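/- arXiv:1808.10368 — 5 statements merged into one kernel-verified Lean document; each statement's English description precedes it below -/
import Mathlib

section
/- For every d ∈ ℕ there is a constant C_d such that the following holds: for every real polynomial Q of degree at most d, every finite set S ⊂ ℤ, and every family {Φ_j}_{j∈S} of C^∞ functions Φ_j : ℝ → ℝ supported in {1/2 ≤ |s| ≤ 2} with ∫_ℝ Φ_j(s) ds = 0 and |Φ_j(s)| ≤ 1, |Φ_j′(s)| ≤ 1 for all s, one has Σ_{j∈S} | ∫_ℝ e^{2πi Q(s)} 2^{−j} Φ_j(2^{−j} s) ds | ≤ C_d. The constant C_d depends only on d, and not on the coefficients of Q, on S, or on the family {Φ_j}. -/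
open MeasureTheory Real

noncomputable section

theorem polynomial_sublevel_bound (n : ℕ) : ∃ K : ℝ, 1 ≤ K ∧
    ∀ R : Polynomial ℝ, R.natDegree ≤ n → ∀ E : Set ℝ, E ⊆ Set.Icc (-3) 3 →
      ∀ m : ℝ, 0 < m → ENNReal.ofReal m ≤ volume E → ∀ κ : ℝ, (∀ x ∈ E, |R.eval x| ≤ κ) →
        ∀ x ∈ Set.Icc (-3 : ℝ) 3,
          |R.eval x| * m ^ n ≤ K * κ ∧ |R.derivative.eval x| * m ^ n ≤ K * κ := by
  have hne : ∀ (E : Set ℝ) (m : ℝ), 0 < m → ENNReal.ofReal m ≤ volume E → E.Nonempty := by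
    intro E m hm hE
    rw [Set.nonempty_iff_ne_empty]
    rintro rfl
    simp at hE
    linarith
  induction n with
  | zero =>
    refine ⟨1, le_rfl, fun R hR E _ m hm hmE κ hκ x _ => ?_⟩
    obtain ⟨a, ha⟩ := hne E m hm hmE
    have h := hκ a ha
    rw [Polynomial.eq_C_of_natDegree_le_zero hR] at h ⊢
    simp only [Polynomial.eval_C, Polynomial.derivative_C, Polynomial.eval_zero, abs_zero,
      pow_zero, mul_one, one_mul] at h ⊢
    exact ⟨h, (abs_nonneg _).trans h⟩
  | succ n ih =>
    obtain ⟨K, hK, ih⟩ := ih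
    refine ⟨7 * (8 * 2 ^ n * K) + 6 ^ (n + 1), ?_, fun R hR E hE m hm hmE κ hκ x hx => ?_⟩
    · have : (1 : ℝ) ≤ 6 ^ (n + 1) := one_le_pow₀ (by norm_num)
      have : (0 : ℝ) ≤ 7 * (8 * 2 ^ n * K) := by positivity
      linarith
    obtain ⟨a, ha⟩ := hne E m hm hmE
    have haI := hE ha
    have hκ0 : 0 ≤ κ := (abs_nonneg _).trans (hκ a ha)
    have hm6 : m ≤ 6 := by
      have h1 := hmE.trans (measure_mono hE)
      rw [Real.volume_Icc, ENNReal.ofReal_le_ofReal_iff (by norm_num)] at h1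
      linarith
    set T := R /ₘ (Polynomial.X - Polynomial.C a) with hT
    have hTdeg : T.natDegree ≤ n := by
      rw [hT, Polynomial.natDegree_divByMonic _ (Polynomial.monic_X_sub_C a),
        Polynomial.natDegree_X_sub_C]
      omega
    have hRT : R = Polynomial.C (R.eval a) + (Polynomial.X - Polynomial.C a) * T := by
      rw [← Polynomial.modByMonic_X_sub_C_eq_C_eval, hT, Polynomial.modByMonic_add_div]
    have hev : ∀ y, R.eval y = R.eval a + (y - a) * T.eval y := by
      intro y
      conv_lhs => rw [hRT]
      simp
    have hdev : ∀ y, R.derivative.eval y = T.eval y + (y - a) * T.derivative.eval y := by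
      intro y
      conv_lhs => rw [hRT]
      simp
    have hE' : ENNReal.ofReal (m / 2) ≤ volume (E \ Set.Ioo (a - m / 4) (a + m / 4)) := by
      refine le_trans ?_ le_measure_sdiff
      rw [Real.volume_Ioo]
      have : a + m / 4 - (a - m / 4) = m / 2 := by ring
      rw [this]
      refine le_trans ?_ (tsub_le_tsub_right hmE _)
      rw [← ENNReal.ofReal_sub _ (by positivity)]
      apply ENNReal.ofReal_le_ofReal
      linarith
    have hTb : ∀ y ∈ E \ Set.Ioo (a - m / 4) (a + m / 4), |T.eval y| ≤ 8 * κ / m := by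
      rintro y ⟨hyE, hy⟩
      have h1 : m / 4 ≤ |y - a| := by
        by_contra! h
        rw [abs_lt] at h
        exact hy ⟨by linarith, by linarith⟩
      have h2 : |y - a| * |T.eval y| ≤ 2 * κ := by
        rw [← abs_mul]
        have : (y - a) * T.eval y = R.eval y - R.eval a := by rw [hev y]; ring
        rw [this]
        refine (abs_sub _ _).trans ?_
        linarith [hκ y hyE, hκ a ha]
      rw [le_div_iff₀ hm]
      nlinarith [abs_nonneg (T.eval y)]
    obtain ⟨h1, h2⟩ :=
      ih T hTdeg _ (Set.sdiff_subset.trans hE) (m / 2) (by positivity) hE' _ hTb x hx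
    have key : ∀ z : ℝ, z * (m / 2) ^ n ≤ K * (8 * κ / m) → z * m ^ (n + 1) ≤ 8 * 2 ^ n * K * κ := by
      intro z hz
      have h3 := mul_le_mul_of_nonneg_right hz (by positivity : 0 ≤ 2 ^ n * m)
      have e1 : z * (m / 2) ^ n * (2 ^ n * m) = z * m ^ (n + 1) := by
        rw [div_pow]; field_simp; ring
      have e2 : K * (8 * κ / m) * (2 ^ n * m) = 8 * 2 ^ n * K * κ := by field_simp
      rwa [e1, e2] at h3
    replace h1 := key _ h1
    replace h2 := key _ h2
    have hxa : |x - a| ≤ 6 := abs_le.2 ⟨by linarith [hx.1, haI.2], by linarith [hx.2, haI.1]⟩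
    have hm1 : 0 < m ^ (n + 1) := by positivity
    have hm2 : m ^ (n + 1) ≤ 6 ^ (n + 1) := by gcongr
    have h3 : |R.eval a| * m ^ (n + 1) ≤ κ * 6 ^ (n + 1) :=
      mul_le_mul (hκ a ha) hm2 hm1.le hκ0
    have h4 : ∀ z : ℝ, |z| * m ^ (n + 1) ≤ 8 * 2 ^ n * K * κ →
        |(x - a) * z| * m ^ (n + 1) ≤ 6 * (8 * 2 ^ n * K * κ) := by
      intro z hz
      rw [abs_mul, mul_assoc]
      exact mul_le_mul hxa hz (by positivity) (by norm_num)
    have h0 : 0 ≤ 8 * 2 ^ n * K * κ := by positivity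
    have h5 : 0 ≤ 6 ^ (n + 1) * κ := by positivity
    rw [hev x, hdev x]
    constructor
    · have := mul_le_mul_of_nonneg_right (abs_add_le (R.eval a) ((x - a) * T.eval x)) hm1.le
      linarith [h4 _ h1]
    · have := mul_le_mul_of_nonneg_right
        (abs_add_le (T.eval x) ((x - a) * T.derivative.eval x)) hm1.le
      linarith [h4 _ h2]

theorem sum_le_of_geometric_decay {r : ℝ} (hr0 : 0 ≤ r) (hr1 : r < 1) (S : Finset ℤ) (f : ℤ → ℝ)
    (hf1 : ∀ j ∈ S, f j ≤ 1)
    (hf : ∀ i ∈ S, ∀ k : ℕ, i + k ∈ S → f i ≤ r ^ k * f (i + k)) :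
    ∑ j ∈ S, f j ≤ (1 - r)⁻¹ := by
  rcases S.eq_empty_or_nonempty with rfl | hS
  · simpa using hr1.le
  set J := S.max' hS with hJ
  have hle : ∀ j ∈ S, j ≤ J := fun j hj => S.le_max' j hj
  calc ∑ j ∈ S, f j ≤ ∑ j ∈ S, r ^ (J - j).toNat := by
        refine Finset.sum_le_sum fun j hj => ?_
        have e : j + ((J - j).toNat : ℤ) = J := by have := hle j hj; omega
        have hJS : J ∈ S := S.max'_mem hS
        have := hf j hj (J - j).toNat (by rwa [e])
        rw [e] at this
        exact this.trans (mul_le_of_le_one_right (by positivity) (hf1 J hJS))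
    _ = ∑ k ∈ S.image (fun j => (J - j).toNat), r ^ k := by
        rw [Finset.sum_image]
        intro i hi j hj h
        have := hle i hi
        have := hle j hj
        simp only at h
        omega
    _ ≤ (1 - r)⁻¹ := by
        rw [← tsum_geometric_of_lt_one hr0 hr1]
        exact (summable_geometric_of_lt_one hr0 hr1).sum_le_tsum _ (fun _ _ => by positivity)

theorem sum_le_of_geometric_growth {ρ : ℝ} (hρ : 1 < ρ) (t : ℤ → ℝ)
    (hgrow : ∀ j, ρ * t j ≤ t (j + 1)) {C : ℝ} (hC : 0 ≤ C) (S : Finset ℤ) (a : ℤ → ℝ)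
    (hsmall : ∀ j ∈ S, t j ≤ 1 → a j ≤ C * t j)
    (hlarge : ∀ j ∈ S, 1 ≤ t j → a j ≤ C * (t j)⁻¹) :
    ∑ j ∈ S, a j ≤ 2 * C * (1 - ρ⁻¹)⁻¹ := by
  have hρ0 : 0 < ρ := by linarith
  have hr0 : 0 ≤ ρ⁻¹ := by positivity
  have hr1 : ρ⁻¹ < 1 := inv_lt_one_of_one_lt₀ hρ
  have hiter : ∀ j, ∀ k : ℕ, ρ ^ k * t j ≤ t (j + k) := by
    intro j k
    induction k with
    | zero => simp
    | succ k ih =>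
      have := hgrow (j + k)
      calc ρ ^ (k + 1) * t j = ρ * (ρ ^ k * t j) := by ring
        _ ≤ ρ * t (j + k) := by gcongr
        _ ≤ _ := by push_cast; rwa [← add_assoc]
  have h1 : ∑ j ∈ S with t j ≤ 1, a j ≤ C * (1 - ρ⁻¹)⁻¹ := by
    refine le_trans ?_ (mul_le_mul_of_nonneg_left
      (sum_le_of_geometric_decay hr0 hr1 {j ∈ S | t j ≤ 1} t (by simp) ?_) hC)
    · rw [Finset.mul_sum]
      refine Finset.sum_le_sum fun j hj => ?_
      rw [Finset.mem_filter] at hj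
      exact hsmall j hj.1 hj.2
    · intro i _ k _
      rw [inv_pow, ← div_eq_inv_mul, le_div_iff₀ (by positivity), mul_comm]
      exact hiter i k
  have h2 : ∑ j ∈ S with ¬ t j ≤ 1, a j ≤ C * (1 - ρ⁻¹)⁻¹ := by
    refine le_trans ?_ (mul_le_mul_of_nonneg_left
      (sum_le_of_geometric_decay hr0 hr1 ({j ∈ S | ¬ t j ≤ 1}.image (fun j => -j))
        (fun j => (t (-j))⁻¹) ?_ ?_) hC)
    · rw [Finset.mul_sum, Finset.sum_image (fun _ _ _ _ h => neg_injective h)]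
      refine Finset.sum_le_sum fun j hj => ?_
      rw [Finset.mem_filter] at hj
      simpa using hlarge j hj.1 (not_le.1 hj.2).le
    · intro j hj
      obtain ⟨i, hi, rfl⟩ := Finset.mem_image.1 hj
      rw [Finset.mem_filter] at hi
      simpa using inv_le_one_of_one_le₀ (not_le.1 hi.2).le
    · intro i _ k hk
      obtain ⟨l, hl, hlk⟩ := Finset.mem_image.1 hk
      rw [Finset.mem_filter] at hl
      have hi : -i = l + k := by omega
      have hik : -(i + k) = l := by omega
      have htl : 0 < t l := by linarith [not_le.1 hl.2]
      simp only [hi, hik]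
      rw [inv_pow, ← mul_inv]
      exact inv_anti₀ (by positivity) (hiter l k)
  rw [← Finset.sum_filter_add_sum_filter_not S (fun j => t j ≤ 1)]
  linarith

theorem norm_exp_polynomial_phase (P : Polynomial ℝ) (s : ℝ) :
    ‖Complex.exp (2 * (π : ℂ) * Complex.I * (P.eval s : ℝ))‖ = 1 := by
  rw [← Complex.norm_exp_ofReal_mul_I (2 * π * P.eval s)]
  push_cast
  ring_nf

theorem norm_oscillatory_integral_le_of_mean_zero (P : Polynomial ℝ) {M : ℝ}
    (hM : ∀ x ∈ Set.Icc (-3 : ℝ) 3, |P.derivative.eval x| ≤ M) (φ : ℝ → ℝ) (hφ : Continuous φ)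
    (hsupp : Function.support φ ⊆ Set.Ioc (-3) 3) (hmean : ∫ s, φ s = 0) (hb : ∀ s, |φ s| ≤ 1) :
    ‖∫ s : ℝ, Complex.exp (2 * (π : ℂ) * Complex.I * (P.eval s : ℝ)) * (φ s : ℂ)‖
      ≤ 36 * π * M := by
  set e : ℝ → ℂ := fun s => Complex.exp (2 * (π : ℂ) * Complex.I * (P.eval s : ℝ)) with he
  have hec : Continuous e := by
    have := P.continuous
    fun_prop
  have hM0 : 0 ≤ M := (abs_nonneg _).trans (hM 0 (by norm_num))
  have hmean' : ∫ s in (-3 : ℝ)..3, (φ s : ℂ) = 0 := by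
    rw [intervalIntegral.integral_ofReal,
      intervalIntegral.integral_eq_integral_of_support_subset hsupp, hmean, Complex.ofReal_zero]
  have hφc : Continuous fun s => (φ s : ℂ) := by fun_prop
  have hsub : ∫ s, e s * (φ s : ℂ) = ∫ s in (-3 : ℝ)..3, (e s - e 0) * (φ s : ℂ) := by
    rw [← intervalIntegral.integral_eq_integral_of_support_subset (a := -3) (b := 3)]
    · simp_rw [sub_mul]
      rw [intervalIntegral.integral_sub (Continuous.intervalIntegrable (by fun_prop) _ _)
        (Continuous.intervalIntegrable (by fun_prop) _ _), intervalIntegral.integral_const_mul,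
        hmean', mul_zero, sub_zero]
    · refine subset_trans (fun s hs => ?_) hsupp
      simp only [Function.mem_support, ne_eq, mul_eq_zero, not_or, Complex.ofReal_eq_zero] at hs
      exact hs.2
  have hdiff : ∀ s ∈ Set.Icc (-3 : ℝ) 3, ‖e s - e 0‖ ≤ 6 * π * M := by
    intro s hs
    have hmv : |P.eval s - P.eval 0| ≤ M * |s - 0| :=
      Convex.norm_image_sub_le_of_norm_deriv_le (𝕜 := ℝ) (f := fun x => P.eval x)
        (s := Set.Icc (-3) 3) (fun x _ => P.differentiableAt)
        (fun x hx => by rw [Polynomial.deriv]; exact hM x hx) (convex_Icc _ _) (by norm_num) hs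
    have hfac : e s - e 0
        = e 0 * (Complex.exp (Complex.I * ((2 * π * (P.eval s - P.eval 0) : ℝ) : ℂ)) - 1) := by
      simp only [he]
      rw [mul_sub, mul_one, ← Complex.exp_add]
      congr 2
      push_cast
      ring
    rw [hfac, norm_mul, he, norm_exp_polynomial_phase, one_mul]
    refine Real.norm_exp_I_mul_ofReal_sub_one_le.trans ?_
    rw [Real.norm_eq_abs, abs_mul, abs_of_pos Real.two_pi_pos]
    have hs3 : |s - 0| ≤ 3 := by rw [sub_zero]; exact abs_le.2 hs
    have := hmv.trans (mul_le_mul_of_nonneg_left hs3 hM0)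
    nlinarith [Real.pi_pos]
  rw [hsub]
  refine (intervalIntegral.norm_integral_le_of_norm_le_const (C := 6 * π * M) ?_).trans ?_
  · intro s hs
    rw [Set.uIoc_of_le (by norm_num)] at hs
    rw [norm_mul, Complex.norm_real, Real.norm_eq_abs]
    exact (mul_le_mul (hdiff s (Set.Ioc_subset_Icc_self hs)) (hb s) (abs_nonneg _)
      (by have := Real.pi_pos; positivity)).trans (mul_one _).le
  · norm_num
    linarith

theorem norm_integral_phase_mul_le (P : Polynomial ℝ) {L μ : ℝ} (hμ : 0 < μ)
    (hL : ∀ x ∈ Set.Icc (-3 : ℝ) 3, |P.derivative.derivative.eval x| ≤ L)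
    (φ : ℝ → ℝ) (hφ : ContDiff ℝ 1 φ)
    (hsupp : Function.support φ ⊆ Set.Ioo (-3) 3)
    (hb : ∀ s, |φ s| ≤ 1) (hb' : ∀ s, |deriv φ s| ≤ 1) :
    ‖∫ s : ℝ, Complex.exp (2 * (π : ℂ) * Complex.I * (P.eval s : ℝ)) * (φ s : ℂ)‖
      ≤ 6 * (μ⁻¹ + L * (μ ^ 2)⁻¹) +
        ∫ s in (-3 : ℝ)..3, μ ^ 2 / (P.derivative.eval s ^ 2 + μ ^ 2) := by
  set e : ℝ → ℂ := fun s => Complex.exp (2 * (π : ℂ) * Complex.I * (P.eval s : ℝ)) with he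
  set R := P.derivative with hR
  set D : ℝ → ℝ := fun s => R.eval s ^ 2 + μ ^ 2 with hD
  have hDpos : ∀ s, 0 < D s := fun s => by positivity
  have hD0 : ∀ s, D s ≠ 0 := fun s => (hDpos s).ne'
  have hec : Continuous e := by
    have := P.continuous
    fun_prop
  have hRc : Continuous fun s => R.eval s := R.continuous
  have hR'c : Continuous fun s => R.derivative.eval s := R.derivative.continuous
  have hDc : Continuous D := by fun_prop
  have hφc : Continuous φ := hφ.continuous
  have hφ'c : Continuous (deriv φ) := hφ.continuous_deriv le_rfl
  set g : ℝ → ℝ := fun s => φ s * (R.eval s / D s) with hg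
  set g' : ℝ → ℝ := fun s => deriv φ s * (R.eval s / D s) +
    φ s * (R.derivative.eval s * (μ ^ 2 - R.eval s ^ 2) / D s ^ 2) with hg'
  have hgd : ∀ s, HasDerivAt g (g' s) s := by
    intro s
    have h1 : HasDerivAt φ (deriv φ s) s := (hφ.differentiable (by norm_num) s).hasDerivAt
    have h2 := R.hasDerivAt s
    have h3 : HasDerivAt D _ s := (h2.pow 2).add_const (μ ^ 2)
    refine (h1.mul (h2.div h3 (hD0 s))).congr_deriv ?_
    simp only [hg', hD, Pi.div_apply]
    congr 3
    push_cast
    ring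
  have hgc : Continuous g := continuous_iff_continuousAt.2 fun s => (hgd s).continuousAt
  have hg'c : Continuous g' :=
    (hφ'c.mul (hRc.div hDc hD0)).add (hφc.mul ((hR'c.mul (by fun_prop)).div (hDc.pow 2)
      fun s => pow_ne_zero 2 (hD0 s)))
  have hed : ∀ s, HasDerivAt e (2 * (π : ℂ) * Complex.I * (R.eval s : ℝ) * e s) s := by
    intro s
    have h := (((P.hasDerivAt s).ofReal_comp.const_mul (2 * (π : ℂ) * Complex.I))).cexp
    refine h.congr_deriv ?_
    simp only [he]
    ring
  have hzero : ∀ s, s ∉ Set.Ioo (-3 : ℝ) 3 → φ s = 0 := fun s hs => by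
    by_contra h
    exact hs (hsupp h)
  have hibp := intervalIntegral.integral_mul_deriv_eq_deriv_mul (a := -3) (b := 3)
    (u := fun s => (g s : ℂ)) (u' := fun s => (g' s : ℂ)) (v := e)
    (fun s _ => (hgd s).ofReal_comp) (fun s _ => hed s)
    ((Complex.continuous_ofReal.comp hg'c).intervalIntegrable _ _)
    (Continuous.intervalIntegrable (by fun_prop) _ _)
  have hg3 : g 3 = 0 := by simp [hg, hzero 3 (by norm_num)]
  have hg3' : g (-3) = 0 := by simp [hg, hzero (-3) (by norm_num)]
  simp only [hg3, hg3', Complex.ofReal_zero, zero_mul, sub_zero, zero_sub] at hibp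
  have hRcC : Continuous fun s => ((R.eval s : ℝ) : ℂ) := by fun_prop
  have hwc : Continuous fun s => μ ^ 2 / D s := continuous_const.div hDc hD0
  have hsplit : ∫ s, e s * (φ s : ℂ) =
      (2 * (π : ℂ) * Complex.I)⁻¹ *
        (∫ s in (-3 : ℝ)..3, (g s : ℂ) * (2 * (π : ℂ) * Complex.I * (R.eval s : ℝ) * e s)) +
      ∫ s in (-3 : ℝ)..3, e s * (φ s : ℂ) * ((μ ^ 2 / D s : ℝ) : ℂ) := by
    rw [← intervalIntegral.integral_const_mul, ← intervalIntegral.integral_add,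
      ← intervalIntegral.integral_eq_integral_of_support_subset (a := -3) (b := 3)]
    · refine intervalIntegral.integral_congr fun s _ => ?_
      have hDs : (D s : ℂ) = ((R.eval s : ℝ) : ℂ) ^ 2 + (μ : ℂ) ^ 2 := by simp [hD]
      have hDs0 : (D s : ℂ) ≠ 0 := by exact_mod_cast hD0 s
      simp only [hg]
      push_cast
      rw [show (2 * (π : ℂ) * Complex.I)⁻¹ * ((φ s : ℂ) * (((R.eval s : ℝ) : ℂ) / (D s : ℂ)) *
        (2 * (π : ℂ) * Complex.I * ((R.eval s : ℝ) : ℂ) * e s)) =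
        e s * (φ s : ℂ) * (((R.eval s : ℝ) : ℂ) ^ 2 / (D s : ℂ)) by field_simp, ← mul_add, ← add_div,
        ← hDs, div_self hDs0, mul_one]
    · refine subset_trans (fun s hs => ?_) (hsupp.trans Set.Ioo_subset_Ioc_self)
      simp only [Function.mem_support, ne_eq, mul_eq_zero, not_or, Complex.ofReal_eq_zero] at hs
      exact hs.2
    · exact Continuous.intervalIntegrable (by fun_prop) _ _
    · exact Continuous.intervalIntegrable (by fun_prop) _ _
  have hL0 : 0 ≤ L := (abs_nonneg _).trans (hL 0 (by norm_num))
  have hw : ∀ s, |R.eval s / D s| ≤ μ⁻¹ := by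
    intro s
    rw [abs_div, abs_of_pos (hDpos s), div_le_iff₀ (hDpos s), inv_mul_eq_div, le_div_iff₀ hμ]
    simp only [hD]
    rw [← sq_abs (R.eval s)]
    nlinarith [sq_nonneg (|R.eval s| - μ), sq_nonneg (|R.eval s|), sq_nonneg μ]
  have hw' : ∀ s, |(μ ^ 2 - R.eval s ^ 2) / D s ^ 2| ≤ (μ ^ 2)⁻¹ := by
    intro s
    have h1 : |μ ^ 2 - R.eval s ^ 2| ≤ D s := by
      rw [abs_le]; constructor <;> simp only [hD] <;> nlinarith [sq_nonneg (R.eval s), sq_nonneg μ]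
    have h2 : μ ^ 2 ≤ D s := by simp only [hD]; nlinarith [sq_nonneg (R.eval s)]
    have := hDpos s
    rw [abs_div, abs_of_pos (pow_pos (hDpos s) 2), div_le_iff₀ (by positivity), inv_mul_eq_div,
      le_div_iff₀ (by positivity)]
    nlinarith
  have hg'b : ∀ s ∈ Set.Icc (-3 : ℝ) 3, |g' s| ≤ μ⁻¹ + L * (μ ^ 2)⁻¹ := by
    intro s hs
    refine (abs_add_le _ _).trans (add_le_add ?_ ?_)
    · rw [abs_mul]
      exact (mul_le_mul (hb' s) (hw s) (abs_nonneg _) zero_le_one).trans (one_mul _).le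
    · rw [mul_div_assoc, abs_mul, abs_mul]
      refine (mul_le_mul (hb s) (mul_le_mul (hL s hs) (hw' s) (abs_nonneg _) hL0)
        (by positivity) zero_le_one).trans (one_mul _).le
  have hfirst : ‖∫ s in (-3 : ℝ)..3, (g' s : ℂ) * e s‖ ≤ 6 * (μ⁻¹ + L * (μ ^ 2)⁻¹) := by
    refine (intervalIntegral.norm_integral_le_of_norm_le_const
      (C := μ⁻¹ + L * (μ ^ 2)⁻¹) ?_).trans ?_
    · intro s hs
      rw [Set.uIoc_of_le (by norm_num)] at hs
      rw [norm_mul, he, norm_exp_polynomial_phase, mul_one, Complex.norm_real]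
      exact hg'b s (Set.Ioc_subset_Icc_self hs)
    · norm_num
      linarith
  have hsecond : ‖∫ s in (-3 : ℝ)..3, e s * (φ s : ℂ) * ((μ ^ 2 / D s : ℝ) : ℂ)‖ ≤
      ∫ s in (-3 : ℝ)..3, μ ^ 2 / D s := by
    refine intervalIntegral.norm_integral_le_of_norm_le (by norm_num)
      (Filter.Eventually.of_forall fun s _ => ?_) (hwc.intervalIntegrable _ _)
    have hpos : 0 ≤ μ ^ 2 / D s := by have := hDpos s; positivity
    rw [norm_mul, norm_mul, he, norm_exp_polynomial_phase, one_mul, Complex.norm_real,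
      Complex.norm_real, Real.norm_of_nonneg hpos]
    exact mul_le_of_le_one_left hpos (hb s)
  rw [hsplit, hibp]
  refine (norm_add_le _ _).trans (add_le_add ?_ hsecond)
  rw [norm_mul, norm_neg]
  refine (mul_le_of_le_one_left (norm_nonneg _) ?_).trans hfirst
  rw [norm_inv]
  apply inv_le_one_of_one_le₀
  simp only [norm_mul, Complex.norm_I, Complex.norm_real, Real.norm_of_nonneg Real.pi_pos.le,
    Complex.norm_ofNat, mul_one]
  linarith [Real.pi_gt_three]

theorem exists_norm_oscillatory_integral_le (d : ℕ) : ∃ C : ℝ, 0 ≤ C ∧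
    ∀ P : Polynomial ℝ, P.natDegree ≤ d → ∀ t : ℝ, 1 ≤ t →
      (∀ x ∈ Set.Icc (-3 : ℝ) 3, |P.derivative.eval x| ≤ t ^ (8 * (d + 1))) →
      (∃ x ∈ Set.Icc (-3 : ℝ) 3, |P.derivative.eval x| = t ^ (8 * (d + 1))) →
      ∀ φ : ℝ → ℝ, ContDiff ℝ 1 φ → Function.support φ ⊆ Set.Ioo (-3) 3 →
        (∀ s, |φ s| ≤ 1) → (∀ s, |deriv φ s| ≤ 1) →
        ‖∫ s : ℝ, Complex.exp (2 * (π : ℂ) * Complex.I * (P.eval s : ℝ)) * (φ s : ℂ)‖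
          ≤ C * t⁻¹ := by
  obtain ⟨K, hK, hsub⟩ := polynomial_sublevel_bound (d + 1)
  refine ⟨6 * (1 + K) + (K + 6), by positivity, fun P hP t ht hM hMx φ hφ hsupp hb hb' => ?_⟩
  set n := d + 1 with hn
  have hn1 : 1 ≤ n := by omega
  set R := P.derivative with hR
  have ht0 : 0 < t := by linarith
  have hRdeg : R.natDegree ≤ n := (P.natDegree_derivative_le).trans (by omega)
  have hL : ∀ x ∈ Set.Icc (-3 : ℝ) 3, |R.derivative.eval x| ≤ K * t ^ (8 * n) := by
    intro x hx
    refine le_trans ?_ (hsub R hRdeg _ subset_rfl 6 (by norm_num)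
      (by rw [Real.volume_Icc]; norm_num) _ hM x hx).2
    exact le_mul_of_one_le_right (abs_nonneg _) (one_le_pow₀ (by norm_num))
  have hmain := norm_integral_phase_mul_le P (pow_pos ht0 (6 * n)) hL φ hφ hsupp hb hb'
  have hinv : ∀ k, 1 ≤ k → (t ^ k)⁻¹ ≤ t⁻¹ := fun k hk =>
    inv_anti₀ ht0 (le_self_pow₀ ht (by omega))
  have h1 : (t ^ (6 * n))⁻¹ ≤ t⁻¹ := hinv _ (by omega)
  have h2 : K * t ^ (8 * n) * ((t ^ (6 * n)) ^ 2)⁻¹ ≤ K * t⁻¹ := by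
    rw [mul_assoc]
    gcongr
    refine le_trans (le_of_eq ?_) (hinv (4 * n) (by omega))
    rw [← pow_mul, show 6 * n * 2 = 8 * n + 4 * n by ring, pow_add]
    field_simp
  set E : Set ℝ := Set.Icc (-3) 3 ∩ {x | |R.eval x| ≤ t ^ (7 * n)} with hE
  have hEmeas : MeasurableSet E := by
    have : IsClosed {x | |R.eval x| ≤ t ^ (7 * n)} :=
      isClosed_le (R.continuous.abs) continuous_const
    exact measurableSet_Icc.inter this.measurableSet
  have hEfin : volume E ≠ ⊤ :=
    ((measure_mono Set.inter_subset_left).trans_lt (by simp [Real.volume_Icc])).ne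
  have hEvol : volume.real E ≤ K * t⁻¹ := by
    rcases (measureReal_nonneg (μ := volume) (s := E)).eq_or_lt with h0 | hpos
    · rw [← h0]; positivity
    obtain ⟨x, hx, hxM⟩ := hMx
    have h3 := (hsub R hRdeg E Set.inter_subset_left _ hpos
      (by rw [ofReal_measureReal hEfin]) _ (fun y hy => hy.2) x hx).1
    rw [hxM, show 8 * n = 7 * n + n by ring, pow_add, mul_assoc, mul_comm K, ← mul_pow] at h3
    have h4 : (t * volume.real E) ^ n ≤ K ^ n :=
      (le_of_mul_le_mul_left h3 (by positivity)).trans (le_self_pow₀ hK (by omega))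
    have h5 := le_of_pow_le_pow_left₀ (by omega) (by positivity) h4
    rw [← div_eq_mul_inv, le_div_iff₀ ht0]
    linarith
  have h3 : ∫ s in (-3 : ℝ)..3, (t ^ (6 * n)) ^ 2 / (R.eval s ^ 2 + (t ^ (6 * n)) ^ 2)
      ≤ (K + 6) * t⁻¹ := by
    have hpt : ∀ s ∈ Set.Ioc (-3 : ℝ) 3,
        (t ^ (6 * n)) ^ 2 / (R.eval s ^ 2 + (t ^ (6 * n)) ^ 2) ≤ E.indicator 1 s + t⁻¹ := by
      intro s hs
      by_cases hsE : s ∈ E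
      · rw [Set.indicator_of_mem hsE, Pi.one_apply]
        have : (t ^ (6 * n)) ^ 2 / (R.eval s ^ 2 + (t ^ (6 * n)) ^ 2) ≤ 1 :=
          div_le_one_of_le₀ (by nlinarith [sq_nonneg (R.eval s)]) (by positivity)
        have : 0 < t⁻¹ := by positivity
        linarith
      · rw [Set.indicator_of_notMem hsE, zero_add]
        have hlt : t ^ (7 * n) < |R.eval s| := by
          by_contra! h
          exact hsE ⟨Set.Ioc_subset_Icc_self hs, h⟩
        have hsq : (t ^ (7 * n)) ^ 2 ≤ R.eval s ^ 2 := by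
          rw [← sq_abs (R.eval s)]
          gcongr
        refine le_trans ?_ (hinv (2 * n) (by omega))
        rw [div_le_iff₀ (by positivity), inv_mul_eq_div, le_div_iff₀ (by positivity)]
        have e : (t ^ (6 * n)) ^ 2 * t ^ (2 * n) = (t ^ (7 * n)) ^ 2 := by ring
        rw [e]
        nlinarith [sq_nonneg (t ^ (6 * n))]
    have hi1 : IntervalIntegrable (E.indicator (1 : ℝ → ℝ)) volume (-3) 3 :=
      ((integrable_indicator_iff hEmeas).2 (integrableOn_const hEfin)).intervalIntegrable
    have hcont : Continuous fun s => (t ^ (6 * n)) ^ 2 / (R.eval s ^ 2 + (t ^ (6 * n)) ^ 2) :=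
      continuous_const.div ((R.continuous.pow 2).add continuous_const)
        fun s => by positivity
    calc _ ≤ ∫ s in (-3 : ℝ)..3, (E.indicator (1 : ℝ → ℝ) s + t⁻¹) := by
          refine intervalIntegral.integral_mono_on_of_le_Ioo (by norm_num)
            (hcont.intervalIntegrable _ _) (hi1.add intervalIntegrable_const)
            fun s hs => hpt s (Set.Ioo_subset_Ioc_self hs)
      _ = (∫ s in (-3 : ℝ)..3, E.indicator (1 : ℝ → ℝ) s) + 6 * t⁻¹ := by
          rw [intervalIntegral.integral_add hi1 intervalIntegrable_const]
          norm_num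
      _ ≤ volume.real E + 6 * t⁻¹ := by
          gcongr
          rw [intervalIntegral.integral_of_le (by norm_num), ← integral_indicator_one hEmeas]
          exact setIntegral_le_integral
            ((integrable_indicator_iff hEmeas).2 (integrableOn_const hEfin))
            (Filter.Eventually.of_forall fun s =>
              Set.indicator_nonneg (fun _ _ => zero_le_one) s)
      _ ≤ (K + 6) * t⁻¹ := by linarith
  linarith

/-- generalized Stein–Wainger bound.  For every `d` there is `C_d` such that
for every real polynomial `Q` of degree `≤ d`, every finite `S ⊂ ℤ`, and every family of
smooth mean-zero amplitudes `Φ_j` supported in `{1/2 ≤ |s| ≤ 2}` with `|Φ_j|, |Φ_j'| ≤ 1`,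
one has `Σ_{j∈S} |∫ e^{2πi Q(s)} 2^{-j} Φ_j(2^{-j}s) ds| ≤ C_d`. -/
theorem generalized_stein_wainger (d : ℕ) :
    ∃ C : ℝ, ∀ Q : Polynomial ℝ, Q.natDegree ≤ d →
      ∀ S : Finset ℤ, ∀ Φ : ℤ → ℝ → ℝ,
        (∀ j ∈ S, ContDiff ℝ (⊤ : ℕ∞) (Φ j) ∧
          (∀ s : ℝ, Φ j s ≠ 0 → 1 / 2 ≤ |s| ∧ |s| ≤ 2) ∧
          (∫ s : ℝ, Φ j s) = 0 ∧
          (∀ s : ℝ, |Φ j s| ≤ 1 ∧ |deriv (Φ j) s| ≤ 1)) →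
        ∑ j ∈ S, ‖∫ s : ℝ, Complex.exp (2 * (π : ℂ) * Complex.I * (Q.eval s : ℝ)) *
            (((2 : ℝ) ^ (-j) * Φ j ((2 : ℝ) ^ (-j) * s) : ℝ) : ℂ)‖ ≤ C := by
  obtain ⟨C, hC, hosc⟩ := exists_norm_oscillatory_integral_le d
  set N := 8 * (d + 1) with hN
  set ρ : ℝ := 2 ^ ((N : ℝ)⁻¹) with hρ
  have hρ1 : 1 < ρ := Real.one_lt_rpow (by norm_num) (by positivity)
  refine ⟨2 * (C + 36 * π) * (1 - ρ⁻¹)⁻¹, fun Q hQ S Φ hΦ => ?_⟩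
  have hmax : ∀ P : Polynomial ℝ, ∃ M : ℝ, (∀ x ∈ Set.Icc (-3 : ℝ) 3, |P.derivative.eval x| ≤ M) ∧
      ∃ x ∈ Set.Icc (-3 : ℝ) 3, |P.derivative.eval x| = M := by
    intro P
    obtain ⟨x, hx, hmx⟩ := (isCompact_Icc (a := (-3 : ℝ)) (b := 3)).exists_isMaxOn
      (Set.nonempty_Icc.2 (by norm_num)) P.derivative.continuous.abs.continuousOn
    exact ⟨_, fun y hy => hmx hy, x, hx, rfl⟩
  set P : ℤ → Polynomial ℝ := fun j => Q.comp (Polynomial.C ((2 : ℝ) ^ j) * Polynomial.X) with hP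
  have hPev : ∀ j s, (P j).eval s = Q.eval ((2 : ℝ) ^ j * s) := by simp [hP]
  have hP'ev : ∀ j s, (P j).derivative.eval s =
      (2 : ℝ) ^ j * Q.derivative.eval ((2 : ℝ) ^ j * s) := by
    simp [hP, Polynomial.derivative_comp]
  have hPdeg : ∀ j, (P j).natDegree ≤ d := by
    intro j
    refine Polynomial.natDegree_comp_le.trans ?_
    refine (Nat.mul_le_mul hQ
      ((Polynomial.natDegree_C_mul_le _ _).trans Polynomial.natDegree_X_le)).trans (mul_one _).le
  choose M hM hMx using fun j => hmax (P j)
  have hM0 : ∀ j, 0 ≤ M j := fun j => (abs_nonneg _).trans (hM j 0 (by norm_num))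
  have hMgrow : ∀ j, 2 * M j ≤ M (j + 1) := by
    intro j
    obtain ⟨x, hx, hxM⟩ := hMx j
    have h := hM (j + 1) (x / 2) ⟨by linarith [hx.1], by linarith [hx.2]⟩
    have e : (2 : ℝ) ^ (j + 1) = 2 * 2 ^ j := by rw [zpow_add_one₀ two_ne_zero]; ring
    rw [hP'ev, e, show 2 * (2 : ℝ) ^ j * (x / 2) = 2 ^ j * x by ring, mul_assoc, ← hP'ev, abs_mul,
      hxM, abs_of_pos two_pos] at h
    exact h
  set t : ℤ → ℝ := fun j => M j ^ ((N : ℝ)⁻¹) with ht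
  have ht0 : ∀ j, 0 ≤ t j := fun j => Real.rpow_nonneg (hM0 j) _
  have htM : ∀ j, t j ^ N = M j := fun j => Real.rpow_inv_natCast_pow (hM0 j) (by omega)
  have htgrow : ∀ j, ρ * t j ≤ t (j + 1) := by
    intro j
    rw [hρ, ht, ← Real.mul_rpow two_pos.le (hM0 j)]
    exact Real.rpow_le_rpow (by linarith [hM0 j]) (hMgrow j) (by positivity)
  have hscale : ∀ j, ∫ s : ℝ, Complex.exp (2 * (π : ℂ) * Complex.I * (Q.eval s : ℝ)) *
      (((2 : ℝ) ^ (-j) * Φ j ((2 : ℝ) ^ (-j) * s) : ℝ) : ℂ) =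
      ∫ s : ℝ, Complex.exp (2 * (π : ℂ) * Complex.I * ((P j).eval s : ℝ)) * (Φ j s : ℂ) := by
    intro j
    have hj : (0 : ℝ) < 2 ^ j := by positivity
    have h := Measure.integral_comp_mul_left (fun s : ℝ =>
      Complex.exp (2 * (π : ℂ) * Complex.I * ((P j).eval s : ℝ)) * (Φ j s : ℂ)) ((2 : ℝ) ^ (-j))
    rw [zpow_neg, inv_inv, abs_of_pos hj] at h
    simp only [hPev, mul_inv_cancel_left₀ hj.ne'] at h
    simp only [hPev, zpow_neg]
    rw [← inv_smul_eq_iff₀ hj.ne', ← integral_smul] at h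
    rw [← h]
    congr 1
    ext s
    rw [Complex.real_smul]
    push_cast
    ring
  have hsupp : ∀ j ∈ S, Function.support (Φ j) ⊆ Set.Ioo (-3) 3 := by
    intro j hj s hs
    have := abs_le.1 ((hΦ j hj).2.1 s hs).2
    exact ⟨by linarith [this.1], by linarith [this.2]⟩
  refine sum_le_of_geometric_growth hρ1 t htgrow (by positivity) S _ ?_ ?_
  · intro j hj htj
    obtain ⟨hsm, _, hmean, hb⟩ := hΦ j hj
    rw [hscale]
    refine (norm_oscillatory_integral_le_of_mean_zero (P j) (hM j) (Φ j) hsm.continuous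
      ((hsupp j hj).trans Set.Ioo_subset_Ioc_self) hmean fun s => (hb s).1).trans ?_
    have hMt : M j ≤ t j := by
      rw [← htM]
      exact pow_le_of_le_one (ht0 j) htj (by omega)
    have := mul_le_mul_of_nonneg_left hMt (by positivity : 0 ≤ 36 * π)
    nlinarith [mul_nonneg hC (ht0 j)]
  · intro j hj htj
    obtain ⟨hsm, _, hmean, hb⟩ := hΦ j hj
    rw [hscale]
    refine (hosc (P j) (hPdeg j) (t j) htj (by rw [htM]; exact hM j) (by rw [htM]; exact hMx j)
      (Φ j) (hsm.of_le (by exact_mod_cast le_top)) (hsupp j hj) (fun s => (hb s).1)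
      fun s => (hb s).2).trans ?_
    have := inv_nonneg.2 (ht0 j)
    gcongr
    linarith [Real.pi_pos]
end
end

section
/- For every d ∈ ℕ there exist N ∈ ℕ and a constant C_d such that for every real polynomial Q (in one variable) of degree at most d, every real number u ≠ 0, every finite set ℱ′ ⊂ ℤ², and every normalized cancellative bump family {φ_I} of order N, one has Σ_{I∈ℱ′} | ∫_ℝ e^{2πi Q(s)} φ_I^{(I)}(s, u) ds | ≤ C_d / |u|. The constant C_d depends only on d and N, and not on the coefficients of Q, on ℱ′, on u, or on the bump family. -/
open MeasureTheory Real

noncomputable section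

/-- A normalized cancellative bump family of order `N`. -/
def IsBumpFamily (N : ℕ) (φ : ℤ × ℤ → ℝ × ℝ → ℝ) : Prop :=
  ∀ I : ℤ × ℤ,
    ContDiff ℝ (⊤ : ℕ∞) (φ I) ∧
    (∀ p : ℝ × ℝ, φ I p ≠ 0 →
      1 / 2 ≤ |p.1| ∧ |p.1| ≤ 2 ∧ 1 / 2 ≤ |p.2| ∧ |p.2| ≤ 2) ∧
    (∀ t : ℝ, (∫ s : ℝ, φ I (s, t)) = 0) ∧
    (∀ s : ℝ, (∫ t : ℝ, φ I (s, t)) = 0) ∧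
    (∀ n : ℕ, n ≤ N → ∀ p : ℝ × ℝ, ‖iteratedFDeriv ℝ n (φ I) p‖ ≤ 1)

/-- `φ_I^{(I)}(s,t) = 2^{-j-k} φ_I(2^{-j} s, 2^{-k} t)` for `I = (j,k)`. -/
def scaledBump (φ : ℤ × ℤ → ℝ × ℝ → ℝ) (I : ℤ × ℤ) (p : ℝ × ℝ) : ℝ :=
  (2 : ℝ) ^ (-(I.1 + I.2)) * φ I ((2 : ℝ) ^ (-I.1) * p.1, (2 : ℝ) ^ (-I.2) * p.2)

/-- The oscillating factor `e^{2πit}`. -/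
def unitPhase (t : ℝ) : ℂ := Complex.exp (2 * (π : ℂ) * Complex.I * (t : ℝ))

lemma norm_unitPhase (t : ℝ) : ‖unitPhase t‖ = 1 := by
  simp [unitPhase, Complex.norm_exp]

lemma unitPhase_add (s t : ℝ) : unitPhase (s + t) = unitPhase s * unitPhase t := by
  simp only [unitPhase, ← Complex.exp_add]
  push_cast
  ring_nf

lemma norm_unitPhase_sub_one_le (t : ℝ) : ‖unitPhase t - 1‖ ≤ 2 * π * |t| := by
  have h := Real.norm_exp_I_mul_ofReal_sub_one_le (x := 2 * π * t)
  rw [Real.norm_eq_abs, abs_mul, abs_of_pos Real.two_pi_pos] at h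
  convert h using 3
  rw [unitPhase]
  push_cast
  ring_nf

lemma hasDerivAt_unitPhase (t : ℝ) :
    HasDerivAt unitPhase (2 * (π : ℂ) * Complex.I * unitPhase t) t := by
  have h1 : HasDerivAt (fun t : ℝ => 2 * (π : ℂ) * Complex.I * (t : ℂ))
      (2 * (π : ℂ) * Complex.I * 1) t :=
    (Complex.ofRealCLM.hasDerivAt (x := t)).const_mul _
  have h := h1.cexp
  refine h.congr_deriv ?_
  simp only [unitPhase]
  ring

lemma continuous_unitPhase : Continuous unitPhase :=
  continuous_iff_continuousAt.2 fun t => (hasDerivAt_unitPhase t).continuousAt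

open Polynomial in
lemma abs_eval_le_of_abs_coeff_le {d : ℕ} {P : ℝ[X]} (hd : P.natDegree ≤ d) {A x : ℝ}
    (hA : ∀ m, |P.coeff m| ≤ A) (hx : |x| ≤ 3) : |P.eval x| ≤ (d + 1) * 3 ^ d * A := by
  have hA0 : 0 ≤ A := (abs_nonneg _).trans (hA 0)
  rw [eval_eq_sum_range' (Nat.lt_succ_of_le hd)]
  calc _ ≤ ∑ i ∈ Finset.range (d + 1), |P.coeff i * x ^ i| := Finset.abs_sum_le_sum_abs _ _
    _ ≤ ∑ i ∈ Finset.range (d + 1), A * 3 ^ d := by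
        refine Finset.sum_le_sum fun i hi => ?_
        rw [abs_mul, abs_pow]
        have h1 : |x| ^ i ≤ 3 ^ d := (pow_le_pow_left₀ (abs_nonneg x) hx i).trans
          (pow_le_pow_right₀ (by norm_num) (Nat.lt_succ_iff.1 (Finset.mem_range.1 hi)))
        exact mul_le_mul (hA i) h1 (by positivity) hA0
    _ = _ := by simp; ring

lemma max_one_norm_mul_le_norm_sub {x r : ℝ} (hx : |x| ≤ 3) (hr : 0 ≤ r) (hr1 : r ≤ 1) {z : ℂ}
    (hz : r ≤ |x - z.re|) : max 1 ‖z‖ * (r / 6) ≤ ‖(x : ℂ) - z‖ := by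
  have h1 : |x - z.re| ≤ ‖(x : ℂ) - z‖ := by simpa using Complex.abs_re_le_norm ((x : ℂ) - z)
  rcases le_total ‖z‖ 6 with h | h
  · have : max 1 ‖z‖ ≤ 6 := max_le (by norm_num) h
    nlinarith
  · rw [max_eq_right (by linarith)]
    have h2 : ‖z‖ - ‖(x : ℂ)‖ ≤ ‖(x : ℂ) - z‖ := by
      rw [norm_sub_rev]; exact norm_sub_norm_le _ _
    rw [Complex.norm_real, Real.norm_eq_abs] at h2
    nlinarith

open Polynomial in
lemma mahlerMeasure_mul_pow_le_norm_eval (R : ℂ[X]) {x r : ℝ} (hx : |x| ≤ 3) (hr : 0 ≤ r)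
    (hr1 : r ≤ 1) (hz : ∀ z ∈ R.roots, r ≤ |x - z.re|) :
    R.mahlerMeasure * (r / 6) ^ R.natDegree ≤ ‖R.eval (x : ℂ)‖ := by
  have key : ∀ s : Multiset ℂ, (∀ z ∈ s, r ≤ |x - z.re|) →
      (s.map fun a => max 1 ‖a‖).prod * (r / 6) ^ s.card ≤
        ‖(s.map fun a => (x : ℂ) - a).prod‖ := by
    intro s
    induction s using Multiset.induction with
    | empty => simp
    | cons a s ih =>
      intro h
      simp only [Multiset.map_cons, Multiset.prod_cons, Multiset.card_cons, norm_mul, pow_succ]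
      have h1 := max_one_norm_mul_le_norm_sub hx hr hr1 (h a (Multiset.mem_cons_self a s))
      have h2 := ih fun z hz => h z (Multiset.mem_cons_of_mem hz)
      have h3 := mul_le_mul h1 h2 (mul_nonneg (Multiset.prod_nonneg (by
        simp only [Multiset.mem_map]; rintro _ ⟨a, -, rfl⟩; positivity)) (by positivity))
        (norm_nonneg _)
      linarith
  have hs := IsAlgClosed.splits R
  rw [mahlerMeasure_eq_leadingCoeff_mul_prod_roots, hs.eval_eq_prod_roots, norm_mul, mul_assoc,
    hs.natDegree_eq_card_roots]
  exact mul_le_mul_of_nonneg_left (key _ hz) (norm_nonneg _)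

open Polynomial in
lemma abs_coeff_mul_pow_le_abs_eval {d : ℕ} {R : ℝ[X]} (hd : R.natDegree ≤ d) (m : ℕ) {x r : ℝ}
    (hx : |x| ≤ 3) (hr : 0 ≤ r) (hr1 : r ≤ 1)
    (hz : ∀ z ∈ (R.map Complex.ofRealHom).roots, r ≤ |x - z.re|) :
    |R.coeff m| * (r / 12) ^ d ≤ |R.eval x| := by
  have h := mahlerMeasure_mul_pow_le_norm_eval _ hx hr hr1 hz
  have hev : ‖(R.map Complex.ofRealHom).eval (x : ℂ)‖ = |R.eval x| := by
    have := eval_map_apply (p := R) Complex.ofRealHom x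
    rw [Complex.ofRealHom_eq_coe, Complex.ofRealHom_eq_coe] at this
    rw [this, Complex.norm_real, Real.norm_eq_abs]
  have hn : (R.map Complex.ofRealHom).natDegree ≤ d := natDegree_map_le.trans hd
  rw [hev] at h
  refine le_trans ?_ h
  have hM := (R.map Complex.ofRealHom).norm_coeff_le_choose_mul_mahlerMeasure m
  have hc : (((R.map Complex.ofRealHom).natDegree.choose m : ℕ) : ℝ) ≤ 2 ^ d := by
    calc (((R.map Complex.ofRealHom).natDegree.choose m : ℕ) : ℝ)
        ≤ 2 ^ (R.map Complex.ofRealHom).natDegree := by exact_mod_cast Nat.choose_le_two_pow _ _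
      _ ≤ 2 ^ d := pow_le_pow_right₀ (by norm_num) hn
  rw [coeff_map, Complex.ofRealHom_eq_coe, Complex.norm_real, Real.norm_eq_abs] at hM
  have hM0 := (R.map Complex.ofRealHom).mahlerMeasure_nonneg
  calc |R.coeff m| * (r / 12) ^ d
      ≤ (2 ^ d * (R.map Complex.ofRealHom).mahlerMeasure) * (r / 12) ^ d := by
        gcongr
        exact hM.trans (mul_le_mul_of_nonneg_right hc hM0)
    _ = (R.map Complex.ofRealHom).mahlerMeasure * (r / 6) ^ d := by
        rw [show r / 6 = 2 * (r / 12) by ring, mul_pow]; ring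
    _ ≤ _ := mul_le_mul_of_nonneg_left
        (pow_le_pow_of_le_one (by positivity) (by linarith) hn) hM0

lemma intervalIntegral_indicator_Icc_le (a r : ℝ) (hr : 0 ≤ r) :
    ∫ x in (-3 : ℝ)..3, (Set.Icc (a - r) (a + r)).indicator (fun _ => (1 : ℝ)) x ≤ 2 * r := by
  rw [intervalIntegral.integral_of_le (by norm_num)]
  calc _ ≤ ∫ x, (Set.Icc (a - r) (a + r)).indicator (fun _ => (1 : ℝ)) x := by
        refine setIntegral_le_integral ?_ ?_
        · exact (integrable_indicator_iff measurableSet_Icc).2 (by simp)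
        · exact Filter.Eventually.of_forall fun x => Set.indicator_nonneg (by simp) x
    _ = 2 * r := by
        rw [integral_indicator_const _ measurableSet_Icc, Real.volume_real_Icc_of_le (by linarith)]
        simp; ring

open Polynomial in
lemma intervalIntegral_smoothed_sublevel_le {d : ℕ} {R : ℝ[X]} (hd : R.natDegree ≤ d) (m : ℕ)
    (hm : R.coeff m ≠ 0) {r l : ℝ} (hr : 0 < r) (hr1 : r ≤ 1) (hl : 0 < l) :
    ∫ x in (-3 : ℝ)..3, l ^ 2 / (R.eval x ^ 2 + l ^ 2) ≤
      2 * d * r + 6 * (l ^ 2 / (|R.coeff m| * (r / 12) ^ d) ^ 2) := by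
  classical
  set Z := (R.map Complex.ofRealHom).roots.toFinset with hZ
  set B := |R.coeff m| * (r / 12) ^ d with hB
  have hBpos : 0 < B := by have := abs_pos.2 hm; positivity
  have hcard : (Z.card : ℝ) ≤ d := by
    exact_mod_cast (Multiset.toFinset_card_le _).trans
      ((card_roots' _).trans (natDegree_map_le.trans hd))
  have hind : ∀ z : ℂ, IntervalIntegrable
      (fun x => (Set.Icc (z.re - r) (z.re + r)).indicator (fun _ => (1 : ℝ)) x) volume (-3) 3 :=
    fun z => ((integrable_indicator_iff measurableSet_Icc).2 (by simp)).intervalIntegrable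
  have hsum : IntervalIntegrable (fun x => ∑ z ∈ Z,
      (Set.Icc (z.re - r) (z.re + r)).indicator (fun _ => (1 : ℝ)) x) volume (-3) 3 := by
    have := IntervalIntegrable.sum Z (fun z _ => hind z)
    rwa [Finset.sum_fn] at this
  calc _ ≤ ∫ x in (-3 : ℝ)..3, ((∑ z ∈ Z,
        (Set.Icc (z.re - r) (z.re + r)).indicator (fun _ => (1 : ℝ)) x) + l ^ 2 / B ^ 2) := by
        refine intervalIntegral.integral_mono_on (by norm_num) ?_
          (hsum.add intervalIntegrable_const) fun x hx => ?_
        · refine Continuous.intervalIntegrable ?_ _ _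
          exact continuous_const.div (by fun_prop) fun x => by positivity
        · have hnn : ∀ z ∈ Z,
              0 ≤ (Set.Icc (z.re - r) (z.re + r)).indicator (fun _ => (1 : ℝ)) x :=
            fun z _ => Set.indicator_nonneg (by simp) x
          by_cases h : ∀ z ∈ (R.map Complex.ofRealHom).roots, r ≤ |x - z.re|
          · have h1 := abs_coeff_mul_pow_le_abs_eval hd m (abs_le.2 hx) hr.le hr1 h
            have h2 : B ^ 2 ≤ R.eval x ^ 2 := by
              rw [← sq_abs (R.eval x)]
              exact pow_le_pow_left₀ hBpos.le h1 2
            have h3 : l ^ 2 / (R.eval x ^ 2 + l ^ 2) ≤ l ^ 2 / B ^ 2 := by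
              gcongr
              nlinarith
            linarith [Finset.sum_nonneg hnn]
          · push Not at h
            obtain ⟨z, hz, hzx⟩ := h
            have h1 := Finset.single_le_sum hnn (Multiset.mem_toFinset.2 hz)
            have h2 := abs_lt.1 hzx
            rw [Set.indicator_of_mem (Set.mem_Icc.2 ⟨by linarith, by linarith⟩)] at h1
            have h3 : l ^ 2 / (R.eval x ^ 2 + l ^ 2) ≤ 1 := by
              rw [div_le_one (by positivity)]
              nlinarith [sq_nonneg (R.eval x)]
            have : 0 ≤ l ^ 2 / B ^ 2 := by positivity
            linarith
    _ ≤ _ := by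
        rw [intervalIntegral.integral_add hsum intervalIntegrable_const,
          intervalIntegral.integral_finsetSum fun z _ => hind z, intervalIntegral.integral_const]
        have h1 : ∑ z ∈ Z, (∫ x in (-3 : ℝ)..3,
            (Set.Icc (z.re - r) (z.re + r)).indicator (fun _ => (1 : ℝ)) x) ≤ Z.card * (2 * r) := by
          rw [← nsmul_eq_mul]
          exact Finset.sum_le_card_nsmul _ _ _ fun z _ =>
            intervalIntegral_indicator_Icc_le z.re r hr.le
        have h2 : (Z.card : ℝ) * (2 * r) ≤ d * (2 * r) := by gcongr
        simp only [smul_eq_mul]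
        linarith

open Polynomial in
lemma norm_integral_unitPhase_nonstationary_le (P : ℝ[X]) {D l : ℝ} (hl : 0 < l)
    (hD : ∀ x : ℝ, |x| ≤ 3 → |P.derivative.derivative.eval x| ≤ D) {ψ ψ' : ℝ → ℝ}
    (hψ : ∀ x, HasDerivAt ψ (ψ' x) x) (hψ'c : Continuous ψ') (h0 : ∀ x, |ψ x| ≤ 1)
    (h1 : ∀ x, |ψ' x| ≤ 1) (hneg : ψ (-3) = 0) (hpos : ψ 3 = 0) :
    ‖∫ x in (-3 : ℝ)..3, unitPhase (P.eval x) *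
      ((P.derivative.eval x ^ 2 / (P.derivative.eval x ^ 2 + l ^ 2) * ψ x : ℝ) : ℂ)‖ ≤
      6 * (1 / l + D / l ^ 2) := by
  set R := P.derivative with hR
  have hψc : Continuous ψ := continuous_iff_continuousAt.2 fun x => (hψ x).continuousAt
  have hden : ∀ x : ℝ, 0 < R.eval x ^ 2 + l ^ 2 := fun x => by positivity
  let G : ℝ → ℝ := fun x => R.eval x * ψ x / (R.eval x ^ 2 + l ^ 2)
  let G' : ℝ → ℝ := fun x => ((R.derivative.eval x * ψ x + R.eval x * ψ' x) *
    (R.eval x ^ 2 + l ^ 2) - R.eval x * ψ x * (2 * R.eval x * R.derivative.eval x)) /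
      (R.eval x ^ 2 + l ^ 2) ^ 2
  have hG : ∀ x, HasDerivAt G (G' x) x := fun x => by
    have hsq : HasDerivAt (fun x => R.eval x ^ 2 + l ^ 2)
        (2 * R.eval x * R.derivative.eval x) x := by
      simpa using ((R.hasDerivAt x).pow 2).add_const (l ^ 2)
    exact ((R.hasDerivAt x).mul (hψ x)).div hsq (hden x).ne'
  have hG'c : Continuous G' :=
    Continuous.div (by fun_prop) (by fun_prop) fun x => (pow_pos (hden x) 2).ne'
  have hGc : Continuous G := continuous_iff_continuousAt.2 fun x => (hG x).continuousAt
  have hec : Continuous fun x => unitPhase (P.eval x) := continuous_unitPhase.comp P.continuous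
  have hF : ∀ x, HasDerivAt (fun x => unitPhase (P.eval x) * (G x : ℂ))
      (2 * (π : ℂ) * Complex.I * (unitPhase (P.eval x) * ((R.eval x * G x : ℝ) : ℂ)) +
        unitPhase (P.eval x) * (G' x : ℂ)) x := fun x => by
    have he := (hasDerivAt_unitPhase (P.eval x)).scomp x (P.hasDerivAt x)
    refine (he.mul (hG x).ofReal_comp).congr_deriv ?_
    rw [Complex.real_smul]
    push_cast
    simp only [Function.comp]
    ring
  have hcont1 : Continuous fun x => unitPhase (P.eval x) * ((R.eval x * G x : ℝ) : ℂ) :=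
    hec.mul (Complex.continuous_ofReal.comp (R.continuous.mul hGc))
  have hcont2 : Continuous fun x => unitPhase (P.eval x) * (G' x : ℂ) :=
    hec.mul (Complex.continuous_ofReal.comp hG'c)
  have hcont0 : Continuous fun x =>
      2 * (π : ℂ) * Complex.I * (unitPhase (P.eval x) * ((R.eval x * G x : ℝ) : ℂ)) :=
    continuous_const.mul hcont1
  have hFTC := intervalIntegral.integral_eq_sub_of_hasDerivAt (a := -3) (b := 3)
    (fun x _ => hF x) ((hcont0.add hcont2).intervalIntegrable _ _)
  rw [intervalIntegral.integral_add (hcont0.intervalIntegrable _ _)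
    (hcont2.intervalIntegrable _ _), intervalIntegral.integral_const_mul] at hFTC
  simp only [G, hneg, hpos, mul_zero, zero_div, Complex.ofReal_zero, sub_zero] at hFTC
  have hbound : ∀ x ∈ Set.uIoc (-3 : ℝ) 3, ‖unitPhase (P.eval x) * (G' x : ℂ)‖ ≤
      1 / l + D / l ^ 2 := fun x hx => by
    rw [Set.uIoc_of_le (by norm_num)] at hx
    have hDx := hD x (abs_le.2 ⟨hx.1.le, hx.2⟩)
    rw [norm_mul, norm_unitPhase, one_mul, Complex.norm_real, Real.norm_eq_abs]
    have hsplit : G' x = ψ' x * (R.eval x / (R.eval x ^ 2 + l ^ 2)) +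
        R.derivative.eval x * ψ x *
          ((l ^ 2 - R.eval x ^ 2) / (R.eval x ^ 2 + l ^ 2)) * (1 / (R.eval x ^ 2 + l ^ 2)) := by
      have := (hden x).ne'
      simp only [G']
      field_simp
      ring
    have e1 : |R.eval x / (R.eval x ^ 2 + l ^ 2)| ≤ 1 / l := by
      rw [abs_div, abs_of_pos (hden x), div_le_div_iff₀ (hden x) hl]
      nlinarith [sq_nonneg (|R.eval x| - l), sq_abs (R.eval x), abs_nonneg (R.eval x)]
    have e2 : |(l ^ 2 - R.eval x ^ 2) / (R.eval x ^ 2 + l ^ 2)| ≤ 1 := by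
      rw [abs_div, abs_of_pos (hden x), div_le_one (hden x), abs_le]
      constructor <;> nlinarith [sq_nonneg (R.eval x), sq_nonneg l]
    have e3 : |1 / (R.eval x ^ 2 + l ^ 2)| ≤ 1 / l ^ 2 := by
      rw [abs_of_pos (by have := hden x; positivity)]
      exact one_div_le_one_div_of_le (by positivity) (by nlinarith [sq_nonneg (R.eval x)])
    have hD0 : 0 ≤ D := (abs_nonneg _).trans hDx
    rw [hsplit]
    refine (abs_add_le _ _).trans (add_le_add ?_ ?_)
    · rw [abs_mul]
      calc _ ≤ 1 * (1 / l) := mul_le_mul (h1 x) e1 (abs_nonneg _) zero_le_one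
        _ = _ := one_mul _
    · rw [abs_mul, abs_mul, abs_mul]
      calc _ ≤ D * 1 * 1 * (1 / l ^ 2) := by
            gcongr
            exact h0 x
        _ = _ := by ring
  have hI := intervalIntegral.norm_integral_le_of_norm_le_const hbound
  have hrew : ∀ x, ((R.eval x ^ 2 / (R.eval x ^ 2 + l ^ 2) * ψ x : ℝ) : ℂ) =
      ((R.eval x * G x : ℝ) : ℂ) := fun x => by
    congr 1
    simp only [G]
    ring
  simp only [hrew]
  have hnorm := congrArg norm (eq_neg_of_add_eq_zero_left hFTC)
  rw [norm_neg, norm_mul] at hnorm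
  have hpi : ‖2 * (π : ℂ) * Complex.I‖ = 2 * π := by
    simp [abs_of_pos Real.pi_pos]
  rw [hpi] at hnorm
  have hpi1 : 1 ≤ 2 * π := by linarith [Real.pi_gt_three]
  calc _ ≤ 2 * π * ‖∫ x in (-3 : ℝ)..3, unitPhase (P.eval x) * ((R.eval x * G x : ℝ) : ℂ)‖ :=
        le_mul_of_one_le_left (norm_nonneg _) hpi1
    _ ≤ (1 / l + D / l ^ 2) * |3 - -3| := hnorm.trans_le hI
    _ = _ := by norm_num; ring

open Polynomial in
lemma norm_integral_unitPhase_le_inv {d m : ℕ} {P : ℝ[X]} (hd : P.natDegree ≤ d)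
    {T : ℝ} (hT : 1 ≤ T) (hmax : ∀ k, |P.coeff (k + 1)| ≤ |P.coeff (m + 1)|)
    (hm : |P.coeff (m + 1)| = T ^ (8 * (d + 1))) {ψ ψ' : ℝ → ℝ}
    (hψ : ∀ x, HasDerivAt ψ (ψ' x) x) (hψ'c : Continuous ψ') (h0 : ∀ x, |ψ x| ≤ 1)
    (h1 : ∀ x, |ψ' x| ≤ 1) (hneg : ψ (-3) = 0) (hpos : ψ 3 = 0) :
    ‖∫ x in (-3 : ℝ)..3, unitPhase (P.eval x) * (ψ x : ℂ)‖ ≤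
      (6 + 6 * ((d + 1) * 3 ^ d * (d + 2) ^ 2) + 2 * d + 6 * 144 ^ d) * T⁻¹ := by
  set R := P.derivative with hR
  set n := d + 1 with hn
  have hT0 : 0 < T := by linarith
  have hRd : R.natDegree ≤ d := (natDegree_derivative_le P).trans (by omega)
  have hR'd : R.derivative.natDegree ≤ d := (natDegree_derivative_le R).trans (by omega)
  set l := T ^ (6 * n) with hl
  have hl0 : 0 < l := by positivity
  set K : ℝ := (d + 1) * 3 ^ d * (d + 2) ^ 2 with hK
  have hD : ∀ x : ℝ, |x| ≤ 3 → |R.derivative.eval x| ≤ K * T ^ (8 * n) := fun x hx => by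
    have hA : ∀ k, |R.derivative.coeff k| ≤ (d + 2) ^ 2 * T ^ (8 * n) := fun k => by
      rcases le_or_gt k d with hk | hk
      · rw [coeff_derivative, hR, coeff_derivative, abs_mul, abs_mul,
          abs_of_nonneg (by positivity : (0 : ℝ) ≤ ((k + 1 : ℕ) : ℝ) + 1),
          abs_of_nonneg (by positivity : (0 : ℝ) ≤ (k : ℝ) + 1), ← hm]
        have hk' : (k : ℝ) ≤ d := by exact_mod_cast hk
        have h2 := hmax (k + 1)
        calc _ ≤ |P.coeff (m + 1)| * (d + 2) * (d + 2) := by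
              refine mul_le_mul (mul_le_mul h2 ?_ (by positivity) (abs_nonneg _)) ?_
                (by positivity) (by positivity)
              · push_cast; linarith
              · linarith
          _ = _ := by ring
      · rw [coeff_eq_zero_of_natDegree_lt (by omega), abs_zero]
        positivity
    have h := abs_eval_le_of_abs_coeff_le hR'd hA hx
    rw [hK]
    linarith
  have hRm : R.coeff m = P.coeff (m + 1) * (m + 1) := coeff_derivative P m
  have hRm1 : T ^ (8 * n) ≤ |R.coeff m| := by
    rw [hRm, abs_mul, hm, abs_of_nonneg (by positivity : (0 : ℝ) ≤ m + 1)]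
    exact le_mul_of_one_le_right (by positivity) (by linarith [m.cast_nonneg (α := ℝ)])
  have hRm0 : R.coeff m ≠ 0 := by
    intro h
    rw [h, abs_zero] at hRm1
    have : 0 < T ^ (8 * n) := by positivity
    linarith
  have hns := norm_integral_unitPhase_nonstationary_le P hl0 hD hψ hψ'c h0 h1 hneg hpos
  have hsl := intervalIntegral_smoothed_sublevel_le hRd m hRm0 (inv_pos.2 hT0)
    (inv_le_one_of_one_le₀ hT) hl0
  have hψc : Continuous ψ := continuous_iff_continuousAt.2 fun x => (hψ x).continuousAt
  have hec : Continuous fun x => unitPhase (P.eval x) := continuous_unitPhase.comp P.continuous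
  have hden : ∀ x : ℝ, 0 < R.eval x ^ 2 + l ^ 2 := fun x => by positivity
  have hwc : Continuous fun x => l ^ 2 / (R.eval x ^ 2 + l ^ 2) :=
    continuous_const.div (by fun_prop) fun x => (hden x).ne'
  have hvc : Continuous fun x => R.eval x ^ 2 / (R.eval x ^ 2 + l ^ 2) :=
    Continuous.div (by fun_prop) (by fun_prop) fun x => (hden x).ne'
  have hsplit : ∫ x in (-3 : ℝ)..3, unitPhase (P.eval x) * (ψ x : ℂ) =
      (∫ x in (-3 : ℝ)..3, unitPhase (P.eval x) *
        ((R.eval x ^ 2 / (R.eval x ^ 2 + l ^ 2) * ψ x : ℝ) : ℂ)) +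
      ∫ x in (-3 : ℝ)..3, unitPhase (P.eval x) *
        ((l ^ 2 / (R.eval x ^ 2 + l ^ 2) * ψ x : ℝ) : ℂ) := by
    have c1 : Continuous fun x => unitPhase (P.eval x) *
        ((R.eval x ^ 2 / (R.eval x ^ 2 + l ^ 2) * ψ x : ℝ) : ℂ) :=
      hec.mul (Complex.continuous_ofReal.comp (hvc.mul hψc))
    have c2 : Continuous fun x => unitPhase (P.eval x) *
        ((l ^ 2 / (R.eval x ^ 2 + l ^ 2) * ψ x : ℝ) : ℂ) :=
      hec.mul (Complex.continuous_ofReal.comp (hwc.mul hψc))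
    rw [← intervalIntegral.integral_add (c1.intervalIntegrable _ _) (c2.intervalIntegrable _ _)]
    refine intervalIntegral.integral_congr fun x _ => ?_
    rw [← mul_add, ← Complex.ofReal_add, ← add_mul, ← add_div, div_self (hden x).ne', one_mul]
  have hstat : ‖∫ x in (-3 : ℝ)..3, unitPhase (P.eval x) *
        ((l ^ 2 / (R.eval x ^ 2 + l ^ 2) * ψ x : ℝ) : ℂ)‖ ≤
      ∫ x in (-3 : ℝ)..3, l ^ 2 / (R.eval x ^ 2 + l ^ 2) := by
    refine intervalIntegral.norm_integral_le_of_norm_le (by norm_num)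
      (Filter.Eventually.of_forall fun x _ => ?_) (hwc.intervalIntegrable _ _)
    rw [norm_mul, norm_unitPhase, one_mul, Complex.norm_real, Real.norm_eq_abs, abs_mul,
      abs_of_pos (by have := hden x; positivity)]
    exact mul_le_of_le_one_right (by have := hden x; positivity) (h0 x)
  have hle : ∀ k : ℕ, k ≠ 0 → (T ^ k)⁻¹ ≤ T⁻¹ := fun k hk =>
    inv_anti₀ hT0 (le_self_pow₀ hT hk)
  have b1 : 1 / l ≤ T⁻¹ := by
    rw [one_div]
    exact hle _ (by omega)
  have b2 : K * T ^ (8 * n) / l ^ 2 ≤ K * T⁻¹ := by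
    have : K * T ^ (8 * n) / l ^ 2 = K * (T ^ (4 * n))⁻¹ := by
      rw [hl]
      field_simp
      ring
    rw [this]
    exact mul_le_mul_of_nonneg_left (hle _ (by omega)) (by positivity)
  have b3 : l ^ 2 / (|R.coeff m| * (T⁻¹ / 12) ^ d) ^ 2 ≤ 144 ^ d * T⁻¹ := by
    calc l ^ 2 / (|R.coeff m| * (T⁻¹ / 12) ^ d) ^ 2
        ≤ l ^ 2 / (T ^ (8 * n) * (T⁻¹ / 12) ^ d) ^ 2 := by gcongr
      _ = 144 ^ d * (T ^ (2 * d + 4))⁻¹ := by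
          rw [hl, div_pow, inv_pow, show (144 : ℝ) = 12 ^ 2 by norm_num, ← pow_mul, ← pow_mul]
          rw [show 8 * n = 6 * n + d + d + 2 by omega]
          field_simp
          ring
      _ ≤ _ := mul_le_mul_of_nonneg_left (hle _ (by omega)) (by positivity)
  rw [hsplit]
  refine (norm_add_le _ _).trans ?_
  have := hstat.trans hsl
  linarith

open Polynomial in
lemma norm_integral_unitPhase_le_coeff {d : ℕ} {P : ℝ[X]} (hd : P.natDegree ≤ d) {L : ℝ}
    (hL : ∀ k, |P.coeff (k + 1)| ≤ L) {ψ : ℝ → ℝ} (hψc : Continuous ψ) (h0 : ∀ x, |ψ x| ≤ 1)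
    (hmean : ∫ x in (-3 : ℝ)..3, ψ x = 0) :
    ‖∫ x in (-3 : ℝ)..3, unitPhase (P.eval x) * (ψ x : ℂ)‖ ≤
      12 * π * ((d + 1) * 3 ^ d) * L := by
  have hL0 : 0 ≤ L := (abs_nonneg _).trans (hL 0)
  set c := P.coeff 0 with hc
  have hPc : ∀ x : ℝ, |x| ≤ 3 → |P.eval x - c| ≤ (d + 1) * 3 ^ d * L := fun x hx => by
    have h : |(P - C c).eval x| ≤ (d + 1) * 3 ^ d * L := by
      refine abs_eval_le_of_abs_coeff_le ((natDegree_sub_C (p := P)).trans_le hd) (fun m => ?_) hx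
      cases m with
      | zero => simpa [hc] using hL0
      | succ k => simpa [coeff_C_succ] using hL k
    simpa using h
  have hec : Continuous fun x => unitPhase (P.eval x - c) :=
    continuous_unitPhase.comp (P.continuous.sub continuous_const)
  have hψC : Continuous fun x => (ψ x : ℂ) := Complex.continuous_ofReal.comp hψc
  have hc1 : Continuous fun x => (unitPhase (P.eval x - c) - 1) * (ψ x : ℂ) :=
    (hec.sub continuous_const).mul hψC
  have hmeanC : ∫ x in (-3 : ℝ)..3, (ψ x : ℂ) = 0 := by
    rw [intervalIntegral.integral_ofReal, hmean, Complex.ofReal_zero]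
  have hsplit : ∫ x in (-3 : ℝ)..3, unitPhase (P.eval x) * (ψ x : ℂ) =
      unitPhase c * ∫ x in (-3 : ℝ)..3, (unitPhase (P.eval x - c) - 1) * (ψ x : ℂ) := by
    calc _ = unitPhase c * ((∫ x in (-3 : ℝ)..3, (unitPhase (P.eval x - c) - 1) * (ψ x : ℂ)) +
          ∫ x in (-3 : ℝ)..3, (ψ x : ℂ)) := by
          rw [← intervalIntegral.integral_add (hc1.intervalIntegrable _ _)
            (hψC.intervalIntegrable _ _), ← intervalIntegral.integral_const_mul]
          refine intervalIntegral.integral_congr fun x _ => ?_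
          have := unitPhase_add c (P.eval x - c)
          rw [add_sub_cancel] at this
          simp only [this]
          ring
      _ = _ := by rw [hmeanC, add_zero]
  rw [hsplit, norm_mul, norm_unitPhase, one_mul]
  have hb : ∀ x ∈ Set.uIoc (-3 : ℝ) 3, ‖(unitPhase (P.eval x - c) - 1) * (ψ x : ℂ)‖ ≤
      2 * π * ((d + 1) * 3 ^ d * L) := fun x hx => by
    rw [Set.uIoc_of_le (by norm_num)] at hx
    rw [norm_mul, Complex.norm_real, Real.norm_eq_abs]
    calc _ ≤ ‖unitPhase (P.eval x - c) - 1‖ := mul_le_of_le_one_right (norm_nonneg _) (h0 x)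
      _ ≤ 2 * π * |P.eval x - c| := norm_unitPhase_sub_one_le _
      _ ≤ _ := mul_le_mul_of_nonneg_left (hPc x (abs_le.2 ⟨hx.1.le, hx.2⟩)) (by positivity)
  refine (intervalIntegral.norm_integral_le_of_norm_le_const hb).trans_eq ?_
  norm_num
  ring

open Polynomial in
lemma exists_norm_integral_unitPhase_le_sum_min (d : ℕ) :
    ∃ C : ℝ, 0 ≤ C ∧ ∀ (P : ℝ[X]) (ψ ψ' : ℝ → ℝ), P.natDegree ≤ d →
      (∀ x, HasDerivAt ψ (ψ' x) x) → Continuous ψ' → (∀ x, |ψ x| ≤ 1) → (∀ x, |ψ' x| ≤ 1) →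
      ψ (-3) = 0 → ψ 3 = 0 → ∫ x in (-3 : ℝ)..3, ψ x = 0 →
      ‖∫ x in (-3 : ℝ)..3, unitPhase (P.eval x) * (ψ x : ℂ)‖ ≤
        C * ∑ m ∈ Finset.range d, min (|P.coeff (m + 1)| ^ (8 * (d + 1) : ℝ)⁻¹)
          (|P.coeff (m + 1)| ^ (8 * (d + 1) : ℝ)⁻¹)⁻¹ := by
  set δ : ℝ := (8 * (d + 1) : ℝ)⁻¹ with hδ
  set C₁ : ℝ := 12 * π * ((d + 1) * 3 ^ d) with hC₁
  set C₂ : ℝ := 6 + 6 * ((d + 1) * 3 ^ d * (d + 2) ^ 2) + 2 * d + 6 * 144 ^ d with hC₂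
  have hC₁0 : 0 ≤ C₁ := by positivity
  have hC₂0 : 0 ≤ C₂ := by positivity
  have hδ0 : 0 < δ := by positivity
  have hδ1 : δ ≤ 1 := inv_le_one_of_one_le₀ (by have := d.cast_nonneg (α := ℝ); linarith)
  refine ⟨C₁ + C₂, by positivity, fun P ψ ψ' hd hψ hψ'c h0 h1 hneg hpos hmean => ?_⟩
  have hψc : Continuous ψ := continuous_iff_continuousAt.2 fun x => (hψ x).continuousAt
  have hterm : ∀ m ∈ Finset.range d, 0 ≤ min (|P.coeff (m + 1)| ^ δ) (|P.coeff (m + 1)| ^ δ)⁻¹ :=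
    fun m _ => le_min (by positivity) (by positivity)
  have hvanish : ∀ k, d ≤ k → P.coeff (k + 1) = 0 := fun k hk =>
    coeff_eq_zero_of_natDegree_lt (by omega)
  rcases Nat.eq_zero_or_pos d with hd0 | hd0
  · have h := norm_integral_unitPhase_le_coeff hd (L := 0)
      (fun k => by rw [hvanish k (by omega), abs_zero]) hψc h0 hmean
    rw [mul_zero] at h
    exact h.trans (mul_nonneg (by positivity) (Finset.sum_nonneg hterm))
  · obtain ⟨m, hm, hmmax⟩ := Finset.exists_max_image (Finset.range d)
      (fun m => |P.coeff (m + 1)|) ⟨0, Finset.mem_range.2 hd0⟩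
    have hmax : ∀ k, |P.coeff (k + 1)| ≤ |P.coeff (m + 1)| := fun k => by
      rcases lt_or_ge k d with hk | hk
      · exact hmmax k (Finset.mem_range.2 hk)
      · rw [hvanish k hk, abs_zero]
        exact abs_nonneg _
    refine le_trans ?_ (mul_le_mul_of_nonneg_left (Finset.single_le_sum hterm hm) (by positivity))
    set L := |P.coeff (m + 1)| with hL
    have hL0 : 0 ≤ L := abs_nonneg _
    rcases le_total L 1 with hL1 | hL1
    · have hT1 : L ^ δ ≤ 1 := Real.rpow_le_one hL0 hL1 hδ0.le
      rcases hL0.eq_or_lt with hLz | hLpos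
      · have h := norm_integral_unitPhase_le_coeff hd hmax hψc h0 hmean
        rw [← hLz, mul_zero] at h
        exact h.trans (mul_nonneg (by positivity) (le_min (by positivity) (by positivity)))
      have hTpos : 0 < L ^ δ := Real.rpow_pos_of_pos hLpos δ
      have hLT : L ≤ L ^ δ := by
        simpa using Real.rpow_le_rpow_of_exponent_ge hLpos hL1 hδ1
      rw [min_eq_left (hT1.trans (one_le_inv₀ hTpos |>.2 hT1))]
      calc _ ≤ C₁ * L := norm_integral_unitPhase_le_coeff hd hmax hψc h0 hmean
        _ ≤ (C₁ + C₂) * L ^ δ := mul_le_mul (by linarith) hLT hL0 (by positivity)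
    · have hT1 : 1 ≤ L ^ δ := Real.one_le_rpow hL1 hδ0.le
      have hTL : L = (L ^ δ) ^ (8 * (d + 1)) := by
        rw [← Real.rpow_mul_natCast hL0, hδ]
        push_cast
        rw [inv_mul_cancel₀ (by positivity), Real.rpow_one]
      rw [min_eq_right ((inv_le_one_of_one_le₀ hT1).trans hT1)]
      calc _ ≤ C₂ * (L ^ δ)⁻¹ :=
            norm_integral_unitPhase_le_inv hd hT1 hmax hTL hψ hψ'c h0 h1 hneg hpos
        _ ≤ (C₁ + C₂) * (L ^ δ)⁻¹ := by gcongr; linarith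

lemma exists_sum_min_mul_zpow_le {q : ℝ} (hq : 1 < q) :
    ∃ S : ℝ, ∀ b : ℝ, 0 ≤ b → ∀ F : Finset ℤ,
      ∑ j ∈ F, min (b * q ^ j) (b * q ^ j)⁻¹ ≤ S := by
  have hq0 : 0 < q := by linarith
  have hs : Summable fun n : ℕ => q⁻¹ ^ n :=
    summable_geometric_of_lt_one (by positivity) (inv_lt_one_of_one_lt₀ hq)
  have hg : Summable fun k : ℤ => q⁻¹ ^ k.natAbs :=
    Summable.of_nat_of_neg (by simpa using hs) (by simpa using hs)
  refine ⟨q * ∑' k : ℤ, q⁻¹ ^ k.natAbs, fun b hb F => ?_⟩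
  rcases hb.eq_or_lt with rfl | hb
  · simpa using mul_nonneg hq0.le (tsum_nonneg fun k : ℤ => by positivity)
  obtain ⟨n, hn1, hn2⟩ := exists_mem_Ico_zpow hb hq
  have hterm : ∀ j ∈ F, min (b * q ^ j) (b * q ^ j)⁻¹ ≤ q * q⁻¹ ^ (n + j).natAbs := fun j _ => by
    have hqj : 0 < q ^ j := zpow_pos hq0 j
    rcases le_total 0 (n + j) with h | h
    · obtain ⟨k, hk⟩ := Int.eq_ofNat_of_zero_le h
      refine (min_le_right _ _).trans ?_
      have h1 : q ^ k ≤ b * q ^ j := by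
        rw [← zpow_natCast, ← hk, zpow_add₀ hq0.ne']
        gcongr
      rw [hk, Int.natAbs_natCast, inv_pow]
      exact (inv_anti₀ (by positivity) h1).trans (le_mul_of_one_le_left (by positivity) hq.le)
    · obtain ⟨k, hk⟩ := Int.eq_ofNat_of_zero_le (neg_nonneg.2 h)
      have hk' : n + j = -(k : ℤ) := by omega
      refine (min_le_left _ _).trans ?_
      rw [hk', Int.natAbs_neg, Int.natAbs_natCast, inv_pow, ← zpow_natCast, ← zpow_neg, ← hk',
        zpow_add₀ hq0.ne', ← mul_assoc, ← zpow_one_add₀ hq0.ne', add_comm 1 n]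
      gcongr
  calc _ ≤ ∑ j ∈ F, q * q⁻¹ ^ (n + j).natAbs := Finset.sum_le_sum hterm
    _ = q * ∑ k ∈ F.map (addLeftEmbedding n), q⁻¹ ^ k.natAbs := by
        rw [Finset.sum_map, Finset.mul_sum]; rfl
    _ ≤ _ := mul_le_mul_of_nonneg_left
        (hg.sum_le_tsum _ fun k _ => by positivity) hq0.le

/-- After rescaling, the oscillatory integral against a scaled bump lives on `[-3, 3]`. -/
lemma integral_unitPhase_mul_scaledBump (Q : Polynomial ℝ) (u : ℝ)
    {φ : ℤ × ℤ → ℝ × ℝ → ℝ} (I : ℤ × ℤ)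
    (hsupp : ∀ p : ℝ × ℝ, φ I p ≠ 0 → |p.1| ≤ 2) :
    ∫ s : ℝ, unitPhase (Q.eval s) * (scaledBump φ I (s, u) : ℂ) =
      ((2 : ℝ) ^ (-I.2) : ℝ) * ∫ x in (-3 : ℝ)..3,
        unitPhase ((Q.comp (Polynomial.C ((2 : ℝ) ^ I.1) * Polynomial.X)).eval x) *
          (φ I (x, (2 : ℝ) ^ (-I.2) * u) : ℂ) := by
  set g : ℝ → ℂ := fun x =>
    unitPhase ((Q.comp (Polynomial.C ((2 : ℝ) ^ I.1) * Polynomial.X)).eval x) *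
      (φ I (x, (2 : ℝ) ^ (-I.2) * u) : ℂ) with hg
  have hint : ∫ x in (-3 : ℝ)..3, g x = ∫ x, g x := by
    refine intervalIntegral.integral_eq_integral_of_support_subset fun x hx => ?_
    have h := abs_le.1 (hsupp (x, (2 : ℝ) ^ (-I.2) * u) fun h => hx (by simp only [hg, h]; simp))
    exact ⟨by linarith [h.1], by linarith [h.2]⟩
  have hpt : ∀ s : ℝ, unitPhase (Q.eval s) * (scaledBump φ I (s, u) : ℂ) =
      ((2 : ℝ) ^ (-(I.1 + I.2)) : ℝ) * g ((2 : ℝ) ^ (-I.1) * s) := fun s => by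
    have : (2 : ℝ) ^ I.1 * ((2 : ℝ) ^ (-I.1) * s) = s := by
      rw [← mul_assoc, ← zpow_add₀ (by norm_num), add_neg_cancel, zpow_zero, one_mul]
    simp only [hg, scaledBump, Polynomial.eval_comp, Polynomial.eval_mul, Polynomial.eval_C,
      Polynomial.eval_X, this, Complex.ofReal_mul]
    ring
  simp only [hpt]
  rw [hint, integral_const_mul, Measure.integral_comp_mul_left, ← zpow_neg, neg_neg,
    abs_of_pos (by positivity), Complex.real_smul, ← mul_assoc, ← Complex.ofReal_mul,
    ← zpow_add₀ (by norm_num)]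
  congr 4
  ring

lemma norm_integral_unitPhase_mul_scaledBump_le {d : ℕ} {C : ℝ}
    (hC : ∀ (P : Polynomial ℝ) (ψ ψ' : ℝ → ℝ), P.natDegree ≤ d →
      (∀ x, HasDerivAt ψ (ψ' x) x) → Continuous ψ' → (∀ x, |ψ x| ≤ 1) → (∀ x, |ψ' x| ≤ 1) →
      ψ (-3) = 0 → ψ 3 = 0 → ∫ x in (-3 : ℝ)..3, ψ x = 0 →
      ‖∫ x in (-3 : ℝ)..3, unitPhase (P.eval x) * (ψ x : ℂ)‖ ≤
        C * ∑ m ∈ Finset.range d, min (|P.coeff (m + 1)| ^ (8 * (d + 1) : ℝ)⁻¹)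
          (|P.coeff (m + 1)| ^ (8 * (d + 1) : ℝ)⁻¹)⁻¹)
    {Q : Polynomial ℝ} (hQ : Q.natDegree ≤ d) {u : ℝ} (hu : u ≠ 0)
    {φ : ℤ × ℤ → ℝ × ℝ → ℝ} (hφ : IsBumpFamily 1 φ) (I : ℤ × ℤ) :
    ‖∫ s : ℝ, unitPhase (Q.eval s) * (scaledBump φ I (s, u) : ℂ)‖ ≤
      2 / |u| * (C * ∑ m ∈ Finset.range d,
        min (|Q.coeff (m + 1)| ^ (8 * (d + 1) : ℝ)⁻¹ *
            ((2 : ℝ) ^ ((m + 1) * (8 * (d + 1) : ℝ)⁻¹)) ^ I.1)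
          (|Q.coeff (m + 1)| ^ (8 * (d + 1) : ℝ)⁻¹ *
            ((2 : ℝ) ^ ((m + 1) * (8 * (d + 1) : ℝ)⁻¹)) ^ I.1)⁻¹) := by
  obtain ⟨hsm, hsupp, hmean, -, hder⟩ := hφ I
  have hupos : 0 < |u| := abs_pos.2 hu
  rw [integral_unitPhase_mul_scaledBump Q u I fun p hp => (hsupp p hp).2.1]
  set P := Q.comp (Polynomial.C ((2 : ℝ) ^ I.1) * Polynomial.X) with hP
  set t := (2 : ℝ) ^ (-I.2) * u with ht
  set ψ : ℝ → ℝ := fun x => φ I (x, t) with hψdef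
  have hPd : P.natDegree ≤ d :=
    (Polynomial.natDegree_comp_le.trans (Nat.mul_le_mul hQ
      ((Polynomial.natDegree_C_mul_le _ _).trans Polynomial.natDegree_X_le))).trans_eq
      (mul_one d)
  have hcoeff : ∀ m : ℕ, |P.coeff (m + 1)| ^ (8 * (d + 1) : ℝ)⁻¹ =
      |Q.coeff (m + 1)| ^ (8 * (d + 1) : ℝ)⁻¹ *
        ((2 : ℝ) ^ ((m + 1) * (8 * (d + 1) : ℝ)⁻¹)) ^ I.1 := fun m => by
    rw [hP, Polynomial.comp_C_mul_X_coeff, abs_mul, Real.mul_rpow (abs_nonneg _) (abs_nonneg _),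
      abs_of_pos (by positivity : (0 : ℝ) < ((2 : ℝ) ^ I.1) ^ (m + 1))]
    congr 1
    rw [← Real.rpow_intCast, ← Real.rpow_intCast, ← Real.rpow_natCast,
      ← Real.rpow_mul (by positivity), ← Real.rpow_mul (by positivity),
      ← Real.rpow_mul (by positivity)]
    congr 1
    push_cast
    ring
  have hψ : ∀ x, HasDerivAt ψ (fderiv ℝ (φ I) (x, t) (1, 0)) x := fun x =>
    ((hsm.differentiable (by simp)) (x, t)).hasFDerivAt.comp_hasDerivAt x
      ((hasDerivAt_id x).prodMk (hasDerivAt_const x t))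
  have hψ'c : Continuous fun x => fderiv ℝ (φ I) (x, t) (1, 0) :=
    ((hsm.continuous_fderiv (by simp)).comp (by fun_prop : Continuous fun x : ℝ => (x, t))).clm_apply
      continuous_const
  have h0 : ∀ x, |ψ x| ≤ 1 := fun x => by
    simpa [norm_iteratedFDeriv_zero] using hder 0 (by norm_num) (x, t)
  have h1 : ∀ x, |fderiv ℝ (φ I) (x, t) (1, 0)| ≤ 1 := fun x => by
    have h := hder 1 le_rfl (x, t)
    rw [norm_iteratedFDeriv_one] at h
    exact ((fderiv ℝ (φ I) (x, t)).le_opNorm (1, 0)).trans (by simpa [Prod.norm_def] using h)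
  have hfar : ∀ x, 2 < |x| → ψ x = 0 := fun x hx => by
    by_contra h
    exact absurd (hsupp _ h).2.1 (not_le.2 hx)
  have hmean' : ∫ x in (-3 : ℝ)..3, ψ x = 0 := by
    rw [← hmean t]
    refine intervalIntegral.integral_eq_integral_of_support_subset fun x hx => ?_
    have h : |x| ≤ 2 := not_lt.1 fun h => hx (hfar x h)
    have h := abs_le.1 h
    exact ⟨by linarith [h.1], by linarith [h.2]⟩
  have hmain := hC P ψ _ hPd hψ hψ'c h0 h1 (hfar _ (by norm_num)) (hfar _ (by norm_num)) hmean'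
  simp only [hcoeff] at hmain
  have hpow : 0 < (2 : ℝ) ^ (-I.2) := by positivity
  rw [norm_mul, Complex.norm_real, Real.norm_eq_abs, abs_of_pos hpow]
  by_cases hz : |t| ≤ 2
  · refine mul_le_mul ?_ hmain (norm_nonneg _) (by positivity)
    rw [ht, abs_mul, abs_of_pos hpow] at hz
    rwa [le_div_iff₀ hupos]
  · have hψ0 : ∀ x, φ I (x, t) = 0 := fun x => by
      by_contra h
      exact hz (hsupp _ h).2.2.2
    simp only [hψ0, Complex.ofReal_zero, mul_zero, intervalIntegral.integral_zero, norm_zero]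
    exact mul_nonneg (by positivity) ((norm_nonneg _).trans hmain)

lemma exists_scaledBump_eq_zero_of_notMem_Icc {u : ℝ} (hu : u ≠ 0) :
    ∃ n : ℤ, ∀ {N : ℕ} {φ : ℤ × ℤ → ℝ × ℝ → ℝ}, IsBumpFamily N φ → ∀ I : ℤ × ℤ,
      I.2 ∉ Finset.Icc (n - 1) (n + 1) → ∀ s, scaledBump φ I (s, u) = 0 := by
  obtain ⟨n, hn1, hn2⟩ := exists_mem_Ico_zpow (abs_pos.2 hu) (one_lt_two (α := ℝ))
  refine ⟨n, fun hφ I hI s => ?_⟩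
  by_contra h
  obtain ⟨-, -, h3, h4⟩ := (hφ I).2.1 _ (right_ne_zero_of_mul h)
  simp only [abs_mul] at h3 h4
  have hpow : 0 < (2 : ℝ) ^ I.2 := by positivity
  rw [abs_of_pos (by positivity : (0 : ℝ) < 2 ^ (-I.2)), zpow_neg, inv_mul_eq_div] at h3 h4
  rw [div_le_div_iff₀ (by norm_num) hpow] at h3
  rw [div_le_iff₀ hpow] at h4
  refine hI (Finset.mem_Icc.2 ⟨?_, ?_⟩)
  · have : (2 : ℝ) ^ n ≤ 2 ^ (I.2 + 1) := by
      rw [zpow_add_one₀ (by norm_num)]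
      linarith
    have := (zpow_le_zpow_iff_right₀ (one_lt_two (α := ℝ))).1 this
    omega
  · have : (2 : ℝ) ^ I.2 < 2 ^ (n + 1 + 1) := by
      rw [zpow_add_one₀ (by norm_num)]
      linarith
    have := (zpow_lt_zpow_iff_right₀ (one_lt_two (α := ℝ))).1 this
    omega

/-- two-parameter generalized Stein–Wainger bound.  For every `d` there
exist `N` and `C_d` such that for every polynomial `Q` of degree `≤ d`, every `u ≠ 0`, every
finite `ℱ' ⊂ ℤ²`, and every normalized cancellative bump family of order `N`,
`Σ_{I∈ℱ'} |∫ e^{2πi Q(s)} φ_I^{(I)}(s,u) ds| ≤ C_d / |u|`. -/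
theorem two_parameter_stein_wainger (d : ℕ) :
    ∃ N : ℕ, ∃ C : ℝ, ∀ Q : Polynomial ℝ, Q.natDegree ≤ d →
      ∀ u : ℝ, u ≠ 0 → ∀ F' : Finset (ℤ × ℤ), ∀ φ : ℤ × ℤ → ℝ × ℝ → ℝ,
        IsBumpFamily N φ →
        ∑ I ∈ F', ‖∫ s : ℝ, Complex.exp (2 * (π : ℂ) * Complex.I * (Q.eval s : ℝ)) *
            (scaledBump φ I (s, u) : ℂ)‖ ≤ C / |u| := by
  obtain ⟨C, hC0, hC⟩ := exists_norm_integral_unitPhase_le_sum_min d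
  have hq : ∀ m : ℕ, 1 < (2 : ℝ) ^ ((m + 1) * (8 * (d + 1) : ℝ)⁻¹) := fun m =>
    Real.one_lt_rpow one_lt_two (by positivity)
  choose S hS using fun m => exists_sum_min_mul_zpow_le (hq m)
  refine ⟨1, 3 * (2 * (C * ∑ m ∈ Finset.range d, S m)), fun Q hQ u hu F' φ hφ => ?_⟩
  obtain ⟨n, hn⟩ := exists_scaledBump_eq_zero_of_notMem_Icc hu
  set K := Finset.Icc (n - 1) (n + 1) with hK
  set A : ℤ → ℕ → ℝ := fun j m => |Q.coeff (m + 1)| ^ (8 * (d + 1) : ℝ)⁻¹ *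
    ((2 : ℝ) ^ ((m + 1) * (8 * (d + 1) : ℝ)⁻¹)) ^ j with hA
  set B : ℤ → ℝ := fun j => 2 / |u| * (C * ∑ m ∈ Finset.range d, min (A j m) (A j m)⁻¹) with hB
  have hB0 : ∀ j, 0 ≤ B j := fun j => mul_nonneg (by positivity) (mul_nonneg hC0
    (Finset.sum_nonneg fun m _ => le_min (by positivity) (by positivity)))
  have hle : ∀ I, ‖∫ s : ℝ, unitPhase (Q.eval s) * (scaledBump φ I (s, u) : ℂ)‖ ≤ B I.1 :=
    fun I => norm_integral_unitPhase_mul_scaledBump_le hC hQ hu hφ I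
  have hBsum : ∑ j ∈ F'.image Prod.fst, B j ≤ 2 / |u| * (C * ∑ m ∈ Finset.range d, S m) := by
    rw [← Finset.mul_sum, ← Finset.mul_sum, Finset.sum_comm]
    gcongr with m _
    exact hS m _ (by positivity) _
  calc ∑ I ∈ F', ‖∫ s : ℝ, unitPhase (Q.eval s) * (scaledBump φ I (s, u) : ℂ)‖
      = ∑ I ∈ F' with I.2 ∈ K,
          ‖∫ s : ℝ, unitPhase (Q.eval s) * (scaledBump φ I (s, u) : ℂ)‖ := by
        refine (Finset.sum_filter_of_ne fun I _ hI => ?_).symm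
        by_contra h
        exact hI (by simp [hn hφ I h])
    _ ≤ ∑ I ∈ F' with I.2 ∈ K, B I.1 := Finset.sum_le_sum fun I _ => hle I
    _ ≤ ∑ I ∈ F'.image Prod.fst ×ˢ K, B I.1 := by
        refine Finset.sum_le_sum_of_subset_of_nonneg (fun I hI => ?_) fun I _ _ => hB0 I.1
        rw [Finset.mem_filter] at hI
        exact Finset.mem_product.2 ⟨Finset.mem_image_of_mem _ hI.1, hI.2⟩
    _ = 3 * ∑ j ∈ F'.image Prod.fst, B j := by
        have hcard : K.card = 3 := by rw [hK, Int.card_Icc]; omega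
        simp [Finset.sum_product, hcard, Finset.mul_sum]
    _ ≤ 3 * (2 / |u| * (C * ∑ m ∈ Finset.range d, S m)) := by gcongr
    _ = _ := by ring
end
end

section
/- Let p₀ ≥ 1 be an integer and let P(u,s) be real-analytic on a neighborhood of (0,0) with P(0,0) = 0 and with vanishing coefficient of s^{p₀} in the expansion P(0,s), i.e. ∂_s^{p₀} P(0,0) = 0. Then there exist N, J, K₀ ∈ ℕ and a constant C (depending on P and p₀) such that: for every normalized cancellative bump family {φ_I} of order N, every finite set ℱ′ ⊆ {(j,k) ∈ ℤ² : j ≤ −J, k ≤ −K₀}, and all λ, y, t ∈ ℝ with y ≠ t, Σ_{I∈ℱ′} | m_I(λ, y, t) | ≤ C / |y − t|, where m_I(λ, y, t) = ∫_ℝ e^{2πi λ (2 y s^{p₀} + P(y−t, s))} φ_I^{(I)}(s, y−t) ds. The constant C is independent of λ, y, t and of the cardinality of ℱ′. -/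
open MeasureTheory Real

noncomputable section

open Set Finset in
/-- Telescoping over products of the weights `τ² / (h² + τ²)`. -/
theorem weight_zero_le_prod_add_sum (h τ : ℕ → ℝ) (hτ : ∀ l, 0 < τ l) (n : ℕ) :
    τ 0 ^ 2 / (h 0 ^ 2 + τ 0 ^ 2) ≤
      ∏ l ∈ range (n + 1), τ l ^ 2 / (h l ^ 2 + τ l ^ 2) +
        ∑ l ∈ range n, τ l ^ 2 / τ (l + 1) ^ 2 * (h (l + 1) ^ 2 / (h l ^ 2 + τ l ^ 2)) := by
  have w0 : ∀ l, 0 ≤ τ l ^ 2 / (h l ^ 2 + τ l ^ 2) := fun l => by positivity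
  have w1 : ∀ l, τ l ^ 2 / (h l ^ 2 + τ l ^ 2) ≤ 1 := fun l => by
    have := hτ l
    rw [div_le_one (by positivity)]; nlinarith [sq_nonneg (h l)]
  have wstep : ∀ l, 1 ≤ τ l ^ 2 / (h l ^ 2 + τ l ^ 2) + h l ^ 2 / τ l ^ 2 := fun l => by
    have h1 := hτ l
    have h2 : h l ^ 2 / (h l ^ 2 + τ l ^ 2) ≤ h l ^ 2 / τ l ^ 2 := by
      gcongr
      nlinarith [sq_nonneg (h l)]
    have h3 : τ l ^ 2 / (h l ^ 2 + τ l ^ 2) + h l ^ 2 / (h l ^ 2 + τ l ^ 2) = 1 := by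
      rw [← add_div, add_comm, div_self (by positivity)]
    linarith
  induction n with
  | zero => simp
  | succ n ih =>
    rw [prod_range_succ _ (n + 1), sum_range_succ _ n]
    set Q := ∏ l ∈ range (n + 1), τ l ^ 2 / (h l ^ 2 + τ l ^ 2) with hQ
    have hQ0 : 0 ≤ Q := prod_nonneg fun l _ => w0 l
    have hQn : Q ≤ τ n ^ 2 / (h n ^ 2 + τ n ^ 2) := by
      rw [hQ, prod_range_succ]
      exact mul_le_of_le_one_left (w0 n) (prod_le_one (fun l _ => w0 l) fun l _ => w1 l)
    have h4 : 0 ≤ h (n + 1) ^ 2 / τ (n + 1) ^ 2 := by positivity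
    have h5 : Q ≤ Q * (τ (n+1) ^ 2 / (h (n+1) ^ 2 + τ (n+1) ^ 2)) +
        τ n ^ 2 / τ (n + 1) ^ 2 * (h (n + 1) ^ 2 / (h n ^ 2 + τ n ^ 2)) := by
      calc Q ≤ Q * (τ (n+1) ^ 2 / (h (n+1) ^ 2 + τ (n+1) ^ 2) + h (n+1) ^ 2 / τ (n+1) ^ 2) :=
            le_mul_of_one_le_right hQ0 (wstep _)
        _ ≤ Q * (τ (n+1) ^ 2 / (h (n+1) ^ 2 + τ (n+1) ^ 2)) +
            τ n ^ 2 / (h n ^ 2 + τ n ^ 2) * (h (n+1) ^ 2 / τ (n+1) ^ 2) := by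
              rw [mul_add]; gcongr
        _ = _ := by ring
    linarith

open Set in
/-- Integration by parts against `arctan (h₀ / τ)`. -/
theorem integral_sq_deriv_div_le {h₀ h₁ h₂ : ℝ → ℝ} {B τ : ℝ} (hτ : 0 < τ)
    (d₀ : ∀ x ∈ Icc (-2 : ℝ) 2, HasDerivAt h₀ (h₁ x) x)
    (d₁ : ∀ x ∈ Icc (-2 : ℝ) 2, HasDerivAt h₁ (h₂ x) x)
    (c₂ : ContinuousOn h₂ (Icc (-2 : ℝ) 2))
    (b₁ : ∀ x ∈ Icc (-2 : ℝ) 2, |h₁ x| ≤ B) (b₂ : ∀ x ∈ Icc (-2 : ℝ) 2, |h₂ x| ≤ B) :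
    ∫ x in (-2 : ℝ)..2, h₁ x ^ 2 / (h₀ x ^ 2 + τ ^ 2) ≤ 12 * B / τ := by
  have hI : uIcc (-2 : ℝ) 2 = Icc (-2) 2 := uIcc_of_le (by norm_num)
  have c₀ : ContinuousOn h₀ (Icc (-2 : ℝ) 2) := fun x hx => (d₀ x hx).continuousAt.continuousWithinAt
  have c₁ : ContinuousOn h₁ (Icc (-2 : ℝ) 2) := fun x hx => (d₁ x hx).continuousAt.continuousWithinAt
  have dat : ∀ x ∈ Icc (-2 : ℝ) 2,
      HasDerivAt (fun x => arctan (h₀ x / τ)) (τ * (h₁ x / (h₀ x ^ 2 + τ ^ 2))) x := by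
    intro x hx
    refine ((d₀ x hx).div_const τ).arctan.congr_deriv ?_
    have : h₀ x ^ 2 + τ ^ 2 ≠ 0 := by positivity
    have : 1 + (h₀ x / τ) ^ 2 ≠ 0 := by positivity
    field_simp
    ring
  have hat : ∀ z, |arctan z| ≤ 2 := fun z => by
    have := arctan_lt_pi_div_two z
    have := neg_pi_div_two_lt_arctan z
    have := pi_lt_four
    rw [abs_le]; constructor <;> linarith
  have hB : 0 ≤ B := (abs_nonneg _).trans (b₁ 0 (by norm_num))
  have ibp := intervalIntegral.integral_mul_deriv_eq_deriv_mul (a := -2) (b := 2)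
    (u := h₁) (v := fun x => arctan (h₀ x / τ)) (u' := h₂)
    (v' := fun x => τ * (h₁ x / (h₀ x ^ 2 + τ ^ 2)))
    (by rwa [hI]) (by rwa [hI]) (ContinuousOn.intervalIntegrable (by rwa [hI]))
    (ContinuousOn.intervalIntegrable (by
      rw [hI]
      exact continuousOn_const.mul (c₁.div ((c₀.pow 2).add continuousOn_const)
        fun x _ => by positivity)))
  have e1 : ∫ x in (-2 : ℝ)..2, h₁ x * (τ * (h₁ x / (h₀ x ^ 2 + τ ^ 2))) =
      τ * ∫ x in (-2 : ℝ)..2, h₁ x ^ 2 / (h₀ x ^ 2 + τ ^ 2) := by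
    rw [← intervalIntegral.integral_const_mul]
    congr 1; ext x; ring
  rw [e1] at ibp
  have e2 : ‖∫ x in (-2 : ℝ)..2, h₂ x * arctan (h₀ x / τ)‖ ≤ (B * 2) * |2 - (-2)| := by
    apply intervalIntegral.norm_integral_le_of_norm_le_const
    intro x hx
    rw [uIoc_of_le (by norm_num)] at hx
    rw [norm_mul]
    exact mul_le_mul (b₂ x ⟨hx.1.le, hx.2⟩) (hat _) (by positivity) hB
  have e3 : ∀ x ∈ Icc (-2 : ℝ) 2, |h₁ x * arctan (h₀ x / τ)| ≤ B * 2 := fun x hx => by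
    rw [abs_mul]
    exact mul_le_mul (b₁ x hx) (hat _) (by positivity) hB
  have e4 := abs_le.1 (e3 2 (by norm_num))
  have e5 := abs_le.1 (e3 (-2) (by norm_num))
  rw [Real.norm_eq_abs, abs_le] at e2
  norm_num at e2
  rw [le_div_iff₀ hτ, mul_comm]
  linarith

open Set in
/-- Integration by parts away from the zeros of the derivative of the phase. -/
theorem norm_integral_exp_mul_le {f g g' ψ ψ' : ℝ → ℝ} {M B η : ℝ} (hM : 0 < M)
    (hη : 0 < η) (hη1 : η ≤ 1)
    (df : ∀ x ∈ Icc (-2 : ℝ) 2, HasDerivAt f (M * g x) x)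
    (dg : ∀ x ∈ Icc (-2 : ℝ) 2, HasDerivAt g (g' x) x)
    (cg' : ContinuousOn g' (Icc (-2 : ℝ) 2)) (bg' : ∀ x ∈ Icc (-2 : ℝ) 2, |g' x| ≤ B)
    (dψ : ∀ x, HasDerivAt ψ (ψ' x) x) (cψ' : Continuous ψ')
    (bψ : ∀ x, |ψ x| ≤ 1) (bψ' : ∀ x, |ψ' x| ≤ 1) (hr : ψ 2 = 0) (hl : ψ (-2) = 0) :
    ‖∫ x in (-2 : ℝ)..2, Complex.exp (Complex.I * f x) * ψ x‖ ≤
      4 * (1 + B) / (M * η ^ 2) + ∫ x in (-2 : ℝ)..2, η ^ 2 / (g x ^ 2 + η ^ 2) := by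
  have hI : uIcc (-2 : ℝ) 2 = Icc (-2) 2 := uIcc_of_le (by norm_num)
  have cf : ContinuousOn f (Icc (-2 : ℝ) 2) := fun x hx => (df x hx).continuousAt.continuousWithinAt
  have cg : ContinuousOn g (Icc (-2 : ℝ) 2) := fun x hx => (dg x hx).continuousAt.continuousWithinAt
  have cψ : Continuous ψ := continuous_iff_continuousAt.2 fun x => (dψ x).continuousAt
  have hB : 0 ≤ B := (abs_nonneg _).trans (bg' 0 (by norm_num))
  have hpos : ∀ x, 0 < g x ^ 2 + η ^ 2 := fun x => by positivity
  set q : ℝ → ℝ := fun x => ψ x * (g x / (g x ^ 2 + η ^ 2)) with hq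
  set q' : ℝ → ℝ := fun x => ψ' x * (g x / (g x ^ 2 + η ^ 2)) +
    ψ x * (g' x * (η ^ 2 - g x ^ 2) / (g x ^ 2 + η ^ 2) ^ 2) with hq'
  set v : ℝ → ℂ := fun x => Complex.exp (Complex.I * f x) with hv
  have cv : ContinuousOn v (Icc (-2 : ℝ) 2) := by fun_prop
  have nv : ∀ x, ‖v x‖ = 1 := fun x => by
    simpa only [hv, mul_comm] using Complex.norm_exp_ofReal_mul_I (f x)
  have cden : ContinuousOn (fun x => g x ^ 2 + η ^ 2) (Icc (-2 : ℝ) 2) := by fun_prop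
  have dq : ∀ x ∈ Icc (-2 : ℝ) 2, HasDerivAt q (q' x) x := by
    intro x hx
    refine ((dψ x).mul ((dg x hx).div (((dg x hx).pow 2).add_const (η ^ 2)) (hpos x).ne')).congr_deriv ?_
    simp only [hq', Pi.pow_apply]
    congr 3
    push_cast
    ring
  have cq' : ContinuousOn q' (Icc (-2 : ℝ) 2) := by
    refine (cψ'.continuousOn.mul (cg.div cden fun x _ => (hpos x).ne')).add
      (cψ.continuousOn.mul ((cg'.mul (continuousOn_const.sub (cg.pow 2))).div (cden.pow 2)
        fun x _ => pow_ne_zero 2 (hpos x).ne'))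
  have dv : ∀ x ∈ Icc (-2 : ℝ) 2, HasDerivAt v (v x * (Complex.I * ((M * g x : ℝ) : ℂ))) x := by
    intro x hx
    exact (((df x hx).ofReal_comp).const_mul Complex.I).cexp
  have bq' : ∀ x ∈ Icc (-2 : ℝ) 2, |q' x| ≤ (1 + B) / η ^ 2 := by
    intro x hx
    have a1 : |g x / (g x ^ 2 + η ^ 2)| ≤ 1 / η ^ 2 := by
      rw [abs_div, abs_of_pos (hpos x), div_le_div_iff₀ (hpos x) (by positivity)]
      have : |g x| ^ 2 = g x ^ 2 := sq_abs _
      have h0 := abs_nonneg (g x)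
      have : |g x| * η ≤ g x ^ 2 + η ^ 2 := by nlinarith [sq_nonneg (|g x| - η)]
      nlinarith [mul_nonneg h0 hη.le]
    have a2 : |g' x * (η ^ 2 - g x ^ 2) / (g x ^ 2 + η ^ 2) ^ 2| ≤ B / η ^ 2 := by
      rw [abs_div, abs_mul, abs_of_pos (pow_pos (hpos x) 2),
        div_le_div_iff₀ (pow_pos (hpos x) 2) (by positivity)]
      have h1 : |η ^ 2 - g x ^ 2| ≤ g x ^ 2 + η ^ 2 := by
        rw [abs_le]; constructor <;> nlinarith [sq_nonneg (g x), sq_nonneg η]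
      have h2 : η ^ 2 ≤ g x ^ 2 + η ^ 2 := by nlinarith [sq_nonneg (g x)]
      calc |g' x| * |η ^ 2 - g x ^ 2| * η ^ 2 ≤ B * (g x ^ 2 + η ^ 2) * (g x ^ 2 + η ^ 2) := by
            have := bg' x hx
            gcongr
        _ = _ := by ring
    calc |q' x| ≤ |ψ' x| * |g x / (g x ^ 2 + η ^ 2)| +
          |ψ x| * |g' x * (η ^ 2 - g x ^ 2) / (g x ^ 2 + η ^ 2) ^ 2| := by
          rw [← abs_mul, ← abs_mul]; exact abs_add_le _ _
      _ ≤ 1 * (1 / η ^ 2) + 1 * (B / η ^ 2) := by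
          have := bψ x
          have := bψ' x
          gcongr
      _ = _ := by ring
  have ibp := intervalIntegral.integral_mul_deriv_eq_deriv_mul (a := -2) (b := 2)
    (u := fun x => (q x : ℂ)) (v := v) (u' := fun x => (q' x : ℂ))
    (v' := fun x => v x * (Complex.I * ((M * g x : ℝ) : ℂ)))
    (by rw [hI]; exact fun x hx => (dq x hx).ofReal_comp) (by rwa [hI])
    (ContinuousOn.intervalIntegrable (by rw [hI]; fun_prop))
    (ContinuousOn.intervalIntegrable (by rw [hI]; fun_prop))
  have q2 : q 2 = 0 := by simp [hq, hr]
  have q3 : q (-2) = 0 := by simp [hq, hl]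
  rw [q2, q3] at ibp
  simp only [Complex.ofReal_zero, zero_mul, sub_zero, zero_sub] at ibp
  have cw : ContinuousOn (fun x => η ^ 2 / (g x ^ 2 + η ^ 2)) (Icc (-2 : ℝ) 2) :=
    continuousOn_const.div cden fun x _ => (hpos x).ne'
  have cq : ContinuousOn q (Icc (-2 : ℝ) 2) :=
    cψ.continuousOn.mul (cg.div cden fun x _ => (hpos x).ne')
  have split : ∀ x, v x * ψ x = (1 / (M * Complex.I)) * (q x * (v x * (Complex.I * ((M * g x : ℝ) : ℂ))))
      + v x * ((ψ x * (η ^ 2 / (g x ^ 2 + η ^ 2)) : ℝ) : ℂ) := by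
    intro x
    have hMc : (M : ℂ) ≠ 0 := by exact_mod_cast hM.ne'
    have hpc : (g x : ℂ) ^ 2 + (η : ℂ) ^ 2 ≠ 0 := by exact_mod_cast (hpos x).ne'
    simp only [hq]
    push_cast
    field_simp [Complex.I_ne_zero]
  have hsplit : ∫ x in (-2 : ℝ)..2, v x * ψ x =
      (1 / (M * Complex.I)) * (∫ x in (-2 : ℝ)..2, q x * (v x * (Complex.I * ((M * g x : ℝ) : ℂ)))) +
      ∫ x in (-2 : ℝ)..2, v x * ((ψ x * (η ^ 2 / (g x ^ 2 + η ^ 2)) : ℝ) : ℂ) := by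
    simp_rw [split]
    rw [intervalIntegral.integral_add, intervalIntegral.integral_const_mul]
    · exact ContinuousOn.intervalIntegrable (by rw [hI]; fun_prop)
    · refine ContinuousOn.intervalIntegrable ?_
      rw [hI]
      exact cv.mul (Complex.continuous_ofReal.comp_continuousOn (cψ.continuousOn.mul cw))
  change ‖∫ x in (-2 : ℝ)..2, v x * ψ x‖ ≤ _
  rw [hsplit, ibp]
  refine (norm_add_le _ _).trans (add_le_add ?_ ?_)
  · have := intervalIntegral.norm_integral_le_of_norm_le_const (a := -2) (b := 2)
      (f := fun x => (q' x : ℂ) * v x) (C := (1 + B) / η ^ 2) (by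
        intro x hx
        rw [uIoc_of_le (by norm_num)] at hx
        rw [norm_mul, nv, mul_one, Complex.norm_real]
        exact bq' x ⟨hx.1.le, hx.2⟩)
    norm_num at this
    rw [norm_mul, norm_neg, norm_div, norm_mul, norm_one, Complex.norm_I, mul_one,
      Complex.norm_real, Real.norm_of_nonneg hM.le]
    calc 1 / M * ‖∫ x in (-2 : ℝ)..2, (q' x : ℂ) * v x‖ ≤ 1 / M * ((1 + B) / η ^ 2 * 4) := by gcongr
      _ = _ := by field_simp
  · refine intervalIntegral.norm_integral_le_of_norm_le (by norm_num) ?_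
      (ContinuousOn.intervalIntegrable (by rwa [hI]))
    refine Filter.Eventually.of_forall fun x _ => ?_
    have : 0 ≤ η ^ 2 / (g x ^ 2 + η ^ 2) := by positivity
    rw [norm_mul, nv, one_mul, Complex.norm_real, norm_mul, Real.norm_of_nonneg this]
    exact mul_le_of_le_one_left this (bψ x)

open Set in
/-- Bounds at one point for the derivatives of order `1, …, n`, and everywhere for the derivative
of order `n + 1`, propagate to all of `[-2, 2]`. -/
theorem abs_deriv_chain_le {F : ℕ → ℝ → ℝ} {n : ℕ} {A x₀ : ℝ} (hA : 0 ≤ A)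
    (hx₀ : x₀ ∈ Icc (-2 : ℝ) 2)
    (dF : ∀ l ≤ n, ∀ x ∈ Icc (-2 : ℝ) 2, HasDerivAt (F l) (F (l + 1) x) x)
    (h₀ : ∀ l, 1 ≤ l → l ≤ n → |F l x₀| ≤ A) (htop : ∀ x ∈ Icc (-2 : ℝ) 2, |F (n + 1) x| ≤ A) :
    ∀ l, 1 ≤ l → l ≤ n + 1 → ∀ x ∈ Icc (-2 : ℝ) 2, |F l x| ≤ 5 ^ (n + 1) * A := by
  have key : ∀ k ≤ n, ∀ x ∈ Icc (-2 : ℝ) 2, |F (n + 1 - k) x| ≤ 5 ^ k * A := by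
    intro k
    induction k with
    | zero => intro _ x hx; simpa using htop x hx
    | succ k ih =>
      intro hk x hx
      have hb := ih (by omega)
      have e : n + 1 - k = (n + 1 - (k + 1)) + 1 := by omega
      rw [e] at hb
      set l := n + 1 - (k + 1) with hl
      have := Convex.norm_image_sub_le_of_norm_hasDerivWithin_le
        (fun y hy => (dF l (by omega) y hy).hasDerivWithinAt) (fun y hy => hb y hy)
        (convex_Icc (-2 : ℝ) 2) hx₀ hx
      rw [Real.norm_eq_abs, Real.norm_eq_abs] at this
      have h4 : |x - x₀| ≤ 4 := by
        rw [abs_le]; constructor <;> linarith [hx.1, hx.2, hx₀.1, hx₀.2]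
      have h5 : |F l x| ≤ |F l x₀| + |F l x - F l x₀| := by
        have := abs_add_le (F l x₀) (F l x - F l x₀)
        rwa [add_sub_cancel] at this
      have h6 := h₀ l (by omega) (by omega)
      have h7 : (1 : ℝ) ≤ 5 ^ k := one_le_pow₀ (by norm_num)
      have h8 : 5 ^ k * A * |x - x₀| ≤ 5 ^ k * A * 4 := by gcongr
      rw [pow_succ]
      nlinarith
  intro l h1 hl x hx
  have := key (n + 1 - l) (by omega) x hx
  rw [Nat.sub_sub_self hl] at this
  refine this.trans ?_
  gcongr
  · norm_num
  · omega

open Set Finset in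
/-- A weak van der Corput estimate: on `[-2, 2]`, if the sizes at the origin of the derivatives of
orders `1, …, n + 1` of the phase add up to `M`, and the derivative of order `n + 2` is
comparatively small, then the oscillatory integral is `O(min (M, M ^ (-κ)))`. -/
theorem exists_oscillatory_bound (n : ℕ) :
    ∃ C κ ε : ℝ, 0 < C ∧ 0 < κ ∧ 0 < ε ∧ ∀ (F : ℕ → ℝ → ℝ) (M : ℝ) (ψ ψ' : ℝ → ℝ),
      (∀ l ≤ n + 1, ∀ x ∈ Set.Icc (-2 : ℝ) 2, HasDerivAt (F l) (F (l + 1) x) x) →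
      ContinuousOn (F (n + 2)) (Set.Icc (-2 : ℝ) 2) →
      M = ∑ l ∈ Finset.Icc 1 (n + 1), |F l 0| →
      (∀ x ∈ Set.Icc (-2 : ℝ) 2, |F (n + 2) x| ≤ ε * M) →
      (∀ x, HasDerivAt ψ (ψ' x) x) → Continuous ψ' → (∀ x, |ψ x| ≤ 1) → (∀ x, |ψ' x| ≤ 1) →
      (∀ x, 2 ≤ |x| → ψ x = 0) → ∫ x, ψ x = 0 →
      ‖∫ x, Complex.exp (Complex.I * F 0 x) * ψ x‖ ≤ C * M ∧
      (1 ≤ M → ‖∫ x, Complex.exp (Complex.I * F 0 x) * ψ x‖ ≤ C * M ^ (-κ)) := by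
  set B : ℝ := 5 ^ (n + 2) with hB
  have hB0 : 0 < B := by positivity
  have hB1 : 1 ≤ B := one_le_pow₀ (by norm_num)
  set ε : ℝ := 1 / (2 * (n + 2) * B) with hε
  have hε0 : 0 < ε := by positivity
  have hε1 : ε ≤ 1 := by
    rw [hε, div_le_one (by positivity)]
    have : (0 : ℝ) ≤ n := by positivity
    nlinarith
  set κ : ℝ := 1 / (2 * 3 ^ n + 1) with hκ
  have hκ0 : 0 < κ := by positivity
  refine ⟨8 * B + 4 * (1 + B) + 4 / ε ^ 2 + 12 * B * n, κ, ε, by positivity, hκ0, hε0, ?_⟩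
  intro F M ψ ψ' dF cF hMs htop dψ cψ' bψ bψ' sψ iψ
  have hI : uIcc (-2 : ℝ) 2 = Set.Icc (-2) 2 := uIcc_of_le (by norm_num)
  have cψ : Continuous ψ := continuous_iff_continuousAt.2 fun x => (dψ x).continuousAt
  have hr : ψ 2 = 0 := sψ _ (by norm_num)
  have hl : ψ (-2) = 0 := sψ _ (by norm_num)
  have hsupp : Function.support ψ ⊆ Ioc (-2) 2 := by
    intro x hx
    have : |x| < 2 := by
      by_contra h
      exact hx (sψ x (not_lt.1 h))
    rw [abs_lt] at this
    exact ⟨this.1, this.2.le⟩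
  have hint : ∫ x in (-2 : ℝ)..2, Complex.exp (Complex.I * F 0 x) * ψ x =
      ∫ x, Complex.exp (Complex.I * F 0 x) * ψ x := by
    apply intervalIntegral.integral_eq_integral_of_support_subset
    intro x hx
    apply hsupp
    intro h
    simp [h] at hx
  have hint0 : ∫ x in (-2 : ℝ)..2, ψ x = 0 := by
    rw [intervalIntegral.integral_eq_integral_of_support_subset hsupp, iψ]
  rw [← hint]
  have cFl : ∀ l ≤ n + 2, ContinuousOn (F l) (Set.Icc (-2 : ℝ) 2) := by
    intro l hl
    rcases Nat.lt_or_eq_of_le hl with h | h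
    · exact fun x hx => (dF l (by omega) x hx).continuousAt.continuousWithinAt
    · rwa [h]
  have hM0 : 0 ≤ M := hMs ▸ sum_nonneg fun _ _ => abs_nonneg _
  have hF0 : ∀ l, 1 ≤ l → l ≤ n + 1 → |F l 0| ≤ M := by
    intro l h1 h2
    rw [hMs]
    exact single_le_sum (f := fun l => |F l 0|) (fun _ _ => abs_nonneg _) (Finset.mem_Icc.2 ⟨h1, h2⟩)
  have hup : ∀ l, 1 ≤ l → l ≤ n + 2 → ∀ x ∈ Set.Icc (-2 : ℝ) 2, |F l x| ≤ B * M :=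
    abs_deriv_chain_le hM0 (x₀ := 0) (by norm_num) dF hF0 fun x hx =>
      (htop x hx).trans (by nlinarith)
  constructor
  · have e1 : ∫ x in (-2 : ℝ)..2, Complex.exp (Complex.I * F 0 x) * ψ x =
        ∫ x in (-2 : ℝ)..2, (Complex.exp (Complex.I * F 0 x) - Complex.exp (Complex.I * F 0 0)) * ψ x := by
      have c0 := cFl 0 (by omega)
      simp_rw [sub_mul]
      rw [intervalIntegral.integral_sub, intervalIntegral.integral_const_mul,
        intervalIntegral.integral_ofReal, hint0]
      · simp
      · exact ContinuousOn.intervalIntegrable (by rw [hI]; fun_prop)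
      · exact ContinuousOn.intervalIntegrable (by rw [hI]; fun_prop)
    rw [e1]
    have e2 := intervalIntegral.norm_integral_le_of_norm_le_const (a := -2) (b := 2)
      (f := fun x => (Complex.exp (Complex.I * F 0 x) - Complex.exp (Complex.I * F 0 0)) * ψ x)
      (C := B * M * 2) (by
        intro x hx
        rw [uIoc_of_le (by norm_num)] at hx
        have hx' : x ∈ Set.Icc (-2 : ℝ) 2 := ⟨hx.1.le, hx.2⟩
        have h1 := Convex.norm_image_sub_le_of_norm_hasDerivWithin_le
          (fun y hy => (dF 0 (by omega) y hy).hasDerivWithinAt)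
          (fun y hy => hup 1 le_rfl (by omega) y hy)
          (convex_Icc (-2 : ℝ) 2) (by norm_num : (0 : ℝ) ∈ Set.Icc (-2 : ℝ) 2) hx'
        have h2 : ‖Complex.exp (Complex.I * F 0 x) - Complex.exp (Complex.I * F 0 0)‖ ≤
            |F 0 x - F 0 0| := by
          have : Complex.exp (Complex.I * F 0 x) - Complex.exp (Complex.I * F 0 0) =
              Complex.exp (F 0 0 * Complex.I) *
                (Complex.exp (Complex.I * ((F 0 x - F 0 0 : ℝ) : ℂ)) - 1) := by
            rw [mul_sub, ← Complex.exp_add]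
            push_cast
            ring_nf
          rw [this, norm_mul, Complex.norm_exp_ofReal_mul_I, one_mul]
          exact Real.norm_exp_I_mul_ofReal_sub_one_le
        have h3 : |x| ≤ 2 := abs_le.2 hx'
        rw [sub_zero, Real.norm_eq_abs, Real.norm_eq_abs] at h1
        rw [norm_mul, Complex.norm_real, Real.norm_eq_abs]
        calc _ ≤ B * M * 2 * 1 := by
              refine mul_le_mul (h2.trans (h1.trans ?_)) (bψ x) (abs_nonneg _) (by positivity)
              gcongr
          _ = _ := mul_one _)
    norm_num at e2
    refine e2.trans ?_
    have : 0 ≤ 4 * (1 + B) + 4 / ε ^ 2 + 12 * B * n := by positivity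
    nlinarith
  · intro hM1
    have hM : 0 < M := by linarith
    have hlow : ∀ x ∈ Set.Icc (-2 : ℝ) 2, ∃ l ≤ n, ε * M ≤ |F (l + 1) x| := by
      intro x hx
      by_contra! hcon
      have h1 := abs_deriv_chain_le (by positivity : 0 ≤ ε * M) hx dF (fun l h1 h2 => by
        have := hcon (l - 1) (by omega)
        rw [Nat.sub_add_cancel h1] at this
        exact this.le) htop
      have h2 : ∑ l ∈ Finset.Icc 1 (n + 1), |F l 0| ≤ ∑ l ∈ Finset.Icc 1 (n + 1), B * (ε * M) :=
        sum_le_sum fun l hl => by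
          rw [Finset.mem_Icc] at hl
          exact h1 l hl.1 (by omega) 0 (by norm_num)
      rw [← hMs] at h2
      simp only [sum_const, Nat.card_Icc, nsmul_eq_mul] at h2
      have h3 : ((n + 1 + 1 - 1 : ℕ) : ℝ) * (B * (ε * M)) = (n + 1) / (2 * (n + 2)) * M := by
        rw [hε]
        push_cast [Nat.add_sub_cancel]
        field_simp
      rw [h3] at h2
      have h4 : ((n : ℝ) + 1) / (2 * (n + 2)) < 1 := by
        rw [div_lt_one (by positivity)]
        have : (0 : ℝ) ≤ n := by positivity
        linarith
      nlinarith
    set ρ : ℝ := M ^ (-κ) with hρ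
    have hρ0 : 0 < ρ := by positivity
    have hρ1 : ρ ≤ 1 := rpow_le_one_of_one_le_of_nonpos hM1 (by linarith)
    have hMρ : M * (ρ ^ 3 ^ n) ^ 2 = ρ⁻¹ := by
      have : M = ρ ^ (-(2 * 3 ^ n + 1) : ℝ) := by
        rw [hρ, ← rpow_mul hM.le, hκ]
        have : -(1 / (2 * 3 ^ n + 1)) * -(2 * 3 ^ n + 1) = (1 : ℝ) := by field_simp
        rw [this, rpow_one]
      rw [← pow_mul]
      conv_lhs => rw [this]
      rw [← rpow_natCast ρ (3 ^ n * 2), ← rpow_add hρ0, ← rpow_neg_one]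
      congr 1
      push_cast
      ring
    set τ : ℕ → ℝ := fun l => ρ ^ 3 ^ (n - l) with hτ
    have hτ0 : ∀ l, 0 < τ l := fun l => by positivity
    have hτρ : ∀ l, τ l ≤ ρ := fun l => pow_le_of_le_one hρ0.le hρ1 (by positivity)
    have hτs : ∀ l < n, τ l = τ (l + 1) ^ 3 := by
      intro l hl
      simp only [hτ]
      rw [← pow_mul, ← pow_succ]
      congr 2
      omega
    set h : ℕ → ℝ → ℝ := fun l x => F (l + 1) x / M with hh
    have dh : ∀ l ≤ n, ∀ x ∈ Set.Icc (-2 : ℝ) 2, HasDerivAt (h l) (h (l + 1) x) x :=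
      fun l hl x hx => (dF (l + 1) (by omega) x hx).div_const M
    have ch : ∀ l ≤ n + 1, ContinuousOn (h l) (Set.Icc (-2 : ℝ) 2) := fun l hl =>
      (cFl (l + 1) (by omega)).div_const M
    have bh : ∀ l ≤ n + 1, ∀ x ∈ Set.Icc (-2 : ℝ) 2, |h l x| ≤ B := by
      intro l hl x hx
      rw [hh, abs_div, abs_of_pos hM, div_le_iff₀ hM]
      exact hup (l + 1) (by omega) (by omega) x hx
    have lh : ∀ x ∈ Set.Icc (-2 : ℝ) 2, ∃ l ≤ n, ε ≤ |h l x| := by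
      intro x hx
      obtain ⟨l, hl, h1⟩ := hlow x hx
      refine ⟨l, hl, ?_⟩
      rwa [hh, abs_div, abs_of_pos hM, le_div_iff₀ hM]
    have hη1 : τ 0 ≤ 1 := (hτρ 0).trans hρ1
    have main := norm_integral_exp_mul_le (f := F 0) (g := h 0) (g' := h 1) hM (hτ0 0) hη1
      (fun x hx => (dF 0 (by omega) x hx).congr_deriv (by simp only [hh]; field_simp))
      (dh 0 (by omega)) (ch 1 (by omega)) (bh 1 (by omega)) dψ cψ' bψ bψ' hr hl
    have hw : ∫ x in (-2 : ℝ)..2, τ 0 ^ 2 / (h 0 x ^ 2 + τ 0 ^ 2) ≤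
        4 * (ρ / ε ^ 2) + ∑ l ∈ Finset.range n, 12 * B * ρ := by
      have cden : ∀ l ≤ n, ContinuousOn (fun x => h l x ^ 2 + τ l ^ 2) (Set.Icc (-2 : ℝ) 2) :=
        fun l hl => ((ch l (by omega)).pow 2).add continuousOn_const
      have cterm : ∀ l ∈ Finset.range n, IntervalIntegrable (fun x => τ l ^ 2 / τ (l + 1) ^ 2 *
          (h (l + 1) x ^ 2 / (h l x ^ 2 + τ l ^ 2))) volume (-2) 2 := by
        intro l hl
        rw [Finset.mem_range] at hl
        refine ContinuousOn.intervalIntegrable ?_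
        rw [hI]
        exact continuousOn_const.mul (((ch (l + 1) (by omega)).pow 2).div (cden l hl.le)
          fun x _ => by have := hτ0 l; positivity)
      have csum : IntervalIntegrable (fun x => ∑ l ∈ Finset.range n, τ l ^ 2 / τ (l + 1) ^ 2 *
          (h (l + 1) x ^ 2 / (h l x ^ 2 + τ l ^ 2))) volume (-2) 2 := by
        have := IntervalIntegrable.sum _ cterm
        rwa [Finset.sum_fn] at this
      calc ∫ x in (-2 : ℝ)..2, τ 0 ^ 2 / (h 0 x ^ 2 + τ 0 ^ 2)
          ≤ ∫ x in (-2 : ℝ)..2, (ρ / ε ^ 2 + ∑ l ∈ Finset.range n, τ l ^ 2 / τ (l + 1) ^ 2 *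
              (h (l + 1) x ^ 2 / (h l x ^ 2 + τ l ^ 2))) := by
            refine intervalIntegral.integral_mono_on (by norm_num) ?_ ?_ ?_
            · refine ContinuousOn.intervalIntegrable ?_
              rw [hI]
              exact continuousOn_const.div (cden 0 (by omega))
                fun x _ => by have := hτ0 0; positivity
            · exact intervalIntegrable_const.add csum
            · intro x hx
              refine (weight_zero_le_prod_add_sum (fun l => h l x) τ hτ0 n).trans ?_
              gcongr
              obtain ⟨l, hl, h1⟩ := lh x hx
              have p0 : ∀ l, 0 ≤ τ l ^ 2 / (h l x ^ 2 + τ l ^ 2) := fun l => by positivity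
              have p1 : ∀ l, τ l ^ 2 / (h l x ^ 2 + τ l ^ 2) ≤ 1 := fun l => by
                have := hτ0 l
                rw [div_le_one (by positivity)]
                nlinarith [sq_nonneg (h l x)]
              have hmem : l ∈ Finset.range (n + 1) := Finset.mem_range.2 (by omega)
              rw [← Finset.mul_prod_erase _ _ hmem]
              calc _ ≤ τ l ^ 2 / (h l x ^ 2 + τ l ^ 2) :=
                    mul_le_of_le_one_right (p0 l) (prod_le_one (fun l _ => p0 l) fun l _ => p1 l)
                _ ≤ ρ / ε ^ 2 := by
                    have h2 : ε ^ 2 ≤ h l x ^ 2 := by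
                      rw [← sq_abs (h l x)]; gcongr
                    have h3 : τ l ^ 2 ≤ ρ := by
                      have := hτρ l
                      have := hτ0 l
                      nlinarith
                    have : ε ^ 2 ≤ h l x ^ 2 + τ l ^ 2 := by nlinarith [sq_nonneg (τ l)]
                    gcongr
        _ = 4 * (ρ / ε ^ 2) + ∑ l ∈ Finset.range n, τ l ^ 2 / τ (l + 1) ^ 2 *
              ∫ x in (-2 : ℝ)..2, (h (l + 1) x ^ 2 / (h l x ^ 2 + τ l ^ 2)) := by
            rw [intervalIntegral.integral_add intervalIntegrable_const csum,
              intervalIntegral.integral_finsetSum cterm]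
            simp_rw [intervalIntegral.integral_const_mul]
            congr 1
            rw [intervalIntegral.integral_const, smul_eq_mul]
            norm_num
        _ ≤ _ := by
            refine add_le_add le_rfl (sum_le_sum fun l hl => ?_)
            rw [Finset.mem_range] at hl
            have h1 := integral_sq_deriv_div_le (hτ0 l) (dh l (by omega)) (dh (l + 1) (by omega))
              (ch (l + 2) (by omega)) (bh (l + 1) (by omega)) (bh (l + 2) (by omega))
            have h2 := hτ0 (l + 1)
            have h3 := hτ0 l
            calc _ ≤ τ l ^ 2 / τ (l + 1) ^ 2 * (12 * B / τ l) := by gcongr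
              _ = 12 * B * τ (l + 1) := by
                  rw [hτs l hl]
                  field_simp
              _ ≤ _ := by gcongr; exact hτρ _
    have e5 : 4 * (1 + B) / (M * τ 0 ^ 2) = 4 * (1 + B) * ρ := by
      rw [show τ 0 ^ 2 = (ρ ^ 3 ^ n) ^ 2 from rfl, hMρ, div_inv_eq_mul]
    rw [e5] at main
    refine (main.trans (add_le_add_right hw _)).trans ?_
    simp only [sum_const, Finset.card_range, nsmul_eq_mul]
    have : 4 * (1 + B) * ρ + (4 * (ρ / ε ^ 2) + n * (12 * B * ρ)) =
      (4 * (1 + B) + 4 / ε ^ 2 + 12 * B * n) * ρ := by ring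
    rw [this]
    gcongr
    linarith

/-- The directional derivative operator `∂_v`. -/
def dirDeriv (v : ℝ × ℝ) (f : ℝ × ℝ → ℝ) (p : ℝ × ℝ) : ℝ := fderiv ℝ f p v

theorem AnalyticAt.dirDeriv {f : ℝ × ℝ → ℝ} {p : ℝ × ℝ} (hf : AnalyticAt ℝ f p) (v : ℝ × ℝ) :
    AnalyticAt ℝ (dirDeriv v f) p :=
  (ContinuousLinearMap.apply ℝ ℝ v).analyticAt _ |>.comp hf.fderiv

theorem AnalyticAt.iterate_dirDeriv {f : ℝ × ℝ → ℝ} {p : ℝ × ℝ} (hf : AnalyticAt ℝ f p)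
    (v : ℝ × ℝ) (n : ℕ) : AnalyticAt ℝ ((_root_.dirDeriv v)^[n] f) p := by
  induction n with
  | zero => exact hf
  | succ n ih => rw [Function.iterate_succ_apply']; exact ih.dirDeriv v

section dirDeriv

open Filter Topology

variable {f g : ℝ × ℝ → ℝ} {p v : ℝ × ℝ}

theorem Filter.EventuallyEq.dirDeriv (h : f =ᶠ[𝓝 p] g) (v : ℝ × ℝ) :
    dirDeriv v f =ᶠ[𝓝 p] dirDeriv v g := by
  filter_upwards [h.fderiv (𝕜 := ℝ)] with x hx
  simp only [_root_.dirDeriv, hx]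

theorem Filter.EventuallyEq.iterate_dirDeriv (h : f =ᶠ[𝓝 p] g) (v : ℝ × ℝ) (n : ℕ) :
    (_root_.dirDeriv v)^[n] f =ᶠ[𝓝 p] (_root_.dirDeriv v)^[n] g := by
  induction n with
  | zero => exact h
  | succ n ih => simp only [Function.iterate_succ_apply']; exact ih.dirDeriv v

theorem dirDeriv_comm (hf : AnalyticAt ℝ f p) (v w : ℝ × ℝ) :
    dirDeriv v (dirDeriv w f) =ᶠ[𝓝 p] dirDeriv w (dirDeriv v f) := by
  filter_upwards [hf.eventually_analyticAt] with x hx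
  have hs : IsSymmSndFDerivAt ℝ f x := (hx.contDiffAt (n := ⊤)).isSymmSndFDerivAt le_top
  have key : ∀ a b : ℝ × ℝ, dirDeriv a (dirDeriv b f) x = fderiv ℝ (fderiv ℝ f) x a b := by
    intro a b
    change fderiv ℝ (fun y => fderiv ℝ f y b) x a = _
    rw [fderiv_clm_apply hx.fderiv.differentiableAt (differentiableAt_const b)]
    simp
  rw [key, key, hs]

theorem dirDeriv_iterate_comm (hf : AnalyticAt ℝ f p) (v w : ℝ × ℝ) (n : ℕ) :
    dirDeriv v ((dirDeriv w)^[n] f) =ᶠ[𝓝 p] (dirDeriv w)^[n] (dirDeriv v f) := by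
  induction n with
  | zero => rfl
  | succ n ih =>
    simp only [Function.iterate_succ_apply']
    exact (dirDeriv_comm (hf.iterate_dirDeriv w n) v w).trans (ih.dirDeriv w)

theorem iterate_dirDeriv_comm (hf : AnalyticAt ℝ f p) (v w : ℝ × ℝ) (m n : ℕ) :
    (dirDeriv v)^[m] ((dirDeriv w)^[n] f) =ᶠ[𝓝 p] (dirDeriv w)^[n] ((dirDeriv v)^[m] f) := by
  induction m with
  | zero => rfl
  | succ m ih =>
    simp only [Function.iterate_succ_apply']
    exact (ih.dirDeriv v).trans (dirDeriv_iterate_comm (hf.iterate_dirDeriv v m) v w n)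

theorem hasDerivAt_comp_add_smul {t : ℝ} (hf : AnalyticAt ℝ f (p + t • v)) :
    HasDerivAt (fun t : ℝ => f (p + t • v)) (dirDeriv v f (p + t • v)) t := by
  have h1 : HasDerivAt (fun t : ℝ => p + t • v) v t := by
    simpa using ((hasDerivAt_id t).smul_const v).const_add p
  exact hf.differentiableAt.hasFDerivAt.comp_hasDerivAt t h1

theorem AnalyticAt.comp_add_smul {t : ℝ} (hf : AnalyticAt ℝ f (p + t • v)) :
    AnalyticAt ℝ (fun t : ℝ => f (p + t • v)) t :=
  AnalyticAt.fun_comp (f := fun t : ℝ => p + t • v) hf (by fun_prop)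

theorem iteratedDeriv_comp_add_smul (hf : AnalyticAt ℝ f p) (v : ℝ × ℝ) (n : ℕ) :
    iteratedDeriv n (fun t : ℝ => f (p + t • v)) 0 = (dirDeriv v)^[n] f p := by
  have h0 : Tendsto (fun t : ℝ => p + t • v) (𝓝 0) (𝓝 p) :=
    Continuous.tendsto' (by fun_prop) _ _ (by simp)
  have key : iteratedDeriv n (fun t : ℝ => f (p + t • v)) =ᶠ[𝓝 0]
      fun t : ℝ => (dirDeriv v)^[n] f (p + t • v) := by
    induction n with
    | zero => simp
    | succ n ih =>
      rw [iteratedDeriv_succ]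
      refine ih.deriv.trans ?_
      filter_upwards [h0.eventually hf.eventually_analyticAt] with t ht
      rw [Function.iterate_succ_apply']
      exact (hasDerivAt_comp_add_smul (ht.iterate_dirDeriv v n)).deriv
  simpa using key.eq_of_nhds

theorem comp_add_smul_eventuallyEq_zero (hf : AnalyticAt ℝ f p)
    (hv : ∀ n, (dirDeriv v)^[n] f p = 0) : (fun t : ℝ => f (p + t • v)) =ᶠ[𝓝 0] 0 := by
  have ha : AnalyticAt ℝ (fun t : ℝ => f (p + t • v)) 0 :=
    AnalyticAt.comp_add_smul (by simpa using hf)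
  refine analyticOrderAt_eq_top.1 (ENat.eq_top_iff_forall_ge.2 fun m => ?_)
  rw [natCast_le_analyticOrderAt_iff_iteratedDeriv_eq_zero ha]
  intro i _
  rw [iteratedDeriv_comp_add_smul hf, hv]

theorem comp_add_smul_eq_zero {r : ℝ} (hr : 0 < r)
    (hf : ∀ t ∈ Metric.ball (0 : ℝ) r, AnalyticAt ℝ f (p + t • v))
    (hv : ∀ n, (dirDeriv v)^[n] f p = 0) {t : ℝ} (ht : t ∈ Metric.ball (0 : ℝ) r) :
    f (p + t • v) = 0 := by
  have h0 : (0 : ℝ) ∈ Metric.ball (0 : ℝ) r := Metric.mem_ball_self hr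
  have hp : AnalyticAt ℝ f p := by simpa using hf 0 h0
  exact AnalyticOnNhd.eqOn_zero_of_preconnected_of_eventuallyEq_zero
    (f := fun t : ℝ => f (p + t • v)) (U := Metric.ball (0 : ℝ) r)
    (fun t ht => (hf t ht).comp_add_smul)
    (convex_ball _ _).isPreconnected h0 (comp_add_smul_eventuallyEq_zero hp hv) ht

theorem fst_smul_add_snd_smul (p : ℝ × ℝ) :
    p = p.2 • ((0, 1) : ℝ × ℝ) + p.1 • ((1, 0) : ℝ × ℝ) := by
  ext <;> simp

/-- A real-analytic function all of whose mixed derivatives vanish at the origin vanishes nearby. -/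
theorem eventually_eq_zero_of_mixed_derivs (hf : AnalyticAt ℝ f 0)
    (h : ∀ m n, (dirDeriv (0, 1))^[n] ((dirDeriv (1, 0))^[m] f) 0 = 0) :
    ∀ᶠ p in 𝓝 (0 : ℝ × ℝ), f p = 0 := by
  obtain ⟨r, hr, hball⟩ := Metric.eventually_nhds_iff_ball.1 hf.eventually_analyticAt
  have hmem : ∀ a b : ℝ, a ∈ Metric.ball (0 : ℝ) r → b ∈ Metric.ball (0 : ℝ) r →
      b • ((0, 1) : ℝ × ℝ) + a • ((1, 0) : ℝ × ℝ) ∈ Metric.ball (0 : ℝ × ℝ) r := by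
    intro a b ha hb
    rw [mem_ball_zero_iff] at *
    simpa [Prod.norm_def] using ⟨ha, hb⟩
  have h1 : ∀ m, ∀ b ∈ Metric.ball (0 : ℝ) r,
      (dirDeriv (1, 0))^[m] f (b • ((0, 1) : ℝ × ℝ)) = 0 := by
    intro m b hb
    have := comp_add_smul_eq_zero (p := 0) (v := (0, 1)) (f := (dirDeriv (1, 0))^[m] f) hr
      (fun t ht => (hball _ (by
        simpa using hmem 0 t (Metric.mem_ball_self hr) ht)).iterate_dirDeriv _ _) (h m) hb
    simpa using this
  filter_upwards [Metric.ball_mem_nhds (0 : ℝ × ℝ) hr] with p hp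
  rw [mem_ball_zero_iff] at hp
  have hp1 : p.1 ∈ Metric.ball (0 : ℝ) r := mem_ball_zero_iff.2 ((norm_fst_le p).trans_lt hp)
  have hp2 : p.2 ∈ Metric.ball (0 : ℝ) r := mem_ball_zero_iff.2 ((norm_snd_le p).trans_lt hp)
  rw [fst_smul_add_snd_smul p]
  exact comp_add_smul_eq_zero hr (fun t ht => hball _ (hmem t p.2 ht hp2)) (fun m => h1 m _ hp2) hp1

theorem exists_bound_abs_fst_pow (m : ℕ) : ∀ f : ℝ × ℝ → ℝ, AnalyticAt ℝ f 0 →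
    (∀ i < m, ∀ n, (dirDeriv (0, 1))^[n] ((dirDeriv (1, 0))^[i] f) 0 = 0) →
    ∃ C, 0 ≤ C ∧ ∀ᶠ p in 𝓝 (0 : ℝ × ℝ), |f p| ≤ C * |p.1| ^ m := by
  induction m with
  | zero =>
    intro f hf _
    refine ⟨|f 0| + 1, by positivity, ?_⟩
    filter_upwards [hf.continuousAt.abs.eventually (gt_mem_nhds (lt_add_one |f 0|))] with p hp
    simpa using hp.le
  | succ m ih =>
    intro f hf h
    obtain ⟨C, hC, hb⟩ := ih (dirDeriv (1, 0) f) (hf.dirDeriv _) fun i hi n => by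
      rw [← Function.iterate_succ_apply]
      exact h (i + 1) (by omega) n
    have h0 := comp_add_smul_eventuallyEq_zero (v := (0, 1)) hf (h 0 (by omega))
    have h0' : ∀ᶠ p : ℝ × ℝ in 𝓝 0, f (0 + p.2 • ((0, 1) : ℝ × ℝ)) = 0 :=
      (continuous_snd.tendsto' (0 : ℝ × ℝ) 0 rfl).eventually h0
    obtain ⟨r, hr, hball⟩ := Metric.eventually_nhds_iff_ball.1
      ((hf.eventually_analyticAt.and hb).and h0')
    refine ⟨C, hC, ?_⟩
    filter_upwards [Metric.ball_mem_nhds (0 : ℝ × ℝ) hr] with p hp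
    set q : ℝ × ℝ := p.2 • ((0, 1) : ℝ × ℝ) with hq
    have hmem : ∀ t ∈ Metric.closedBall (0 : ℝ) |p.1|, q + t • ((1, 0) : ℝ × ℝ) ∈
        Metric.ball (0 : ℝ × ℝ) r := by
      intro t ht
      rw [mem_closedBall_zero_iff] at ht
      rw [mem_ball_zero_iff] at *
      refine lt_of_le_of_lt ?_ hp
      rw [Prod.norm_def, Prod.norm_def]
      apply max_le_max <;> simp [hq]
      exact ht
    have hz : f (q + (0 : ℝ) • ((1, 0) : ℝ × ℝ)) = 0 := by
      simpa [hq] using (hball p hp).2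
    have := Convex.norm_image_sub_le_of_norm_hasDerivWithin_le
      (f := fun t : ℝ => f (q + t • ((1, 0) : ℝ × ℝ))) (C := C * |p.1| ^ m)
      (fun t ht => (hasDerivAt_comp_add_smul (hball _ (hmem t ht)).1.1).hasDerivWithinAt)
      (fun t ht => by
        refine ((hball _ (hmem t ht)).1.2).trans ?_
        rw [mem_closedBall_zero_iff, Real.norm_eq_abs] at ht
        have : (q + t • ((1, 0) : ℝ × ℝ)).1 = t := by simp [hq]
        rw [this]
        gcongr)
      (convex_closedBall (0 : ℝ) |p.1|) (x := 0) (y := p.1) (by simp) (by simp)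
    rw [hz, hq, ← fst_smul_add_snd_smul p, sub_zero, sub_zero, Real.norm_eq_abs,
      Real.norm_eq_abs] at this
    rwa [pow_succ, ← mul_assoc]

/-- Finite-type control of a real-analytic phase, uniform in the first variable: some
low-order `s`-derivative on `{s = 0}` dominates a high-order one on a whole neighborhood. -/
theorem exists_deriv_domination {P : ℝ × ℝ → ℝ} (hP : AnalyticAt ℝ P 0) (k : ℕ) :
    ∃ n D : ℕ, ∃ C r : ℝ, 1 ≤ n ∧ n ≠ k ∧ n ≤ D + 1 ∧ k ≤ D + 1 ∧ 0 ≤ C ∧ 0 < r ∧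
      ∀ p ∈ Metric.ball (0 : ℝ × ℝ) r, AnalyticAt ℝ P p ∧
        |(dirDeriv (0, 1))^[D + 2] P p| ≤ C * |(dirDeriv (0, 1))^[n] P (p.1, 0)| := by
  classical
  by_cases hex : ∃ m n, n ≠ 0 ∧ n ≠ k ∧ (dirDeriv (0, 1))^[n] ((dirDeriv (1, 0))^[m] P) 0 ≠ 0
  · obtain ⟨n, hn0, hnk, hne⟩ := Nat.find_spec hex
    set m := Nat.find hex with hm
    have hmin : ∀ i < m, ∀ n, n ≠ 0 → n ≠ k →
        (dirDeriv (0, 1))^[n] ((dirDeriv (1, 0))^[i] P) 0 = 0 := by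
      intro i hi n h1 h2
      by_contra h3
      exact Nat.find_min hex hi ⟨n, h1, h2, h3⟩
    have hup := exists_bound_abs_fst_pow m _ (hP.iterate_dirDeriv (0, 1) (n + k + 2))
      fun i hi l => by
        rw [((iterate_dirDeriv_comm hP (1, 0) (0, 1) i (n + k + 2)).iterate_dirDeriv (0, 1)
          l).eq_of_nhds, ← Function.iterate_add_apply]
        exact hmin i hi _ (by omega) (by omega)
    obtain ⟨C, hC, hup⟩ := hup
    have hPn := hP.iterate_dirDeriv (0, 1) n
    have hg : AnalyticAt ℝ (fun u : ℝ => (dirDeriv (0, 1))^[n] P (0 + u • ((1, 0) : ℝ × ℝ))) 0 :=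
      AnalyticAt.comp_add_smul (by simpa using hPn)
    have hd : ∀ i, iteratedDeriv i
        (fun u : ℝ => (dirDeriv (0, 1))^[n] P (0 + u • ((1, 0) : ℝ × ℝ))) 0 =
        (dirDeriv (0, 1))^[n] ((dirDeriv (1, 0))^[i] P) 0 := fun i => by
      rw [iteratedDeriv_comp_add_smul hPn, (iterate_dirDeriv_comm hP _ _ _ _).eq_of_nhds]
    have hord : analyticOrderAt
        (fun u : ℝ => (dirDeriv (0, 1))^[n] P (0 + u • ((1, 0) : ℝ × ℝ))) 0 = m := by
      rw [analyticOrderAt_eq_nat_iff_iteratedDeriv_eq_zero hg]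
      exact ⟨fun i hi => (hd i).trans (hmin i hi n hn0 hnk), by rwa [hd]⟩
    obtain ⟨φ, hφ, hφ0, hgφ⟩ := hg.analyticOrderAt_eq_natCast.1 hord
    have hφpos : 0 < |φ 0| := abs_pos.2 hφ0
    have hlow : ∀ᶠ u : ℝ in 𝓝 0, |φ 0| / 2 < |φ u| :=
      hφ.continuousAt.abs.eventually (lt_mem_nhds (half_lt_self hφpos))
    have hboth : ∀ᶠ p : ℝ × ℝ in 𝓝 0, _ :=
      (continuous_fst.tendsto' (0 : ℝ × ℝ) 0 rfl).eventually (hlow.and hgφ)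
    obtain ⟨r, hr, hball⟩ := Metric.eventually_nhds_iff_ball.1
      ((hP.eventually_analyticAt.and hup).and hboth)
    refine ⟨n, n + k, C * (2 / |φ 0|), r, by omega, hnk, by omega, by omega, by positivity, hr,
      fun p hp => ⟨(hball p hp).1.1, ?_⟩⟩
    obtain ⟨⟨-, h1⟩, h2, h3⟩ := hball p hp
    have h4 : (0 : ℝ × ℝ) + p.1 • ((1, 0) : ℝ × ℝ) = (p.1, 0) := by ext <;> simp
    rw [h4, sub_zero, smul_eq_mul] at h3
    rw [h3, abs_mul, abs_pow]
    refine h1.trans ?_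
    rw [mul_assoc]
    gcongr
    calc |p.1| ^ m = |p.1| ^ m * (2 / |φ 0| * (|φ 0| / 2)) := by field_simp
      _ ≤ |p.1| ^ m * (2 / |φ 0| * |φ p.1|) := by gcongr
      _ = _ := by ring
  · push Not at hex
    have hz := eventually_eq_zero_of_mixed_derivs (hP.iterate_dirDeriv (0, 1) (k + 2))
      fun m n => by
        rw [((iterate_dirDeriv_comm hP (1, 0) (0, 1) m (k + 2)).iterate_dirDeriv (0, 1)
          n).eq_of_nhds, ← Function.iterate_add_apply]
        exact hex m _ (by omega) (by omega)
    obtain ⟨r, hr, hball⟩ := Metric.eventually_nhds_iff_ball.1 (hP.eventually_analyticAt.and hz)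
    refine ⟨k + 1, k, 0, r, by omega, by omega, by omega, by omega, le_rfl, hr,
      fun p hp => ⟨(hball p hp).1, ?_⟩⟩
    rw [(hball p hp).2]
    simp

end dirDeriv

section sums

theorem sum_le_one_div_one_sub {ι : Type*} {S : Finset ι} {b : ι → ℝ} {f : ι → ℕ} {r : ℝ}
    (hr0 : 0 ≤ r) (hr1 : r < 1) (hf : Set.InjOn f S) (hb : ∀ i ∈ S, b i ≤ r ^ f i) :
    ∑ i ∈ S, b i ≤ (1 - r)⁻¹ := by
  refine (Finset.sum_le_sum hb).trans ?_
  rw [← Finset.sum_image (f := fun n => r ^ n) hf]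
  exact sum_le_hasSum _ (fun _ _ => by positivity) (hasSum_geometric_of_lt_one hr0 hr1)

/-- A sequence that at least doubles at each step has bounded sums of `min (M, M ^ (-κ))`. -/
theorem sum_le_of_two_mul_le {κ : ℝ} (hκ : 0 < κ) {M b : ℤ → ℝ}
    (hM : ∀ j, 2 * M j ≤ M (j + 1)) (hb : ∀ j, b j ≤ M j) (hb' : ∀ j, 1 ≤ M j → b j ≤ M j ^ (-κ))
    (S : Finset ℤ) : ∑ j ∈ S, b j ≤ 2 + (1 - (2 : ℝ) ^ (-κ))⁻¹ := by
  classical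
  have hpow : ∀ j, ∀ n : ℕ, 2 ^ n * M j ≤ M (j + n) := by
    intro j n
    induction n with
    | zero => simp
    | succ n ih =>
      have := hM (j + n)
      rw [Nat.cast_succ, ← add_assoc, pow_succ]
      linarith
  have hle : ∀ i j, i ≤ j → 2 ^ (j - i).toNat * M i ≤ M j := by
    intro i j hij
    have := hpow i (j - i).toNat
    rwa [Int.toNat_of_nonneg (by omega), add_sub_cancel] at this
  have hr1 : (2 : ℝ) ^ (-κ) < 1 := rpow_lt_one_of_one_lt_of_neg (by norm_num) (by linarith)
  rw [← Finset.sum_filter_add_sum_filter_not S (fun j => M j < 1)]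
  apply add_le_add
  · rcases (S.filter fun j => M j < 1).eq_empty_or_nonempty with h | h
    · simp [h]
    · set m := (S.filter fun j => M j < 1).max' h with hm
      have hm1 : M m < 1 := (Finset.mem_filter.1 (Finset.max'_mem _ h)).2
      have := sum_le_one_div_one_sub (S := S.filter fun j => M j < 1) (b := b) (r := 1 / 2)
        (f := fun j => (m - j).toNat) (by norm_num) (by norm_num)
        (fun i hi j hj hij => by
          have h1 := Finset.le_max' _ _ hi
          have h2 := Finset.le_max' _ _ hj
          simp only at hij
          omega)
        (fun j hj => by
          have h1 := hle j m (Finset.le_max' _ _ hj)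
          refine (hb j).trans ?_
          rw [one_div_pow, le_div_iff₀ (by positivity)]
          linarith)
      norm_num at this
      exact this
  · rcases (S.filter fun j => ¬ M j < 1).eq_empty_or_nonempty with h | h
    · rw [h, Finset.sum_empty, inv_nonneg]
      linarith
    · set m := (S.filter fun j => ¬ M j < 1).min' h with hm
      have hm1 : 1 ≤ M m := not_lt.1 (Finset.mem_filter.1 (Finset.min'_mem _ h)).2
      refine sum_le_one_div_one_sub (f := fun j => (j - m).toNat) (by positivity) hr1
        (fun i hi j hj hij => ?_) fun j hj => ?_
      · have h1 := Finset.min'_le _ _ hi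
        have h2 := Finset.min'_le _ _ hj
        simp only at hij
        omega
      · have h1 := hle m j (Finset.min'_le _ _ hj)
        refine (hb' j (not_lt.1 (Finset.mem_filter.1 hj).2)).trans ?_
        rw [← rpow_natCast, ← rpow_mul (by norm_num), mul_comm, rpow_mul (by norm_num), rpow_natCast]
        refine rpow_le_rpow_of_nonpos (by positivity) ?_ (by linarith)
        exact (le_mul_of_one_le_right (by positivity) hm1).trans h1

/-- The dyadic scales comparable to a fixed positive number. -/
theorem sum_dyadic_indicator_le {d : ℝ} (hd : 0 < d) (S : Finset ℤ) :
    ∑ k ∈ S, (if 1 / 2 ≤ (2 : ℝ) ^ (-k) * d ∧ (2 : ℝ) ^ (-k) * d ≤ 2 then (2 : ℝ) ^ (-k) else 0) ≤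
      6 / d := by
  classical
  obtain ⟨k₀, hk₀⟩ := exists_mem_Ico_zpow hd (one_lt_two : (1 : ℝ) < 2)
  rw [← Finset.sum_filter]
  have hsub : S.filter (fun k => 1 / 2 ≤ (2 : ℝ) ^ (-k) * d ∧ (2 : ℝ) ^ (-k) * d ≤ 2) ⊆
      Finset.Icc (k₀ - 1) (k₀ + 1) := by
    intro k hk
    obtain ⟨-, h1, h2⟩ := Finset.mem_filter.1 hk
    have hk0 : (0 : ℝ) < 2 ^ k := by positivity
    rw [zpow_neg, inv_mul_eq_div] at h1 h2
    rw [le_div_iff₀ hk0] at h1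
    rw [div_le_iff₀ hk0] at h2
    have h3 : (2 : ℝ) ^ k₀ ≤ 2 ^ (k + 1) := by
      rw [zpow_add_one₀ two_ne_zero, mul_comm]; exact hk₀.1.trans h2
    have h4 : (2 : ℝ) ^ (k - 1) < 2 ^ (k₀ + 1) := by
      rw [zpow_sub_one₀ two_ne_zero]
      refine lt_of_le_of_lt ?_ hk₀.2
      linarith
    rw [zpow_le_zpow_iff_right₀ one_lt_two] at h3
    rw [zpow_lt_zpow_iff_right₀ one_lt_two] at h4
    rw [Finset.mem_Icc]
    omega
  have hcard := Finset.card_le_card hsub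
  rw [Int.card_Icc] at hcard
  have hcard' : (S.filter (fun k => 1 / 2 ≤ (2 : ℝ) ^ (-k) * d ∧
      (2 : ℝ) ^ (-k) * d ≤ 2)).card ≤ 3 := hcard.trans (by omega)
  refine (Finset.sum_le_card_nsmul _ _ (2 / d) fun k hk => ?_).trans ?_
  · rw [le_div_iff₀ hd]
    exact (Finset.mem_filter.1 hk).2.2
  · rw [nsmul_eq_mul]
    calc _ ≤ ((3 : ℕ) : ℝ) * (2 / d) := by gcongr
      _ = 6 / d := by push_cast; ring

end sums

section phase

variable {P : ℝ × ℝ → ℝ}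

/-- The `l`-th derivative in `σ` of the phase `2 π λ (2 y s ^ m + P (u, s))` at `s = a σ`. -/
def phaseDeriv (P : ℝ × ℝ → ℝ) (m : ℕ) (lam y u a : ℝ) (l : ℕ) (σ : ℝ) : ℝ :=
  2 * π * lam * a ^ l *
    (2 * y * (m.descFactorial l * (a * σ) ^ (m - l)) + (dirDeriv (0, 1))^[l] P (u, a * σ))

theorem phaseDeriv_zero (m : ℕ) (lam y u a σ : ℝ) :
    phaseDeriv P m lam y u a 0 σ = 2 * π * lam * (2 * y * (a * σ) ^ m + P (u, a * σ)) := by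
  simp [phaseDeriv]

theorem hasDerivAt_snd {f : ℝ × ℝ → ℝ} {u s : ℝ} (hf : AnalyticAt ℝ f (u, s)) :
    HasDerivAt (fun t => f (u, t)) (dirDeriv (0, 1) f (u, s)) s := by
  have h := hasDerivAt_comp_add_smul (f := f) (p := (u, 0)) (v := (0, 1)) (t := s) (by simpa using hf)
  simpa using h

theorem hasDerivAt_phaseDeriv (m : ℕ) (lam y : ℝ) {u a σ : ℝ} (l : ℕ)
    (hP : AnalyticAt ℝ P (u, a * σ)) :
    HasDerivAt (phaseDeriv P m lam y u a l) (phaseDeriv P m lam y u a (l + 1) σ) σ := by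
  have ha : HasDerivAt (fun σ => a * σ) a σ := by simpa using (hasDerivAt_id σ).const_mul a
  have h1 := (ha.pow (m - l)).const_mul (m.descFactorial l : ℝ)
  have h2 := HasDerivAt.comp σ (hasDerivAt_snd (hP.iterate_dirDeriv (0, 1) l)) ha
  have h3 := ((h1.const_mul (2 * y)).add h2).const_mul (2 * π * lam * a ^ l)
  refine h3.congr_deriv ?_
  rw [phaseDeriv, Function.iterate_succ_apply', Nat.descFactorial_succ, Nat.cast_mul,
    Nat.sub_sub]
  ring

theorem phaseDeriv_two_mul_zero (m : ℕ) (lam y u a : ℝ) (l : ℕ) :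
    phaseDeriv P m lam y u (2 * a) l 0 = 2 ^ l * phaseDeriv P m lam y u a l 0 := by
  simp only [phaseDeriv, mul_zero, mul_pow]
  ring

theorem phaseDeriv_zero_right_of_ne {m n : ℕ} (h : n ≠ m) (lam y u a : ℝ) :
    phaseDeriv P m lam y u a n 0 =
      2 * π * lam * a ^ n * (dirDeriv (0, 1))^[n] P (u, 0) := by
  have : (m.descFactorial n : ℝ) * (a * 0) ^ (m - n) = 0 := by
    rcases lt_or_gt_of_ne h with h | h
    · simp [Nat.sub_ne_zero_of_lt h]
    · simp [Nat.descFactorial_of_lt h]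
  rw [phaseDeriv, this, mul_zero, mul_zero, zero_add]

theorem abs_phaseDeriv_le {m n q : ℕ} {C lam y u a σ : ℝ} (hn : n < q) (hm : m < q) (hnm : n ≠ m)
    (ha : 0 ≤ a) (ha1 : a ≤ 1)
    (h : |(dirDeriv (0, 1))^[q] P (u, a * σ)| ≤ C * |(dirDeriv (0, 1))^[n] P (u, 0)|) :
    |phaseDeriv P m lam y u a q σ| ≤ C * a * |phaseDeriv P m lam y u a n 0| := by
  rw [phaseDeriv_zero_right_of_ne hnm, phaseDeriv, Nat.descFactorial_of_lt hm, Nat.cast_zero,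
    zero_mul, mul_zero, zero_add, abs_mul, abs_mul _ ((dirDeriv (0, 1))^[n] P (u, 0)), abs_mul,
    abs_mul _ (a ^ n), abs_pow, abs_pow, abs_of_nonneg ha]
  have hpow : a ^ q ≤ a * a ^ n := by
    rw [← pow_succ']
    exact pow_le_pow_of_le_one ha ha1 hn
  calc _ ≤ |2 * π * lam| * (a * a ^ n) * (C * |(dirDeriv (0, 1))^[n] P (u, 0)|) := by gcongr
    _ = _ := by ring

end phase

section bump

variable {φ : ℤ × ℤ → ℝ × ℝ → ℝ}

theorem integral_mul_scaledBump (φ : ℤ × ℤ → ℝ × ℝ → ℝ) (I : ℤ × ℤ) (u : ℝ) (f : ℝ → ℂ) :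
    ∫ s, f s * (scaledBump φ I (s, u) : ℂ) =
      ((2 ^ (-I.2) : ℝ) : ℂ) * ∫ x, f (2 ^ I.1 * x) * (φ I (x, 2 ^ (-I.2) * u) : ℂ) := by
  have hpos : (0 : ℝ) < 2 ^ I.1 := by positivity
  calc ∫ s, f s * (scaledBump φ I (s, u) : ℂ)
      = ∫ s : ℝ, (fun x : ℝ => ((2 ^ (-(I.1 + I.2)) : ℝ) : ℂ) *
          (f (2 ^ I.1 * x) * (φ I (x, 2 ^ (-I.2) * u) : ℂ))) (2 ^ (-I.1) * s) := by
        refine integral_congr_ae (.of_forall fun s => ?_)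
        have hl : (2 : ℝ) ^ I.1 * (2 ^ (-I.1) * s) = s := by
          rw [zpow_neg, mul_inv_cancel_left₀ hpos.ne']
        simp only [hl, scaledBump, Complex.ofReal_mul]
        ring
    _ = _ := by
        refine (Measure.integral_comp_mul_left (fun x : ℝ => ((2 ^ (-(I.1 + I.2)) : ℝ) : ℂ) *
          (f (2 ^ I.1 * x) * (φ I (x, 2 ^ (-I.2) * u) : ℂ))) _).trans ?_
        rw [integral_const_mul, Complex.real_smul, ← mul_assoc,
          ← Complex.ofReal_mul, ← zpow_neg, neg_neg, abs_of_pos hpos, ← zpow_add₀ two_ne_zero]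
        congr 3
        ring

theorem IsBumpFamily.fst_eq_zero {N : ℕ} (hφ : IsBumpFamily N φ) (I : ℤ × ℤ) {x v : ℝ}
    (hx : 2 ≤ |x|) : φ I (x, v) = 0 := by
  have hcont : Continuous fun x => φ I (x, v) := (hφ I).1.continuous.comp (by fun_prop)
  have hlt : ∀ x : ℝ, 2 < |x| → φ I (x, v) = 0 := fun x hx => by
    by_contra h
    exact absurd ((hφ I).2.1 _ h).2.1 (not_le.2 hx)
  have hclosed : IsClosed {x | φ I (x, v) = 0} := isClosed_eq hcont continuous_const
  rcases le_abs.1 hx with h | h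
  · have := closure_minimal (s := Set.Ioi 2)
      (fun z (hz : 2 < z) => hlt z (hz.trans_le (le_abs_self z))) hclosed
    rw [closure_Ioi] at this
    exact this h
  · have := closure_minimal (s := Set.Iio (-2))
      (fun z (hz : z < -2) => hlt z (lt_of_lt_of_le (by linarith) (neg_le_abs z))) hclosed
    rw [closure_Iio] at this
    exact this (show x ≤ -2 by linarith)

theorem IsBumpFamily.abs_le {N : ℕ} (hφ : IsBumpFamily N φ) (I : ℤ × ℤ) (p : ℝ × ℝ) :
    |φ I p| ≤ 1 := by
  simpa using (hφ I).2.2.2.2 0 (Nat.zero_le _) p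

theorem IsBumpFamily.abs_fderiv_le (hφ : IsBumpFamily 1 φ) (I : ℤ × ℤ) (p : ℝ × ℝ) :
    |fderiv ℝ (φ I) p (1, 0)| ≤ 1 := by
  have h := (hφ I).2.2.2.2 1 le_rfl p
  rw [norm_iteratedFDeriv_one] at h
  have h1 := (fderiv ℝ (φ I) p).le_opNorm (1, 0)
  rw [show ‖((1 : ℝ), (0 : ℝ))‖ = 1 by simp [Prod.norm_def], mul_one] at h1
  exact h1.trans h

theorem IsBumpFamily.hasDerivAt {N : ℕ} (hφ : IsBumpFamily N φ) (I : ℤ × ℤ) (x v : ℝ) :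
    HasDerivAt (fun x => φ I (x, v)) (fderiv ℝ (φ I) (x, v) (1, 0)) x :=
  (((hφ I).1.differentiable (by simp)) (x, v)).hasFDerivAt.comp_hasDerivAt x
    ((hasDerivAt_id x).prodMk (hasDerivAt_const x v))

theorem IsBumpFamily.continuous_fderiv {N : ℕ} (hφ : IsBumpFamily N φ) (I : ℤ × ℤ) (v : ℝ) :
    Continuous fun x => fderiv ℝ (φ I) (x, v) (1, 0) :=
  (((hφ I).1.continuous_fderiv (by simp)).comp
    (by fun_prop : Continuous fun x : ℝ => (x, v))).clm_apply continuous_const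

end bump

/-- At each scale `2 ^ j` the normalized integrals are bounded, uniformly over bump families, by
numbers that are summable in `j` with a bound independent of the parameters of the phase. -/
theorem exists_summable_scale_bound {P : ℝ × ℝ → ℝ} (hP : AnalyticAt ℝ P 0) (m : ℕ) :
    ∃ J : ℕ, ∃ C : ℝ, 0 ≤ C ∧ ∀ lam y u : ℝ, ∃ b : ℤ → ℝ, (∀ j, 0 ≤ b j) ∧
      (∀ S : Finset ℤ, ∑ j ∈ S, b j ≤ C) ∧
      ∀ φ : ℤ × ℤ → ℝ × ℝ → ℝ, IsBumpFamily 1 φ → ∀ I : ℤ × ℤ, I.1 ≤ -(J : ℤ) → I.2 ≤ -(J : ℤ) →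
        ∀ v : ℝ, (2 : ℝ) ^ (-I.2) * |u| ≤ 2 →
        ‖∫ x : ℝ, Complex.exp (Complex.I * phaseDeriv P m lam y u (2 ^ I.1) 0 x) *
          (φ I (x, v) : ℂ)‖ ≤ b I.1 := by
  obtain ⟨n, D, C, r, hn, hnm, hnD, hmD, hC, hr, hdom⟩ := exists_deriv_domination hP m
  obtain ⟨C', κ, ε, hC', hκ, hε, hosc⟩ := exists_oscillatory_bound D
  obtain ⟨J, hJ⟩ := exists_pow_lt_of_lt_one (show 0 < min (min (r / 2) 1) (ε / (C + 1)) by positivity)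
    (one_half_lt_one (α := ℝ))
  rw [lt_min_iff, lt_min_iff, lt_div_iff₀ two_pos, lt_div_iff₀ (by positivity)] at hJ
  obtain ⟨⟨hJr, hJ1⟩, hJε⟩ := hJ
  have hscale : ∀ i : ℤ, i ≤ -(J : ℤ) → (2 : ℝ) ^ i ≤ (1 / 2) ^ J := fun i hi => by
    rw [one_div, inv_pow, ← zpow_natCast, ← zpow_neg]
    exact zpow_le_zpow_right₀ one_le_two hi
  have hr1 : (2 : ℝ) ^ (-κ) < 1 := rpow_lt_one_of_one_lt_of_neg (by norm_num) (by linarith)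
  refine ⟨J, C' * (2 + (1 - (2 : ℝ) ^ (-κ))⁻¹),
    mul_nonneg hC'.le (add_nonneg zero_le_two (inv_nonneg.2 (by linarith))), fun lam y u => ?_⟩
  set M : ℤ → ℝ := fun j => ∑ l ∈ Finset.Icc 1 (D + 1), |phaseDeriv P m lam y u (2 ^ j) l 0|
    with hMdef
  have hM0 : ∀ j, 0 ≤ M j := fun j => Finset.sum_nonneg fun _ _ => abs_nonneg _
  set b : ℤ → ℝ := fun j => if 1 ≤ M j then min (M j) (M j ^ (-κ)) else M j with hb
  have hb0 : ∀ j, 0 ≤ b j := fun j => by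
    simp only [hb]
    split_ifs
    · exact le_min (hM0 j) (rpow_nonneg (hM0 j) _)
    · exact hM0 j
  refine ⟨fun j => C' * b j, fun j => mul_nonneg hC'.le (hb0 j), fun S => ?_, ?_⟩
  · rw [← Finset.mul_sum]
    refine mul_le_mul_of_nonneg_left (sum_le_of_two_mul_le hκ (M := M) (fun j => ?_) (fun j => ?_)
      (fun j hj => ?_) S) hC'.le
    · simp only [hMdef]
      rw [Finset.mul_sum]
      refine Finset.sum_le_sum fun l hl => ?_
      rw [zpow_add_one₀ two_ne_zero, mul_comm ((2 : ℝ) ^ j) 2, phaseDeriv_two_mul_zero, abs_mul,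
        abs_of_pos (by positivity : (0 : ℝ) < 2 ^ l)]
      exact mul_le_mul_of_nonneg_right
        (le_self_pow₀ one_le_two (Nat.one_le_iff_ne_zero.1 (Finset.mem_Icc.1 hl).1)) (abs_nonneg _)
    · simp only [hb]
      split_ifs
      · exact min_le_left _ _
      · exact le_rfl
    · simp only [hb, if_pos hj]
      exact min_le_right _ _
  · intro φ hφ I hI1 hI2 v hu
    set a : ℝ := 2 ^ I.1 with ha
    have ha0 : 0 < a := by positivity
    have haJ : a ≤ (1 / 2) ^ J := hscale _ hI1
    have hur : |u| < r := by
      have h1 := hscale _ hI2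
      rw [zpow_neg, inv_mul_le_iff₀ (by positivity)] at hu
      linarith
    have hball : ∀ x ∈ Set.Icc (-2 : ℝ) 2, (u, a * x) ∈ Metric.ball (0 : ℝ × ℝ) r := by
      intro x hx
      rw [mem_ball_zero_iff, Prod.norm_def, max_lt_iff]
      refine ⟨hur, ?_⟩
      rw [Real.norm_eq_abs, abs_mul, abs_of_pos ha0]
      have := abs_le.2 hx
      nlinarith
    have hderiv : ∀ l, ∀ x ∈ Set.Icc (-2 : ℝ) 2, HasDerivAt (phaseDeriv P m lam y u a l)
        (phaseDeriv P m lam y u a (l + 1) x) x := fun l x hx =>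
      hasDerivAt_phaseDeriv m lam y l (hdom _ (hball x hx)).1
    have hest := hosc (phaseDeriv P m lam y u a) (M I.1) (fun x => φ I (x, v))
      (fun x => fderiv ℝ (φ I) (x, v) (1, 0)) (fun l _ => hderiv l)
      (fun x hx => (hderiv _ x hx).continuousAt.continuousWithinAt) rfl
      (fun x hx => ?_) (fun x => hφ.hasDerivAt I x v) (hφ.continuous_fderiv I v)
      (fun x => hφ.abs_le I _) (fun x => hφ.abs_fderiv_le I _) (fun x hx => hφ.fst_eq_zero I hx)
      ((hφ I).2.2.1 v)
    · simp only [hb]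
      split_ifs with h
      · rw [mul_min_of_nonneg _ _ hC'.le]
        exact le_min hest.1 (hest.2 h)
      · exact hest.1
    · have hterm : |phaseDeriv P m lam y u a n 0| ≤ M I.1 :=
        Finset.single_le_sum (f := fun l => |phaseDeriv P m lam y u a l 0|)
          (fun _ _ => abs_nonneg _) (Finset.mem_Icc.2 ⟨hn, hnD⟩)
      refine (abs_phaseDeriv_le (n := n) (C := C) (by omega) (by omega) hnm ha0.le
        (haJ.trans hJ1.le) (hdom _ (hball x hx)).2).trans ?_
      refine mul_le_mul ?_ hterm (abs_nonneg _) hε.le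
      nlinarith [pow_pos (one_half_pos (α := ℝ)) J]

/-- generalized Stein–Wainger bound, real-analytic case.  For `p₀ ≥ 1`
and `P(u,s)` real-analytic near `(0,0)` with `P(0,0) = 0` and `∂_s^{p₀} P(0,0) = 0`, there
exist `N, J, K₀` and `C` such that for every bump family of order `N`, every finite
`ℱ' ⊆ {j ≤ -J, k ≤ -K₀}` and all `λ, y, t` with `y ≠ t`,
`Σ_{I∈ℱ'} |m_I(λ,y,t)| ≤ C / |y - t|`. -/
theorem generalized_stein_wainger_analytic
    (p₀ : ℕ) (hp₀ : 1 ≤ p₀) (P : ℝ × ℝ → ℝ)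
    (hP : AnalyticAt ℝ P (0, 0)) (hP0 : P (0, 0) = 0)
    (hvan : iteratedDeriv p₀ (fun s => P (0, s)) 0 = 0) :
    ∃ N J K₀ : ℕ, ∃ C : ℝ,
      ∀ φ : ℤ × ℤ → ℝ × ℝ → ℝ, IsBumpFamily N φ →
      ∀ F' : Finset (ℤ × ℤ), (∀ I ∈ F', I.1 ≤ -(J : ℤ) ∧ I.2 ≤ -(K₀ : ℤ)) →
      ∀ lam y t : ℝ, y ≠ t →
        ∑ I ∈ F', ‖∫ s : ℝ,
            Complex.exp (2 * (π : ℂ) * Complex.I *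
              ((lam * (2 * y * s ^ p₀ + P (y - t, s)) : ℝ) : ℂ)) *
            (scaledBump φ I (s, y - t) : ℂ)‖ ≤ C / |y - t| := by
  obtain ⟨J, C, hC, h⟩ := exists_summable_scale_bound hP p₀
  refine ⟨1, J, J, 6 * C, fun φ hφ F' hF' lam y t hyt => ?_⟩
  obtain ⟨b, hb0, hbsum, hb⟩ := h lam y (y - t)
  have hd : 0 < |y - t| := abs_pos.2 (sub_ne_zero.2 hyt)
  set w : ℤ → ℝ := fun k => if 1 / 2 ≤ (2 : ℝ) ^ (-k) * |y - t| ∧ (2 : ℝ) ^ (-k) * |y - t| ≤ 2 then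
    (2 : ℝ) ^ (-k) else 0 with hw
  have hw0 : ∀ k, 0 ≤ w k := fun k => by
    simp only [hw]
    split_ifs <;> positivity
  have hpiece : ∀ I ∈ F', ‖∫ s : ℝ, Complex.exp (2 * (π : ℂ) * Complex.I *
      ((lam * (2 * y * s ^ p₀ + P (y - t, s)) : ℝ) : ℂ)) * (scaledBump φ I (s, y - t) : ℂ)‖ ≤
      b I.1 * w I.2 := by
    intro I hI
    rw [integral_mul_scaledBump φ I (y - t) fun s => Complex.exp (2 * (π : ℂ) * Complex.I *
      ((lam * (2 * y * s ^ p₀ + P (y - t, s)) : ℝ) : ℂ))]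
    have habs : |(2 : ℝ) ^ (-I.2) * (y - t)| = 2 ^ (-I.2) * |y - t| := by
      rw [abs_mul, abs_of_pos (by positivity)]
    by_cases hk : 1 / 2 ≤ (2 : ℝ) ^ (-I.2) * |y - t| ∧ (2 : ℝ) ^ (-I.2) * |y - t| ≤ 2
    · have hest := hb φ hφ I (hF' I hI).1 (hF' I hI).2 (2 ^ (-I.2) * (y - t)) hk.2
      simp only [hw, if_pos hk]
      rw [norm_mul, Complex.norm_real, Real.norm_of_nonneg (by positivity), mul_comm]
      refine mul_le_mul_of_nonneg_right (le_of_eq_of_le ?_ hest) (by positivity)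
      congr 2
      funext x
      rw [phaseDeriv_zero]
      congr 2
      push_cast
      ring
    · have hzero : ∀ x, φ I (x, 2 ^ (-I.2) * (y - t)) = 0 := fun x => by
        by_contra hne
        have := ((hφ I).2.1 _ hne).2.2
        rw [habs] at this
        exact hk this
      simp only [hzero, Complex.ofReal_zero, mul_zero, integral_zero, norm_zero]
      exact mul_nonneg (hb0 _) (hw0 _)
  calc _ ≤ ∑ I ∈ F', b I.1 * w I.2 := Finset.sum_le_sum hpiece
    _ ≤ ∑ I ∈ F'.image Prod.fst ×ˢ F'.image Prod.snd, b I.1 * w I.2 :=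
        Finset.sum_le_sum_of_subset_of_nonneg Finset.subset_product
          fun I _ _ => mul_nonneg (hb0 _) (hw0 _)
    _ = (∑ j ∈ F'.image Prod.fst, b j) * ∑ k ∈ F'.image Prod.snd, w k := by
        rw [Finset.sum_mul_sum, Finset.sum_product]
    _ ≤ C * (6 / |y - t|) := mul_le_mul (hbsum _) (sum_dyadic_indicator_le hd _)
        (Finset.sum_nonneg fun k _ => hw0 k) hC
    _ = _ := by ring
end
end

section
/- For every d ∈ ℕ there is a constant C_d such that for every real polynomial Q(s) = Σ_{p=1}^d h_p s^p, every C^∞ function Φ : ℝ → ℝ supported in {1/2 ≤ |s| ≤ 2} with |Φ(s)| ≤ 1 and |Φ′(s)| ≤ 1 for all s, every j ∈ ℤ, and every 1 ≤ p ≤ d with h_p ≠ 0, one has | ∫_ℝ e^{2πi Q(s)} 2^{−j} Φ(2^{−j} s) ds | ≤ C_d ( |h_p| 2^{p j} )^{−1/d}. -/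
open MeasureTheory Real

noncomputable section

open Polynomial in
/-- A substitution bound for polynomials `R` on an interval: on each of the
intervals cut out by the critical points of `R` the integral is at most the oscillation of a
primitive `A` of `w`. -/
theorem integral_comp_polynomial_mul_abs_deriv_le_card (R : ℝ[X]) {A w : ℝ → ℝ} {W : ℝ}
    (hw : Continuous w) (hA : ∀ y, HasDerivAt A (w y) y) (hW : ∀ u v, A u - A v ≤ W)
    (hR : R.derivative ≠ 0) (n : ℕ) :
    ∀ a b : ℝ, a ≤ b → {x ∈ R.derivative.roots.toFinset | x ∈ Set.Ioo a b}.card = n →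
      ∫ s in a..b, w (R.eval s) * |R.derivative.eval s| ≤ (n + 1) * W := by
  have hW0 : 0 ≤ W := by simpa using hW 0 0
  have hcont : Continuous fun s => w (R.eval s) * |R.derivative.eval s| := by fun_prop
  have hder (s : ℝ) : HasDerivAt (fun s => A (R.eval s))
      (w (R.eval s) * R.derivative.eval s) s := (hA _).comp s (R.hasDerivAt s)
  have hcont' : Continuous fun s => w (R.eval s) * R.derivative.eval s := by fun_prop
  induction n using Nat.strong_induction_on with
  | _ n ih =>
    intro a b hab hcard
    by_cases hne : ∀ x ∈ Set.Ioo a b, R.derivative.eval x ≠ 0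
    · have hFTC : ∫ s in a..b, w (R.eval s) * R.derivative.eval s =
          A (R.eval b) - A (R.eval a) :=
        intervalIntegral.integral_eq_sub_of_hasDerivAt (fun s _ => hder s)
          (hcont'.intervalIntegrable _ _)
      have hsign : (∀ x ∈ Set.Ioo a b, 0 ≤ R.derivative.eval x) ∨
          (∀ x ∈ Set.Ioo a b, R.derivative.eval x ≤ 0) := by
        by_contra! hcon
        obtain ⟨⟨x, hx, hx'⟩, y, hy, hy'⟩ := hcon
        obtain ⟨z, hz, hz0⟩ := isPreconnected_Ioo.intermediate_value hx hy
          (f := fun s => R.derivative.eval s) (by fun_prop) ⟨hx'.le, hy'.le⟩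
        exact hne z hz hz0
      suffices h : ∫ s in a..b, w (R.eval s) * |R.derivative.eval s| ≤ W from
        h.trans (le_mul_of_one_le_left hW0 (by simp))
      rcases hab.eq_or_lt with rfl | hlt
      · simpa using hW0
      have hcl : closure (Set.Ioo a b) = Set.Icc a b := closure_Ioo hlt.ne
      have hc : Continuous fun s => R.derivative.eval s := by fun_prop
      rcases hsign with hs | hs
      · have hs' : ∀ x ∈ Set.Icc a b, 0 ≤ R.derivative.eval x := by
          rw [← hcl]
          exact fun x hx => closure_minimal (t := {x | 0 ≤ R.derivative.eval x}) hs
            (isClosed_le continuous_const hc) hx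
        rw [intervalIntegral.integral_congr (g := fun s => w (R.eval s) * R.derivative.eval s)]
        · rw [hFTC]
          exact hW _ _
        · intro x hx
          rw [Set.uIcc_of_le hab] at hx
          simp only [abs_of_nonneg (hs' x hx)]
      · have hs' : ∀ x ∈ Set.Icc a b, R.derivative.eval x ≤ 0 := by
          rw [← hcl]
          exact fun x hx => closure_minimal (t := {x | R.derivative.eval x ≤ 0}) hs
            (isClosed_le hc continuous_const) hx
        rw [intervalIntegral.integral_congr
          (g := fun s => -(w (R.eval s) * R.derivative.eval s))]
        · rw [intervalIntegral.integral_neg, hFTC, neg_sub]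
          exact hW _ _
        · intro x hx
          rw [Set.uIcc_of_le hab] at hx
          simp only [abs_of_nonpos (hs' x hx), mul_neg]
    · push Not at hne
      obtain ⟨c, hc, hc0⟩ := hne
      set Z := R.derivative.roots.toFinset with hZ
      have hcZ : c ∈ Z := by simp [hZ, hR, hc0]
      have hsum : {x ∈ Z | x ∈ Set.Ioo a c}.card + {x ∈ Z | x ∈ Set.Ioo c b}.card + 1 ≤ n := by
        rw [← Finset.card_union_of_disjoint, ← Finset.card_insert_of_notMem (a := c), ← hcard]
        · apply Finset.card_le_card
          intro x hx
          simp only [Finset.mem_insert, Finset.mem_union, Finset.mem_filter, Set.mem_Ioo] at hx ⊢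
          rcases hx with rfl | ⟨h1, h2, h3⟩ | ⟨h1, h2, h3⟩
          · exact ⟨hcZ, hc⟩
          · exact ⟨h1, h2, h3.trans hc.2⟩
          · exact ⟨h1, hc.1.trans h2, h3⟩
        · simp
        · rw [Finset.disjoint_left]
          intro x hx hx'
          simp only [Finset.mem_filter, Set.mem_Ioo] at hx hx'
          exact lt_asymm hx.2.2 hx'.2.1
      have h1 := ih _ (by omega) a c hc.1.le rfl
      have h2 := ih _ (by omega) c b hc.2.le rfl
      have hsum' : (({x ∈ Z | x ∈ Set.Ioo a c}.card : ℝ) + {x ∈ Z | x ∈ Set.Ioo c b}.card + 1)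
          ≤ n := by exact_mod_cast hsum
      rw [← intervalIntegral.integral_add_adjacent_intervals
        (hcont.intervalIntegrable a c) (hcont.intervalIntegrable c b)]
      nlinarith

open Polynomial in
theorem integral_comp_polynomial_mul_abs_deriv_le (R : ℝ[X]) {A w : ℝ → ℝ} {W : ℝ}
    (hw : Continuous w) (hA : ∀ y, HasDerivAt A (w y) y) (hW : ∀ u v, A u - A v ≤ W)
    {a b : ℝ} (hab : a ≤ b) :
    ∫ s in a..b, w (R.eval s) * |R.derivative.eval s| ≤ (R.natDegree + 1) * W := by
  have hW0 : 0 ≤ W := by simpa using hW 0 0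
  by_cases hR : R.derivative = 0
  · simp only [hR, eval_zero, abs_zero, mul_zero, intervalIntegral.integral_zero]
    positivity
  · refine (integral_comp_polynomial_mul_abs_deriv_le_card R hw hA hW hR _ a b hab rfl).trans ?_
    have h : {x ∈ R.derivative.roots.toFinset | x ∈ Set.Ioo a b}.card ≤ R.natDegree :=
      (Finset.card_filter_le _ _).trans <| (Multiset.toFinset_card_le _).trans <|
        (card_roots' _).trans <| (natDegree_derivative_le _).trans (Nat.sub_le _ _)
    gcongr

/-- A `C¹` modification of `z ↦ z⁻¹` on `z ≥ D`, affine for `z ≤ D`. -/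
def truncInv (D z : ℝ) : ℝ := if z ≤ D then (2 * D - z) / D ^ 2 else z⁻¹

theorem truncInv_of_le {D z : ℝ} (h : z ≤ D) : truncInv D z = (2 * D - z) / D ^ 2 := if_pos h

theorem truncInv_of_ge {D z : ℝ} (hD : 0 < D) (h : D ≤ z) : truncInv D z = z⁻¹ := by
  rcases h.eq_or_lt with rfl | h
  · rw [truncInv_of_le le_rfl]
    field_simp
    norm_num
  · exact if_neg h.not_ge

theorem hasDerivAt_truncInv {D : ℝ} (hD : 0 < D) (z : ℝ) :
    HasDerivAt (truncInv D) (-(max z D ^ 2)⁻¹) z := by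
  have hl : z ≤ D → HasDerivWithinAt (truncInv D) (-(max z D ^ 2)⁻¹) (Set.Iic D) z := by
    intro hz
    have : HasDerivAt (fun z => (2 * D - z) / D ^ 2) (-(max z D ^ 2)⁻¹) z := by
      rw [max_eq_right hz]
      exact (((hasDerivAt_id z).const_sub (2 * D)).div_const (D ^ 2)).congr_deriv (by ring)
    exact this.hasDerivWithinAt.congr (fun x hx => truncInv_of_le hx) (truncInv_of_le hz)
  have hr : D ≤ z → HasDerivWithinAt (truncInv D) (-(max z D ^ 2)⁻¹) (Set.Ici D) z := by
    intro hz
    have : HasDerivAt (fun z : ℝ => z⁻¹) (-(max z D ^ 2)⁻¹) z := by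
      rw [max_eq_left hz]
      exact hasDerivAt_inv (hD.trans_le hz).ne'
    exact this.hasDerivWithinAt.congr (fun x hx => truncInv_of_ge hD hx) (truncInv_of_ge hD hz)
  rcases lt_trichotomy z D with h | h | h
  · exact (hl h.le).hasDerivAt (Iic_mem_nhds h)
  · have := (hl h.le).union (hr h.ge)
    rwa [Set.Iic_union_Ici, hasDerivWithinAt_univ] at this
  · exact (hr h.le).hasDerivAt (Ici_mem_nhds h)

/-- A `C¹` function equal to `y⁻¹` for `δ ≤ |y|`. -/
def smoothInv (δ y : ℝ) : ℝ := y * truncInv (δ ^ 2) (y ^ 2)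

/-- The derivative of `smoothInv`. -/
def smoothInvDeriv (δ y : ℝ) : ℝ :=
  truncInv (δ ^ 2) (y ^ 2) - 2 * y ^ 2 * (max (y ^ 2) (δ ^ 2) ^ 2)⁻¹

theorem hasDerivAt_smoothInv {δ : ℝ} (hδ : 0 < δ) (y : ℝ) :
    HasDerivAt (smoothInv δ) (smoothInvDeriv δ y) y := by
  have h := (hasDerivAt_id y).mul
    ((hasDerivAt_truncInv (pow_pos hδ 2) (y ^ 2)).comp y (hasDerivAt_pow 2 y))
  refine h.congr_deriv ?_
  simp only [smoothInvDeriv, id, Function.comp]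
  push_cast
  ring

theorem continuous_smoothInvDeriv {δ : ℝ} (hδ : 0 < δ) : Continuous (smoothInvDeriv δ) := by
  have h1 : Continuous (truncInv (δ ^ 2)) :=
    continuous_iff_continuousAt.2 fun z => (hasDerivAt_truncInv (pow_pos hδ 2) z).continuousAt
  have h2 : Continuous fun y : ℝ => (max (y ^ 2) (δ ^ 2) ^ 2)⁻¹ := by
    refine Continuous.inv₀ (by fun_prop) fun y => ?_
    have : 0 < max (y ^ 2) (δ ^ 2) := lt_max_of_lt_right (by positivity)
    positivity
  unfold smoothInvDeriv
  fun_prop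

theorem abs_smoothInvDeriv_le {δ : ℝ} (hδ : 0 < δ) (y : ℝ) :
    |smoothInvDeriv δ y| ≤ 4 / (δ ^ 2 + y ^ 2) := by
  have hy := sq_nonneg y
  rcases le_total (y ^ 2) (δ ^ 2) with h | h
  · rw [smoothInvDeriv, truncInv_of_le h, max_eq_right h]
    have : (2 * δ ^ 2 - y ^ 2) / (δ ^ 2) ^ 2 - 2 * y ^ 2 * ((δ ^ 2) ^ 2)⁻¹ =
        (2 * δ ^ 2 - 3 * y ^ 2) / (δ ^ 2) ^ 2 := by ring
    rw [this, abs_div, abs_of_pos (a := (δ ^ 2) ^ 2) (by positivity),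
      div_le_div_iff₀ (by positivity) (by positivity)]
    have : |2 * δ ^ 2 - 3 * y ^ 2| ≤ 2 * δ ^ 2 := abs_le.2 ⟨by linarith, by linarith⟩
    calc _ ≤ 2 * δ ^ 2 * (δ ^ 2 + y ^ 2) := by gcongr
      _ ≤ _ := by nlinarith [pow_pos hδ 2]
  · have hy' : 0 < y ^ 2 := (pow_pos hδ 2).trans_le h
    rw [smoothInvDeriv, truncInv_of_ge (pow_pos hδ 2) h, max_eq_left h]
    have : (y ^ 2)⁻¹ - 2 * y ^ 2 * ((y ^ 2) ^ 2)⁻¹ = -(1 / y ^ 2) := by field_simp; ring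
    rw [this, abs_neg, abs_of_pos (by positivity), div_le_div_iff₀ hy' (by positivity)]
    linarith

theorem abs_smoothInv_le {δ : ℝ} (hδ : 0 < δ) (y : ℝ) : |smoothInv δ y| ≤ 2 / δ := by
  rcases le_total |y| δ with h | h
  · have h2 : y ^ 2 ≤ δ ^ 2 := sq_le_sq.2 (by rwa [abs_of_pos hδ])
    have h3 : 0 ≤ (2 * δ ^ 2 - y ^ 2) / (δ ^ 2) ^ 2 :=
      div_nonneg (by linarith [pow_pos hδ 2]) (sq_nonneg _)
    rw [smoothInv, truncInv_of_le h2, abs_mul, abs_of_nonneg h3]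
    calc |y| * ((2 * δ ^ 2 - y ^ 2) / (δ ^ 2) ^ 2) ≤ δ * ((2 * δ ^ 2) / (δ ^ 2) ^ 2) := by
          gcongr
          linarith [sq_nonneg y]
      _ = 2 / δ := by field_simp
  · have h2 : δ ^ 2 ≤ y ^ 2 := sq_le_sq.2 (by rwa [abs_of_pos hδ])
    rw [smoothInv, truncInv_of_ge (pow_pos hδ 2) h2, abs_mul, abs_inv, abs_pow]
    have : 0 < |y| := hδ.trans_le h
    calc |y| * (|y| ^ 2)⁻¹ = 1 / |y| := by field_simp
      _ ≤ 2 / δ := by gcongr; norm_num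

theorem mul_smoothInv_of_le {δ y : ℝ} (hδ : 0 < δ) (h : δ ≤ |y|) : y * smoothInv δ y = 1 := by
  have h2 : δ ^ 2 ≤ y ^ 2 := sq_le_sq.2 (by rwa [abs_of_pos hδ])
  have : y ^ 2 ≠ 0 := ((pow_pos hδ 2).trans_le h2).ne'
  rw [smoothInv, truncInv_of_ge (pow_pos hδ 2) h2, ← mul_assoc, ← sq, mul_inv_cancel₀ this]

theorem abs_one_sub_mul_smoothInv_le {δ y : ℝ} (hδ : 0 < δ) (h : |y| < δ) :
    |1 - y * smoothInv δ y| ≤ 1 := by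
  have h2 : y ^ 2 ≤ δ ^ 2 := sq_le_sq.2 (by rw [abs_of_pos hδ]; exact h.le)
  rw [smoothInv, truncInv_of_le h2]
  have : 1 - y * (y * ((2 * δ ^ 2 - y ^ 2) / (δ ^ 2) ^ 2)) = (1 - y ^ 2 / δ ^ 2) ^ 2 := by
    field_simp
    ring
  have h3 : y ^ 2 / δ ^ 2 ≤ 1 := (div_le_one (by positivity)).2 h2
  have h4 : 0 ≤ y ^ 2 / δ ^ 2 := by positivity
  rw [this, abs_of_nonneg (by positivity)]
  exact pow_le_one₀ (by linarith) (by linarith)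

open Polynomial in
/-- Integration by parts away from the set where the derivative of the phase is smaller than `δ`. -/
theorem norm_integral_exp_mul_le_s12 (P : ℝ[X]) {φ : ℝ → ℝ} {M δ : ℝ} (hM : 0 ≤ M) (hδ : 0 < δ)
    (hφ : ContDiff ℝ 1 φ) (hφM : φ M = 0) (hφM' : φ (-M) = 0) (hφ1 : ∀ s, |φ s| ≤ 1)
    (hφ2 : ∀ s, |deriv φ s| ≤ 1) :
    ‖∫ s in -M..M, Complex.exp (Complex.I * (P.eval s : ℝ)) * (φ s : ℝ)‖ ≤
      (4 * π * (P.derivative.natDegree + 1) + 4 * M) / δ +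
        volume.real {s | s ∈ Set.Ioc (-M) M ∧ |P.derivative.eval s| < δ} := by
  set R := P.derivative with hR
  set e : ℝ → ℂ := fun s => Complex.exp (Complex.I * (P.eval s : ℝ)) with he
  set E := {s | s ∈ Set.Ioc (-M) M ∧ |R.eval s| < δ} with hE
  have hφc : Continuous φ := hφ.continuous
  have hφ'c : Continuous (deriv φ) := hφ.continuous_deriv le_rfl
  have hgc : Continuous (smoothInv δ) :=
    continuous_iff_continuousAt.2 fun z => (hasDerivAt_smoothInv hδ z).continuousAt
  have hg'c := continuous_smoothInvDeriv hδ
  have hec : Continuous e := by fun_prop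
  have hnorm (s : ℝ) : ‖e s‖ = 1 := by
    simp only [he]
    rw [mul_comm]
    exact Complex.norm_exp_ofReal_mul_I _
  set G : ℝ → ℝ := fun s => smoothInv δ (R.eval s) * φ s with hG
  set G' : ℝ → ℝ := fun s => smoothInvDeriv δ (R.eval s) * R.derivative.eval s * φ s +
    smoothInv δ (R.eval s) * deriv φ s with hG'
  have hGd (s : ℝ) : HasDerivAt G (G' s) s :=
    ((hasDerivAt_smoothInv hδ _).comp s (R.hasDerivAt s)).mul
      ((hφ.differentiable one_ne_zero) s).hasDerivAt
  have hed (s : ℝ) : HasDerivAt e (e s * (Complex.I * (R.eval s : ℝ))) s :=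
    ((P.hasDerivAt s).ofReal_comp.const_mul Complex.I).cexp
  have hFd (s : ℝ) := (hed s).mul (hGd s).ofReal_comp
  have hGc : Continuous G := by fun_prop
  have hG'c : Continuous G' := by fun_prop
  have hF'c : Continuous fun s =>
      e s * (Complex.I * (R.eval s : ℝ)) * (G s : ℂ) + e s * (G' s : ℂ) := by fun_prop
  have hFint : ∫ s in -M..M,
      (e s * (Complex.I * (R.eval s : ℝ)) * (G s : ℂ) + e s * (G' s : ℂ)) = 0 := by
    rw [intervalIntegral.integral_eq_sub_of_hasDerivAt (fun s _ => hFd s)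
      (hF'c.intervalIntegrable _ _)]
    simp [hG, hφM, hφM']
  set H : ℝ → ℂ := fun s => e s * ((1 - R.eval s * smoothInv δ (R.eval s)) * φ s : ℝ) +
    Complex.I * (e s * (G' s : ℂ)) with hH
  have hHc : Continuous H := by fun_prop
  have hsplit : ∫ s in -M..M, e s * (φ s : ℝ) = ∫ s in -M..M, H s := by
    have : ∫ s in -M..M, e s * (φ s : ℝ) = ∫ s in -M..M, (H s - Complex.I *
        (e s * (Complex.I * (R.eval s : ℝ)) * (G s : ℂ) + e s * (G' s : ℂ))) := by
      congr 1
      funext s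
      simp only [hH, hG]
      push_cast
      linear_combination (e s * (R.eval s : ℝ) * (smoothInv δ (R.eval s) : ℝ) * (φ s : ℝ)) *
        Complex.I_sq
    rw [this, intervalIntegral.integral_sub (hHc.intervalIntegrable _ _)
      ((hF'c.const_mul Complex.I).intervalIntegrable _ _),
      intervalIntegral.integral_const_mul, hFint, mul_zero, sub_zero]
  have hEm : MeasurableSet {s : ℝ | |R.eval s| < δ} :=
    (isOpen_lt (by fun_prop) continuous_const).measurableSet
  set w : ℝ → ℝ := fun y => 4 / (δ ^ 2 + y ^ 2) with hw
  have hwc : Continuous w := by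
    refine Continuous.div continuous_const (by fun_prop) fun y => ?_
    positivity
  have hbound (s : ℝ) : ‖H s‖ ≤ {s : ℝ | |R.eval s| < δ}.indicator (fun _ => (1 : ℝ)) s +
      (w (R.eval s) * |R.derivative.eval s| + 2 / δ) := by
    refine (norm_add_le _ _).trans (add_le_add ?_ ?_)
    · rw [norm_mul, hnorm, one_mul, Complex.norm_real, Real.norm_eq_abs, abs_mul]
      by_cases hs : |R.eval s| < δ
      · rw [Set.indicator_of_mem (by exact hs)]
        exact mul_le_one₀ (abs_one_sub_mul_smoothInv_le hδ hs) (abs_nonneg _) (hφ1 s)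
      · rw [Set.indicator_of_notMem (by exact hs), mul_smoothInv_of_le hδ (not_lt.1 hs)]
        simp
    · rw [norm_mul, norm_mul, hnorm, one_mul, Complex.norm_I, one_mul, Complex.norm_real,
        Real.norm_eq_abs]
      refine (abs_add_le _ _).trans ?_
      rw [abs_mul, abs_mul, abs_mul]
      refine add_le_add ?_ ?_
      · refine (mul_le_of_le_one_right (by positivity) (hφ1 s)).trans ?_
        gcongr
        exact abs_smoothInvDeriv_le hδ _
      · exact (mul_le_of_le_one_right (by positivity) (hφ2 s)).trans (abs_smoothInv_le hδ _)
  have hvar : ∫ s in -M..M, w (R.eval s) * |R.derivative.eval s| ≤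
      (R.natDegree + 1) * (4 * π / δ) := by
    refine integral_comp_polynomial_mul_abs_deriv_le R (A := fun y => 4 / δ * arctan (y / δ)) hwc
      (fun y => ?_) (fun u v => ?_) (by linarith)
    · refine (((hasDerivAt_id y).div_const δ).arctan.const_mul (4 / δ)).congr_deriv ?_
      simp only [hw, id]
      field_simp
    · have h1 := arctan_lt_pi_div_two (u / δ)
      have h2 := neg_pi_div_two_lt_arctan (v / δ)
      calc 4 / δ * arctan (u / δ) - 4 / δ * arctan (v / δ)
          = 4 / δ * (arctan (u / δ) - arctan (v / δ)) := by ring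
        _ ≤ 4 / δ * π := by gcongr; linarith
        _ = 4 * π / δ := by ring
  have hind : IntervalIntegrable ({s : ℝ | |R.eval s| < δ}.indicator fun _ => (1 : ℝ))
      volume (-M) M := by
    rw [intervalIntegrable_iff_integrableOn_Ioc_of_le (by linarith)]
    exact (integrable_const (1 : ℝ)).indicator hEm
  have hrest : Continuous fun s => w (R.eval s) * |R.derivative.eval s| := by fun_prop
  have hindint : ∫ s in -M..M, {s : ℝ | |R.eval s| < δ}.indicator (fun _ => (1 : ℝ)) s =
      volume.real E := by
    rw [intervalIntegral.integral_of_le (by linarith), integral_indicator hEm,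
      Measure.restrict_restrict hEm, setIntegral_const, smul_eq_mul, mul_one]
    congr 1
    ext s
    simp [hE, and_comm]
  rw [hsplit]
  refine (intervalIntegral.norm_integral_le_of_norm_le (by linarith)
    (Filter.Eventually.of_forall fun s _ => hbound s)
    (hind.add ((hrest.intervalIntegrable _ _).add intervalIntegrable_const))).trans ?_
  rw [intervalIntegral.integral_add hind
      ((hrest.intervalIntegrable _ _).add intervalIntegrable_const),
    intervalIntegral.integral_add (hrest.intervalIntegrable _ _) intervalIntegrable_const,
    hindint, intervalIntegral.integral_const, smul_eq_mul]
  have : (R.natDegree + 1) * (4 * π / δ) + (M - -M) * (2 / δ) =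
      (4 * π * (R.natDegree + 1) + 4 * M) / δ := by ring
  linarith

/-- A set of large measure contains many points that are far apart from each other. -/
theorem exists_separated_finset {E : Set ℝ} {r : ℝ} (n : ℕ) (hr : 0 ≤ r)
    (h : ENNReal.ofReal (n * (2 * r)) < volume E) :
    ∀ k ≤ n + 1, ∃ s : Finset ℝ, s.card = k ∧ (∀ x ∈ s, x ∈ E) ∧
      ∀ x ∈ s, ∀ y ∈ s, x ≠ y → r ≤ |x - y| := by
  intro k
  induction k with
  | zero => exact fun _ => ⟨∅, by simp⟩
  | succ k ih =>
    intro hk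
    obtain ⟨s, hcard, hsE, hs⟩ := ih (by omega)
    have hnot : ¬ E ⊆ ⋃ x ∈ s, Metric.ball x r := by
      intro hsub
      refine absurd h (not_lt.2 ?_)
      calc volume E ≤ volume (⋃ x ∈ s, Metric.ball x r) := measure_mono hsub
        _ ≤ ∑ x ∈ s, volume (Metric.ball x r) := measure_biUnion_finset_le _ _
        _ = ENNReal.ofReal (k * (2 * r)) := by
          simp only [Real.volume_ball, Finset.sum_const, hcard, nsmul_eq_mul]
          rw [ENNReal.ofReal_mul (p := (k : ℝ)) (by positivity), ENNReal.ofReal_natCast]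
        _ ≤ ENNReal.ofReal (n * (2 * r)) := by
          have : (k : ℝ) ≤ n := by exact_mod_cast (by omega : k ≤ n)
          gcongr
    rw [Set.not_subset] at hnot
    obtain ⟨z, hzE, hz⟩ := hnot
    simp only [Set.mem_iUnion, Metric.mem_ball, not_exists, not_lt, Real.dist_eq] at hz
    by_cases hzs : z ∈ s
    · have hr0 : r ≤ 0 := by simpa using hz z hzs
      have hpos : 0 < volume E := lt_of_le_of_lt zero_le h
      obtain ⟨z', hz'E, hz's⟩ : ∃ z' ∈ E, z' ∉ s := by
        by_contra! hcon
        exact hpos.ne' (measure_mono_null hcon (s.countable_toSet.measure_zero _))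
      exact ⟨insert z' s, by simp [hz's, hcard], by simpa using ⟨hz'E, hsE⟩,
        fun x _ y _ _ => hr0.trans (abs_nonneg _)⟩
    · refine ⟨insert z s, by simp [hzs, hcard], by simpa using ⟨hzE, hsE⟩, ?_⟩
      intro x hx y hy hxy
      rw [Finset.mem_insert] at hx hy
      rcases hx with rfl | hx <;> rcases hy with rfl | hy
      · exact absurd rfl hxy
      · exact hz y hy
      · rw [abs_sub_comm]; exact hz x hx
      · exact hs x hx y hy hxy

open Polynomial in
theorem abs_coeff_prod_basisDivisor_le {r M x : ℝ} (hr : 0 < r) (s : Finset ℝ)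
    (hs : ∀ y ∈ s, r ≤ |x - y|) (hM : ∀ y ∈ s, |y| ≤ M) (hM0 : 0 ≤ M) (q : ℕ) :
    |(∏ y ∈ s, Lagrange.basisDivisor x y).coeff q| ≤ ((1 + M) / r) ^ s.card := by
  induction s using Finset.induction_on generalizing q with
  | empty =>
    simp only [Finset.prod_empty, Finset.card_empty, pow_zero, coeff_one]
    split_ifs <;> simp
  | insert y s hy ih =>
    have ih' := ih (fun z hz => hs z (by simp [hz])) (fun z hz => hM z (by simp [hz]))
    rw [Finset.prod_insert hy, Finset.card_insert_of_notMem hy, Lagrange.basisDivisor, mul_assoc,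
      coeff_C_mul, abs_mul, pow_succ']
    set p := ∏ y ∈ s, Lagrange.basisDivisor x y
    set B := ((1 + M) / r) ^ s.card with hB
    have hB0 : 0 ≤ B := by positivity
    have h1 : |(x - y)⁻¹| ≤ 1 / r := by
      rw [abs_inv, ← one_div]
      exact one_div_le_one_div_of_le hr (hs y (by simp))
    have hyM := hM y (by simp)
    have h2 : |((X - C y) * p).coeff q| ≤ (1 + M) * B := by
      rcases q with _ | q
      · rw [mul_coeff_zero, coeff_sub, coeff_X_zero, coeff_C_zero, zero_sub, abs_mul, abs_neg]
        have := ih' 0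
        gcongr
        linarith
      · rw [coeff_X_sub_C_mul]
        calc |p.coeff q - y * p.coeff (q + 1)| ≤ |p.coeff q| + |y * p.coeff (q + 1)| := abs_sub _ _
          _ ≤ B + M * B := by
            rw [abs_mul]
            gcongr
            · exact ih' q
            · exact ih' (q + 1)
          _ = (1 + M) * B := by ring
    calc _ ≤ 1 / r * ((1 + M) * B) := by gcongr
      _ = _ := by ring

open Polynomial in
/-- Sublevel set estimate for polynomials, in terms of any one of the coefficients. -/
theorem abs_coeff_mul_volume_sublevel_pow_le (R : ℝ[X]) (n : ℕ) (hn : R.natDegree ≤ n) {M δ : ℝ}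
    (hM : 0 ≤ M) (q : ℕ) {E : Set ℝ} (hEM : ∀ x ∈ E, |x| ≤ M) (hE : ∀ x ∈ E, |R.eval x| ≤ δ)
    (hpos : 0 < volume.real E) :
    |R.coeff q| * volume.real E ^ n ≤ (n + 1) * (2 * (n + 1) * (1 + M)) ^ n * δ := by
  set m := volume.real E with hm
  set r := m / (2 * (n + 1)) with hr
  have hr0 : 0 < r := by positivity
  have hlt : ENNReal.ofReal (n * (2 * r)) < volume E := by
    have hfin : volume E ≠ ⊤ := by
      intro h
      simp [hm, Measure.real, h] at hpos
    rw [ENNReal.ofReal_lt_iff_lt_toReal (by positivity) hfin]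
    change _ < m
    rw [hr]
    field_simp
    nlinarith
  obtain ⟨s, hcard, hsE, hs⟩ := exists_separated_finset n hr0.le hlt (n + 1) le_rfl
  have hδ : 0 ≤ δ := by
    obtain ⟨x, hx⟩ : s.Nonempty := Finset.card_pos.1 (by omega)
    exact (abs_nonneg _).trans (hE x (hsE x hx))
  have hdeg : R.degree < s.card := by
    rw [hcard]
    exact degree_le_natDegree.trans_lt (by exact_mod_cast Nat.lt_succ_of_le hn)
  have hinterp := Lagrange.eq_interpolate (v := id) (Set.injOn_id _) hdeg
  have hb : |R.coeff q| ≤ (n + 1) * (δ * ((1 + M) / r) ^ n) := by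
    conv_lhs => rw [hinterp, Lagrange.interpolate_apply, finsetSum_coeff]
    refine (Finset.abs_sum_le_sum_abs _ _).trans ?_
    have : ∀ x ∈ s, |(C (R.eval (id x)) * Lagrange.basis s id x).coeff q| ≤
        δ * ((1 + M) / r) ^ n := by
      intro x hx
      rw [coeff_C_mul, abs_mul, Lagrange.basis]
      have hc : (s.erase x).card = n := by rw [Finset.card_erase_of_mem hx, hcard]; rfl
      have := abs_coeff_prod_basisDivisor_le (x := x) hr0 (s.erase x)
        (fun y hy => hs x hx y (Finset.mem_of_mem_erase hy) (Finset.ne_of_mem_erase hy).symm)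
        (fun y hy => hEM y (hsE y (Finset.mem_of_mem_erase hy))) hM q
      rw [hc] at this
      exact mul_le_mul (hE x (hsE x hx)) this (abs_nonneg _) hδ
    refine (Finset.sum_le_sum this).trans ?_
    simp [hcard]
  calc |R.coeff q| * m ^ n ≤ (n + 1) * (δ * ((1 + M) / r) ^ n) * m ^ n := by gcongr
    _ = (n + 1) * δ * ((1 + M) / r * m) ^ n := by rw [mul_pow]; ring
    _ = (n + 1) * δ * (2 * (n + 1) * (1 + M)) ^ n := by
      congr 2
      rw [hr]
      field_simp
    _ = _ := by ring

open Polynomial in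
/-- The bound at unit scale, in terms of a lower bound `δ ^ d` for one of the
coefficients of the derivative of the phase. -/
theorem norm_integral_exp_mul_le_of_le_coeff {d : ℕ} (hd : 0 < d) (P : ℝ[X])
    (hP : P.natDegree ≤ d) {φ : ℝ → ℝ} {M δ : ℝ} (hM : 0 ≤ M) (hδ : 0 < δ) {q : ℕ} (hq : q < d)
    (hcoeff : δ ^ d ≤ |P.derivative.coeff q|) (hφ : ContDiff ℝ 1 φ) (hφM : φ M = 0)
    (hφM' : φ (-M) = 0) (hφ1 : ∀ s, |φ s| ≤ 1) (hφ2 : ∀ s, |deriv φ s| ≤ 1) :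
    ‖∫ s in -M..M, Complex.exp (Complex.I * (P.eval s : ℝ)) * (φ s : ℝ)‖ ≤
      (4 * π * d + 4 * M + max 1 (d * (2 * d * (1 + M)) ^ (d - 1))) / δ := by
  refine (norm_integral_exp_mul_le_s12 P hM hδ hφ hφM hφM' hφ1 hφ2).trans ?_
  obtain ⟨n, rfl⟩ : ∃ n, d = n + 1 := ⟨d - 1, by omega⟩
  have hn : P.derivative.natDegree ≤ n := (natDegree_derivative_le P).trans (by omega)
  rw [add_div _ (max _ _)]
  refine add_le_add ?_ ?_
  · have : (P.derivative.natDegree : ℝ) ≤ n := by exact_mod_cast hn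
    push_cast
    gcongr
  set E := {s | s ∈ Set.Ioc (-M) M ∧ |P.derivative.eval s| < δ} with hE
  rw [le_div_iff₀ hδ]
  rcases (measureReal_nonneg (μ := volume) (s := E)).eq_or_lt with h0 | hpos
  · rw [← h0, zero_mul]
    positivity
  have hmain := abs_coeff_mul_volume_sublevel_pow_le P.derivative n hn hM q
    (E := E) (δ := δ) (fun x hx => abs_le.2 ⟨hx.1.1.le, hx.1.2⟩) (fun x hx => hx.2.le) hpos
  simp only [Nat.add_sub_cancel]
  push_cast
  set m := volume.real E
  set K : ℝ := (n + 1) * (2 * (n + 1) * (1 + M)) ^ n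
  have hK : (m * δ) ^ n ≤ K := by
    have h1 : δ ^ (n + 1) * m ^ n ≤ K * δ :=
      (mul_le_mul_of_nonneg_right hcoeff (by positivity)).trans hmain
    refine le_of_mul_le_mul_right ?_ hδ
    calc (m * δ) ^ n * δ = δ ^ (n + 1) * m ^ n := by ring
      _ ≤ K * δ := h1
  rcases Nat.eq_zero_or_pos n with rfl | hn0
  · exfalso
    obtain rfl : q = 0 := by omega
    obtain ⟨x, hx⟩ : E.Nonempty := by
      rw [Set.nonempty_iff_ne_empty]
      intro h
      simp [m, h] at hpos
    have hx2 := hx.2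
    rw [eq_C_of_natDegree_le_zero hn, eval_C] at hx2
    simp only [zero_add, pow_one] at hcoeff
    linarith
  · by_contra! hcon
    have h1 : 1 ≤ m * δ := (le_max_left _ _).trans hcon.le
    have h2 : m * δ ≤ (m * δ) ^ n := le_self_pow₀ h1 hn0.ne'
    exact absurd ((le_max_right 1 K).trans_lt hcon) (not_lt.2 (h2.trans hK))

/-- For every `d` there is `C_d` such that for every polynomial
`Q(s) = Σ_{p=1}^d h_p s^p`, every smooth `Φ` supported in `{1/2 ≤ |s| ≤ 2}` with
`|Φ|, |Φ'| ≤ 1`, every `j ∈ ℤ` and every `1 ≤ p ≤ d` with `h_p ≠ 0`,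
`|∫ e^{2πi Q(s)} 2^{-j} Φ(2^{-j}s) ds| ≤ C_d (|h_p| 2^{pj})^{-1/d}`. -/
theorem oscillatory_dyadic_scale_bound (d : ℕ) :
    ∃ C : ℝ, ∀ h : ℕ → ℝ, ∀ Φ : ℝ → ℝ,
      ContDiff ℝ (⊤ : ℕ∞) Φ →
      (∀ s : ℝ, Φ s ≠ 0 → 1 / 2 ≤ |s| ∧ |s| ≤ 2) →
      (∀ s : ℝ, |Φ s| ≤ 1 ∧ |deriv Φ s| ≤ 1) →
      ∀ j : ℤ, ∀ p : ℕ, 1 ≤ p → p ≤ d → h p ≠ 0 →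
        ‖∫ s : ℝ, Complex.exp (2 * (π : ℂ) * Complex.I *
              ((∑ i ∈ Finset.Icc 1 d, h i * s ^ i : ℝ) : ℂ)) *
            (((2 : ℝ) ^ (-j) * Φ ((2 : ℝ) ^ (-j) * s) : ℝ) : ℂ)‖
          ≤ C * (|h p| * (2 : ℝ) ^ ((p : ℤ) * j)) ^ (-(1 : ℝ) / d) := by
  refine ⟨4 * π * d + 4 * 3 + max (1 : ℝ) (d * (2 * d * (1 + 3)) ^ (d - 1)), ?_⟩
  intro h Φ hΦ hsupp hbd j p hp hpd hhp
  have hd : 0 < d := by omega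
  set a : ℝ := (2 : ℝ) ^ j with ha
  have ha0 : 0 < a := by positivity
  set Λ := |h p| * (2 : ℝ) ^ ((p : ℤ) * j) with hΛ
  have hΛ' : Λ = |h p| * a ^ p := by rw [hΛ, mul_comm (p : ℤ), zpow_mul, zpow_natCast]
  have hΛ0 : 0 < Λ := by positivity
  set δ := Λ ^ ((1 : ℝ) / d) with hδ
  have hδ0 : 0 < δ := by positivity
  have hδd : δ ^ d = Λ := by
    rw [hδ, one_div]
    exact Real.rpow_inv_natCast_pow hΛ0.le hd.ne'
  have hδinv : Λ ^ (-(1 : ℝ) / d) = δ⁻¹ := by rw [neg_div, Real.rpow_neg hΛ0.le]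
  set P : Polynomial ℝ := ∑ i ∈ Finset.Icc 1 d,
    Polynomial.C (2 * π * (h i * a ^ i)) * Polynomial.X ^ i with hP
  have hPeval (u : ℝ) : P.eval u = 2 * π * ∑ i ∈ Finset.Icc 1 d, h i * (a * u) ^ i := by
    rw [hP, Polynomial.eval_finsetSum, Finset.mul_sum]
    refine Finset.sum_congr rfl fun i _ => ?_
    simp only [Polynomial.eval_mul, Polynomial.eval_C, Polynomial.eval_pow, Polynomial.eval_X]
    ring
  have hPdeg : P.natDegree ≤ d := Polynomial.natDegree_sum_le_of_forall_le _ _ fun i hi =>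
    (Polynomial.natDegree_C_mul_X_pow_le _ _).trans (Finset.mem_Icc.1 hi).2
  have hPcoeff : P.coeff p = 2 * π * (h p * a ^ p) := by
    simp_rw [hP, Polynomial.finsetSum_coeff, Polynomial.coeff_C_mul_X_pow]
    rw [Finset.sum_ite_eq, if_pos (Finset.mem_Icc.2 ⟨hp, hpd⟩)]
  have hcoeff : δ ^ d ≤ |P.derivative.coeff (p - 1)| := by
    rw [hδd, hΛ', Polynomial.coeff_derivative, Nat.sub_add_cancel hp, hPcoeff, abs_mul, abs_mul,
      abs_mul (h p), abs_of_pos (a := 2 * π) (by positivity),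
      abs_of_pos (a := a ^ p) (by positivity)]
    have h1 : 1 ≤ |((p - 1 : ℕ) : ℝ) + 1| := by
      rw [abs_of_nonneg (by positivity)]
      simp
    have h2 : 1 ≤ 2 * π := by linarith [pi_gt_three]
    have h3 : 0 ≤ |h p| * a ^ p := by positivity
    calc |h p| * a ^ p = 1 * (|h p| * a ^ p) * 1 := by ring
      _ ≤ _ := by gcongr
  have hzero {s : ℝ} (hs : 2 < |s|) : Φ s = 0 := by
    by_contra hne
    exact absurd (hsupp s hne).2 (not_le.2 hs)
  have hunit := norm_integral_exp_mul_le_of_le_coeff hd P hPdeg (M := 3) (by norm_num) hδ0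
    (by omega) hcoeff (hΦ.of_le (by exact_mod_cast le_top)) (hzero (by norm_num))
    (hzero (by norm_num)) (fun s => (hbd s).1) (fun s => (hbd s).2)
  rw [hδinv, ← div_eq_mul_inv]
  refine le_trans (le_of_eq ?_) hunit
  rw [intervalIntegral.integral_eq_integral_of_support_subset]
  · have hscale := Measure.integral_comp_mul_left
      (fun u : ℝ => Complex.exp (Complex.I * (P.eval u : ℝ)) * (Φ u : ℝ)) a⁻¹
    rw [inv_inv, abs_of_pos ha0] at hscale
    have hint : ∀ s : ℝ, Complex.exp (2 * (π : ℂ) * Complex.I *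
              ((∑ i ∈ Finset.Icc 1 d, h i * s ^ i : ℝ) : ℂ)) *
            (((2 : ℝ) ^ (-j) * Φ ((2 : ℝ) ^ (-j) * s) : ℝ) : ℂ) =
        ((a⁻¹ : ℝ) : ℂ) *
          (Complex.exp (Complex.I * (P.eval (a⁻¹ * s) : ℝ)) * (Φ (a⁻¹ * s) : ℝ)) := by
      intro s
      rw [hPeval, mul_inv_cancel_left₀ ha0.ne', zpow_neg, ← ha, Complex.ofReal_mul a⁻¹,
        Complex.ofReal_mul (2 * π), Complex.ofReal_mul 2, Complex.ofReal_ofNat, mul_left_comm]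
      congr 3
      ring
    simp_rw [hint]
    rw [integral_const_mul, hscale, Complex.real_smul, ← mul_assoc, ← Complex.ofReal_mul,
      inv_mul_cancel₀ ha0.ne', Complex.ofReal_one, one_mul]
  · intro s hs
    have hs' : Φ s ≠ 0 := by
      intro h0
      simp [h0] at hs
    have := abs_le.1 (hsupp s hs').2
    exact ⟨by linarith, by linarith⟩
end
end

section
/- For every d ≥ 1 there is a constant c_d > 0 such that for every real polynomial Q(s) = Σ_{p=1}^d e_p s^p whose coefficients are not all zero, there exists an integer ℓ with 1 ≤ ℓ ≤ d such that the ℓ-th derivative satisfies |Q^{(ℓ)}(s)| ≥ c_d Σ_{p=1}^d |e_p| for every s with 1/2 ≤ |s| ≤ 2. -/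
open Real

noncomputable section

/-- The `ℓ`-th derivative of a polynomial function with no constant term, in coordinates. -/
theorem iteratedDeriv_sum_Icc_mul_pow (d ℓ : ℕ) (e : ℕ → ℝ) (s : ℝ) :
    iteratedDeriv ℓ (fun x : ℝ => ∑ p ∈ Finset.Icc 1 d, e p * x ^ p) s =
      ∑ p ∈ Finset.Icc 1 d, e p * (p.descFactorial ℓ * s ^ (p - ℓ)) := by
  rw [iteratedDeriv_fun_sum fun p _ => by fun_prop]
  refine Finset.sum_congr rfl fun p _ => ?_
  rw [iteratedDeriv_const_mul_field, iteratedDeriv_pow]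

/-- Each nonconstant term of the `ℓ`-th derivative is dominated by `d! * 2 ^ d` times a bound for
the coefficients of index greater than `ℓ`. -/
theorem abs_mul_descFactorial_mul_pow_le {d ℓ p : ℕ} (hpd : p ≤ d) (hpℓ : p ≠ ℓ) {e : ℕ → ℝ}
    {B : ℝ} (hB : 0 ≤ B) (h : ℓ < p → |e p| ≤ B) {s : ℝ} (hs : |s| ≤ 2) :
    |e p * (p.descFactorial ℓ * s ^ (p - ℓ))| ≤ B * (d.factorial * 2 ^ d) := by
  rcases lt_or_gt_of_ne hpℓ with hlt | hlt
  · rw [Nat.descFactorial_of_lt hlt]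
    simp only [Nat.cast_zero, zero_mul, mul_zero, abs_zero]
    positivity
  · have hfac : (p.descFactorial ℓ : ℝ) ≤ d.factorial := by
      have h₁ := Nat.factorial_mul_descFactorial hlt.le
      have h₂ : p.descFactorial ℓ ≤ p.factorial :=
        h₁ ▸ Nat.le_mul_of_pos_left _ (Nat.factorial_pos _)
      exact_mod_cast h₂.trans (Nat.factorial_le hpd)
    have hpow : |s| ^ (p - ℓ) ≤ 2 ^ d :=
      (pow_le_pow_left₀ (abs_nonneg s) hs _).trans
        (pow_le_pow_right₀ one_le_two ((Nat.sub_le p ℓ).trans hpd))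
    rw [abs_mul, abs_mul, abs_pow, Nat.abs_cast]
    gcongr
    exact h hlt

/-- For every `d ≥ 1` there is `c_d > 0` such that for every polynomial
`Q(s) = Σ_{p=1}^d e_p s^p` with not all coefficients zero, there is `1 ≤ ℓ ≤ d` with
`|Q^{(ℓ)}(s)| ≥ c_d Σ_{p=1}^d |e_p|` for every `s` with `1/2 ≤ |s| ≤ 2`. -/
theorem derivative_lower_bound_on_annulus (d : ℕ) (hd : 1 ≤ d) :
    ∃ c : ℝ, 0 < c ∧
      ∀ e : ℕ → ℝ, (∃ p, 1 ≤ p ∧ p ≤ d ∧ e p ≠ 0) →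
        ∃ ℓ : ℕ, 1 ≤ ℓ ∧ ℓ ≤ d ∧
          ∀ s : ℝ, 1 / 2 ≤ |s| → |s| ≤ 2 →
            c * (∑ p ∈ Finset.Icc 1 d, |e p|) ≤
              |iteratedDeriv ℓ (fun x : ℝ => ∑ p ∈ Finset.Icc 1 d, e p * x ^ p) s| := by
  set K : ℝ := d.factorial * 2 ^ d
  set M : ℝ := 2 * (d * K) with hM
  have hd' : (1 : ℝ) ≤ d := by exact_mod_cast hd
  have hK1 : 1 ≤ K := by
    have h₁ : (1 : ℝ) ≤ d.factorial := by exact_mod_cast d.factorial_pos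
    exact one_le_mul_of_one_le_of_one_le h₁ (one_le_pow₀ one_le_two)
  have hM1 : 1 ≤ M := by nlinarith
  have hM0 : 0 < M := by linarith
  refine ⟨1 / (2 * (d * M ^ d)), by positivity, fun e _ => ?_⟩
  obtain ⟨ℓ, hℓ, hmax⟩ := Finset.exists_max_image (Finset.Icc 1 d) (fun p => M ^ p * |e p|)
    ⟨1, by simpa using hd⟩
  have hℓ' := Finset.mem_Icc.1 hℓ
  refine ⟨ℓ, hℓ'.1, hℓ'.2, fun s _ hs => ?_⟩
  have hsum : ∑ p ∈ Finset.Icc 1 d, |e p| ≤ d * (M ^ d * |e ℓ|) := by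
    have h₁ : ∀ p ∈ Finset.Icc 1 d, |e p| ≤ M ^ d * |e ℓ| := fun p hp =>
      calc |e p| ≤ M ^ p * |e p| := le_mul_of_one_le_left (abs_nonneg _) (one_le_pow₀ hM1)
        _ ≤ M ^ ℓ * |e ℓ| := hmax p hp
        _ ≤ M ^ d * |e ℓ| := by gcongr; exact hℓ'.2
    simpa using Finset.sum_le_card_nsmul _ _ _ h₁
  have hhigh : ∀ p ∈ Finset.Icc 1 d, ℓ < p → |e p| ≤ |e ℓ| / M := by
    intro p hp hlt
    rw [le_div_iff₀ hM0]
    have h₁ : M ^ ℓ * (|e p| * M) ≤ M ^ ℓ * |e ℓ| :=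
      calc M ^ ℓ * (|e p| * M) = M ^ (ℓ + 1) * |e p| := by ring
        _ ≤ M ^ p * |e p| := by gcongr; exact hlt
        _ ≤ M ^ ℓ * |e ℓ| := hmax p hp
    exact le_of_mul_le_mul_left h₁ (by positivity)
  have hrest : |∑ p ∈ (Finset.Icc 1 d).erase ℓ, e p * (p.descFactorial ℓ * s ^ (p - ℓ))| ≤
      |e ℓ| / 2 := by
    refine (Finset.abs_sum_le_sum_abs _ _).trans ?_
    have h₁ : ∀ p ∈ (Finset.Icc 1 d).erase ℓ,
        |e p * (p.descFactorial ℓ * s ^ (p - ℓ))| ≤ |e ℓ| / M * K := fun p hp =>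
      have hp' := Finset.mem_of_mem_erase hp
      abs_mul_descFactorial_mul_pow_le (Finset.mem_Icc.1 hp').2 (Finset.ne_of_mem_erase hp)
        (by positivity) (hhigh p hp') hs
    have hcard : (((Finset.Icc 1 d).erase ℓ).card : ℝ) ≤ d := by
      exact_mod_cast Finset.card_erase_le.trans_eq (by simp)
    calc _ ≤ (((Finset.Icc 1 d).erase ℓ).card : ℝ) * (|e ℓ| / M * K) := by
          simpa using Finset.sum_le_card_nsmul _ _ _ h₁
      _ ≤ d * (|e ℓ| / M * K) := by gcongr
      _ = |e ℓ| / 2 := by rw [hM]; field_simp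
  have hlead : |e ℓ| ≤ |e ℓ * (ℓ.descFactorial ℓ * s ^ (ℓ - ℓ))| := by
    have h₁ : (1 : ℝ) ≤ ℓ.factorial := by exact_mod_cast ℓ.factorial_pos
    rw [Nat.sub_self, pow_zero, mul_one, Nat.descFactorial_self, abs_mul, Nat.abs_cast]
    exact le_mul_of_one_le_right (abs_nonneg _) h₁
  rw [iteratedDeriv_sum_Icc_mul_pow,
    ← Finset.add_sum_erase _ (fun p => e p * (p.descFactorial ℓ * s ^ (p - ℓ))) hℓ]
  calc 1 / (2 * (d * M ^ d)) * ∑ p ∈ Finset.Icc 1 d, |e p|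
      ≤ 1 / (2 * (d * M ^ d)) * (d * (M ^ d * |e ℓ|)) := by gcongr
    _ = |e ℓ| / 2 := by field_simp
    _ ≤ _ := by
      have h₁ := abs_sub_abs_le_abs_add (e ℓ * (ℓ.descFactorial ℓ * s ^ (ℓ - ℓ)))
        (∑ p ∈ (Finset.Icc 1 d).erase ℓ, e p * (p.descFactorial ℓ * s ^ (p - ℓ)))
      linarith
end
end
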